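/- arXiv:1607.04911 — 12 statements merged into one kernel-verified Lean document; each statement's English description precedes it below -/
import Mathlib

section
/- There exists a constant C > 0 such that for all n, D ∈ ℕ with D ≥ 1 and n ≥ 2D, there exists a simple graph U whose number of vertices is at most C(⌊n/2⌋, ⌊D/2⌋) · 2^{C·√(D·log n)·log(n/D)} (as a real number, where C(a,b) denotes the binomial coefficient and log denotes logarithm base 2) such that every simple graph on n vertices with maximum degree at most D is an induced subgraph of U. -/
open Finset in
theorem disc_aux {ι : Type} [Fintype ι] (m : ℕ) (w : ι → Fin m → ℝ) (D l : ℝ)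
    (hw : ∀ v, ∑ j, (w v j) ^ 2 ≤ D) (s : Bool → ℝ) (hs1 : s true = -1) (hs0 : s false = 1) :
    ∃ ε : Fin m → Bool, ∀ v, l * |∑ j, s (ε j) * w v j| ≤
      Real.log (2 * Fintype.card ι) + l ^ 2 * D / 2 := by
  classical
  have key : ∀ (v : ι) (a : ℝ), a ^ 2 = l ^ 2 →
      ∑ ε : Fin m → Bool, Real.exp (a * ∑ j, s (ε j) * w v j) ≤
        2 ^ m * Real.exp (l ^ 2 * D / 2) := by
    intro v a ha
    have h1 : ∑ ε : Fin m → Bool, Real.exp (a * ∑ j, s (ε j) * w v j)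
        = ∏ j : Fin m, ∑ b : Bool, Real.exp (a * (s b * w v j)) := by
      rw [Finset.prod_univ_sum, Fintype.piFinset_univ]
      refine Finset.sum_congr rfl fun ε _ => ?_
      rw [Finset.mul_sum, Real.exp_sum]
    rw [h1]
    calc ∏ j : Fin m, ∑ b : Bool, Real.exp (a * (s b * w v j))
        ≤ ∏ j : Fin m, (2 * Real.exp (l ^ 2 * (w v j) ^ 2 / 2)) := by
          refine Finset.prod_le_prod (fun j _ => Finset.sum_nonneg fun b _ => (Real.exp_pos _).le) ?_
          intro j _
          have := Real.cosh_le_exp_half_sq (a * w v j)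
          rw [Real.cosh_eq, mul_pow, ha] at this
          rw [Fintype.sum_bool, hs1, hs0]
          have e1 : a * (-1 * w v j) = -(a * w v j) := by ring
          have e2 : a * (1 * w v j) = a * w v j := by ring
          rw [e1, e2]
          linarith
      _ = 2 ^ m * Real.exp (∑ j, l ^ 2 * (w v j) ^ 2 / 2) := by
          rw [Finset.prod_mul_distrib, Real.exp_sum]; simp
      _ ≤ _ := by
          rw [← Finset.sum_div, ← Finset.mul_sum]
          have := hw v
          gcongr
  have key2 : ∑ ε : Fin m → Bool, ∑ v : ι, Real.exp (l * |∑ j, s (ε j) * w v j|)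
      ≤ ∑ ε : Fin m → Bool, (2 * Fintype.card ι) * Real.exp (l ^ 2 * D / 2) := by
    rw [Finset.sum_comm]
    calc _ ≤ ∑ v : ι, (2 * (2 ^ m * Real.exp (l ^ 2 * D / 2))) := by
          refine Finset.sum_le_sum fun v _ => ?_
          have a1 := key v l rfl
          have a2 := key v (-l) (by ring)
          have : ∑ ε : Fin m → Bool, Real.exp (l * |∑ j, s (ε j) * w v j|) ≤
             ∑ ε : Fin m → Bool, (Real.exp (l * ∑ j, s (ε j) * w v j)
              + Real.exp (-l * ∑ j, s (ε j) * w v j)) := by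
            refine Finset.sum_le_sum fun ε _ => ?_
            have p1 := Real.exp_pos (l * ∑ j, s (ε j) * w v j)
            have p2 := Real.exp_pos (-l * ∑ j, s (ε j) * w v j)
            rcases abs_cases (∑ j, s (ε j) * w v j) with ⟨h, _⟩ | ⟨h, _⟩
            · rw [h]; linarith
            · rw [h, mul_neg, ← neg_mul]; linarith
          rw [Finset.sum_add_distrib] at this
          linarith
      _ = _ := by simp; ring
  obtain ⟨ε, -, hε⟩ := Finset.exists_le_of_sum_le (Finset.univ_nonempty) key2
  refine ⟨ε, fun v => ?_⟩
  have h3 : Real.exp (l * |∑ j, s (ε j) * w v j|) ≤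
      (2 * Fintype.card ι) * Real.exp (l ^ 2 * D / 2) :=
    (Finset.single_le_sum (f := fun v => Real.exp (l * |∑ j, s (ε j) * w v j|))
      (fun v _ => (Real.exp_pos _).le) (Finset.mem_univ v)).trans hε
  have hc : (0 : ℝ) < 2 * Fintype.card ι := by
    have : 0 < Fintype.card ι := Fintype.card_pos_iff.2 ⟨v⟩
    positivity
  rw [← Real.exp_log hc, ← Real.exp_add, Real.exp_le_exp] at h3
  exact h3

/-- Labels: a pair `(i, c)` and a small subset of `Fin m`. -/
abbrev ULab (m K : ℕ) : Type := (Fin m × Bool) × {S : Finset (Fin m) // S.card ≤ K}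

def UFwd {m : ℕ} (x y : Fin m × Bool) : Prop := y.2 = (x.2 ^^ decide (y.1 ≤ x.1))

def UGraph (m K : ℕ) : SimpleGraph (ULab m K) where
  Adj x y := x.1 ≠ y.1 ∧ ((UFwd x.1 y.1 ∧ y.1.1 ∈ x.2.1) ∨ (UFwd y.1 x.1 ∧ x.1.1 ∈ y.2.1))
  symm := ⟨fun x y h => ⟨h.1.symm, h.2.symm⟩⟩
  loopless := ⟨fun x h => h.1 rfl⟩

theorem fwd_total {m : ℕ} (x y : Fin m × Bool) (h : x ≠ y) : UFwd x y ∨ UFwd y x := by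
  obtain ⟨i, b⟩ := x
  obtain ⟨j, c⟩ := y
  unfold UFwd
  rcases lt_trichotomy i j with h1 | h1 | h1
  · have := h1.le
    have := not_le.2 h1
    cases b <;> cases c <;> simp_all
  · subst h1
    cases b <;> cases c <;> simp_all
  · have := h1.le
    have := not_le.2 h1
    cases b <;> cases c <;> simp_all

open Classical in
noncomputable def lab {m : ℕ} (G : SimpleGraph (Fin m × Bool)) (ε : Fin m → Bool)
    (v : Fin m × Bool) : Finset (Fin m) :=
  Finset.univ.filter fun j => G.Adj v (j, (v.2 ^^ ε v.1 ^^ decide (j ≤ v.1) ^^ ε j))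

theorem embed_aux {m K : ℕ} (G : SimpleGraph (Fin m × Bool)) (ε : Fin m → Bool)
    (h : ∀ v, (lab G ε v).card ≤ K) : Nonempty (G ↪g UGraph m K) := by
  have hfwd : ∀ x y : Fin m × Bool, UFwd (x.1, (x.2 ^^ ε x.1)) (y.1, (y.2 ^^ ε y.1)) →
      (y.1 ∈ lab G ε x ↔ G.Adj x y) := by
    intro x y hf
    unfold UFwd at hf
    simp only at hf
    have : (x.2 ^^ ε x.1 ^^ decide (y.1 ≤ x.1) ^^ ε y.1) = y.2 := by
      rw [← hf]; simp
    simp only [lab, Finset.mem_filter, Finset.mem_univ, true_and]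
    rw [this]
  have hinj : ∀ x y : Fin m × Bool, (x.1, (x.2 ^^ ε x.1)) = (y.1, (y.2 ^^ ε y.1)) → x = y := by
    rintro ⟨i, b⟩ ⟨j, c⟩ h
    simp only [Prod.mk.injEq] at h
    obtain ⟨rfl, h⟩ := h
    simpa using h
  refine ⟨⟨⟨fun v => ((v.1, (v.2 ^^ ε v.1)), ⟨lab G ε v, h v⟩), ?_⟩, ?_⟩⟩
  · intro x y hxy
    exact hinj x y (congrArg Prod.fst hxy)
  · intro x y
    simp only [UGraph, Function.Embedding.coeFn_mk]
    constructor
    · rintro ⟨-, h | h⟩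
      · exact (hfwd x y h.1).1 h.2
      · exact ((hfwd y x h.1).1 h.2).symm
    · intro hadj
      have hne : (x.1, (x.2 ^^ ε x.1)) ≠ (y.1, (y.2 ^^ ε y.1)) := fun h => hadj.ne (hinj x y h)
      refine ⟨hne, ?_⟩
      rcases fwd_total _ _ hne with h | h
      · exact Or.inl ⟨h, (hfwd x y h).2 hadj⟩
      · exact Or.inr ⟨h, (hfwd y x h).2 hadj.symm⟩

theorem lab_bound {m D : ℕ} (G : SimpleGraph (Fin m × Bool))
    (hG : ∀ v, (G.neighborSet v).ncard ≤ D) (l : ℝ) :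
    ∃ ε : Fin m → Bool, ∀ v, l * (2 * ((lab G ε v).card : ℝ) - D) ≤ 
      Real.log (4 * m) + l ^ 2 * D / 2 ∨ l < 0 := by
  classical
  rcases lt_or_ge l 0 with hl | hl
  · exact ⟨fun _ => true, fun _ => Or.inr hl⟩
  let s : Bool → ℝ := fun b => if b then -1 else 1
  let A : Fin m × Bool → Fin m → Bool → ℝ := fun v j b => if G.Adj v (j, b) then 1 else 0
  let w : Fin m × Bool → Fin m → ℝ := fun v j => s (decide (j ≤ v.1)) * (A v j false - A v j true)
  have hdeg : ∀ v, ∑ j, (A v j false + A v j true) ≤ D := by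
    intro v
    have h1 : ∑ j, (A v j false + A v j true) = ((G.neighborSet v).ncard : ℝ) := by
      rw [Set.ncard_eq_toFinset_card']
      have : (G.neighborSet v).toFinset = Finset.univ.filter fun p => G.Adj v p := by
        ext p; simp
      rw [this, Finset.card_filter, Fintype.sum_prod_type]
      push_cast
      refine Finset.sum_congr rfl fun j _ => ?_
      rw [Fintype.sum_bool]
      simp only [A]
      ring
    rw [h1]; exact_mod_cast hG v
  have hw : ∀ v, ∑ j, (w v j) ^ 2 ≤ (D : ℝ) := by
    intro v
    refine le_trans (Finset.sum_le_sum fun j _ => ?_) (hdeg v)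
    simp only [w, A, s]
    split_ifs <;> norm_num
  obtain ⟨ε, hε⟩ := disc_aux m w D l hw s rfl rfl
  refine ⟨ε, fun v => Or.inl ?_⟩
  have hsx : ∀ a b, s (a ^^ b) = s a * s b := by
    intro a b; cases a <;> cases b <;> simp [s]
  have hcard : 2 * ((lab G ε v).card : ℝ) = ∑ j, (A v j false + A v j true)
      + s v.2 * s (ε v.1) * ∑ j, s (ε j) * w v j := by
    rw [lab, Finset.card_filter, Finset.mul_sum, ← Finset.sum_add_distrib]
    push_cast
    rw [Finset.mul_sum]
    refine Finset.sum_congr rfl fun j _ => ?_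
    have hb : ∀ b, 2 * A v j b = A v j false + A v j true + s b * (A v j false - A v j true) := by
      intro b; cases b <;> simp [s] <;> ring
    have := hb (v.2 ^^ ε v.1 ^^ decide (j ≤ v.1) ^^ ε j)
    rw [hsx, hsx, hsx] at this
    simp only [w]
    simp only [A] at this ⊢
    rw [this]; ring
  have habs : ∀ b, |s b| = 1 := by intro b; cases b <;> simp [s]
  have h2 : s v.2 * s (ε v.1) * ∑ j, s (ε j) * w v j ≤ |∑ j, s (ε j) * w v j| := by
    refine (le_abs_self _).trans ?_
    rw [abs_mul, abs_mul, habs, habs]; simp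
  have h3 := hε v
  have h4 : Real.log (2 * (Fintype.card (Fin m × Bool) : ℝ)) = Real.log (4 * m) := by
    congr 1; simp; ring
  rw [h4] at h3
  refine le_trans (mul_le_mul_of_nonneg_left ?_ hl) h3
  have := hdeg v
  linarith

theorem choose_bound (m n D k : ℕ) (hD : 1 ≤ D) (hn : 2 * D ≤ n) (hm : m = (n + 1) / 2)
    (hk : k = D / 2) (s : ℕ) :
    (m.choose (k + s) : ℝ) ≤ m.choose k * ((n : ℝ) / D) ^ s := by
  have hD0 : (0 : ℝ) < D := by exact_mod_cast hD
  induction s with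
  | zero => simp
  | succ s ih =>
    have h1 := Nat.choose_succ_right_eq m (k + s)
    have h2 : (m.choose (k + s + 1) : ℝ) * (k + s + 1) ≤ m.choose (k + s) * m := by
      have : m.choose (k + s + 1) * (k + s + 1) ≤ m.choose (k + s) * m := by
        rw [h1]; exact Nat.mul_le_mul_left _ (Nat.sub_le _ _)
      exact_mod_cast this
    have h3 : (m : ℝ) * D ≤ n * (k + s + 1) := by
      have : m * D ≤ n * (k + s + 1) := by
        have a1 : 2 * m ≤ n + 1 := by omega
        have a2 : D + 1 ≤ 2 * (k + s + 1) := by omega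
        nlinarith
      exact_mod_cast this
    have h4 : (0 : ℝ) < k + s + 1 := by positivity
    have h5 : (m : ℝ) / (k + s + 1) ≤ n / D := by
      rw [div_le_div_iff₀ h4 hD0]; exact h3
    calc (m.choose (k + (s + 1)) : ℝ) ≤ m.choose (k + s) * (m / (k + s + 1)) := by
          rw [← mul_div_assoc, le_div_iff₀ h4]; exact h2
      _ ≤ (m.choose k * ((n : ℝ) / D) ^ s) * (n / D) := by gcongr
      _ = _ := by ring

theorem card_bound (m n D k r : ℕ) (hD : 1 ≤ D) (hn : 2 * D ≤ n) (hm : m = (n + 1) / 2)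
    (hk : k = D / 2) :
    (Fintype.card (ULab m (k + r)) : ℝ) ≤
      (n : ℝ) ^ 4 * ((n / 2).choose (D / 2) * ((n : ℝ) / D) ^ r) := by
  have hD0 : (0 : ℝ) < D := by exact_mod_cast hD
  have hnD : (1 : ℝ) ≤ n / D := by
    rw [le_div_iff₀ hD0]
    have : D ≤ n := by omega
    rw [one_mul]; exact_mod_cast this
  have hterm : ∀ i, i ≤ k + r → (m.choose i : ℝ) ≤ m.choose k * ((n : ℝ) / D) ^ r := by
    intro i hi
    rcases le_total i k with h | h
    · have h1 : m.choose i ≤ m.choose k := by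
        obtain ⟨t, rfl⟩ := Nat.exists_eq_add_of_le h
        clear h hi
        have hkm : i + t ≤ m / 2 := by omega
        clear hk
        induction t with
        | zero => exact le_rfl
        | succ t ih =>
          exact (ih (by omega)).trans (Nat.choose_le_succ_of_lt_half_left (by omega))
      have h1' : (m.choose i : ℝ) ≤ m.choose k := by exact_mod_cast h1
      exact h1'.trans (le_mul_of_one_le_right (by positivity) (one_le_pow₀ hnD))
    · obtain ⟨s, rfl⟩ := Nat.exists_eq_add_of_le h
      refine (choose_bound m n D k hD hn hm hk s).trans ?_
      have hsr : s ≤ r := by omega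
      gcongr
  have hS : (Fintype.card {S : Finset (Fin m) // S.card ≤ k + r} : ℝ) ≤
      (m + 1) * (m.choose k * ((n : ℝ) / D) ^ r) := by
    have h1 : Fintype.card {S : Finset (Fin m) // S.card ≤ k + r} =
        ∑ i ∈ Finset.range (m + 1), if i ≤ k + r then m.choose i else 0 := by
      rw [Fintype.card_subtype, Finset.card_filter, ← Finset.powerset_univ,
        Finset.sum_powerset]
      simp only [Finset.card_univ, Fintype.card_fin]
      refine Finset.sum_congr rfl fun i _ => ?_
      rw [Finset.sum_congr rfl (g := fun _ => if i ≤ k + r then 1 else 0)]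
      · simp
      · intro x hx
        rw [(Finset.mem_powersetCard.1 hx).2]
    rw [h1]
    push_cast
    calc _ ≤ ∑ i ∈ Finset.range (m + 1), (m.choose k * ((n : ℝ) / D) ^ r) := by
          refine Finset.sum_le_sum fun i _ => ?_
          split_ifs with h
          · exact hterm i h
          · positivity
      _ = _ := by simp
  have hch : (m.choose k : ℝ) ≤ n * (n / 2).choose (D / 2) := by
    have : m.choose k ≤ n * (n / 2).choose (D / 2) := by
      subst hk
      rcases Nat.even_or_odd' n with ⟨t, ht | ht⟩
      · have e1 : m = n / 2 := by omega
        rw [e1]; exact Nat.le_mul_of_pos_left _ (by omega)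
      · have e1 : m = n / 2 + 1 := by omega
        rw [e1]
        have h := Nat.choose_mul_succ_eq (n / 2) (D / 2)
        have : 1 ≤ n / 2 + 1 - D / 2 := by omega
        calc (n / 2 + 1).choose (D / 2) ≤ (n / 2 + 1).choose (D / 2) * (n / 2 + 1 - D / 2) :=
              Nat.le_mul_of_pos_right _ this
          _ = (n / 2).choose (D / 2) * (n / 2 + 1) := h.symm
          _ ≤ (n / 2).choose (D / 2) * n := Nat.mul_le_mul_left _ (by omega)
          _ = _ := mul_comm _ _
    exact_mod_cast this
  have h2m : (m : ℝ) * 2 ≤ n ^ 2 := by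
    have : m * 2 ≤ n ^ 2 := by
      have : m * 2 ≤ n + 1 := by omega
      have : 2 ≤ n := by omega
      nlinarith
    exact_mod_cast this
  have hm1 : (m : ℝ) + 1 ≤ n := by
    have : m + 1 ≤ n := by omega
    exact_mod_cast this
  rw [Fintype.card_prod, Fintype.card_prod, Fintype.card_fin, Fintype.card_bool]
  push_cast
  calc _ ≤ (n : ℝ) ^ 2 * (n * ((n * (n / 2).choose (D / 2)) * ((n : ℝ) / D) ^ r)) := by
        refine mul_le_mul h2m (hS.trans ?_) (by positivity) (by positivity)
        gcongr
    _ = _ := by ring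


/-- There is a constant `C > 0` such that for all `n, D` with `D ≥ 1` and
`n ≥ 2D`, there is an induced universal graph with at most
`(⌊n/2⌋ choose ⌊D/2⌋) · 2^(C·√(D·log n)·log(n/D))` vertices for the family of graphs on `n`
vertices with maximum degree at most `D` (logarithms base 2). -/
theorem statement3 :
    ∃ C : ℝ, 0 < C ∧ ∀ n D : ℕ, 1 ≤ D → 2 * D ≤ n →
      ∃ (V : Type) (_ : Fintype V) (U : SimpleGraph V),
        (Fintype.card V : ℝ) ≤
            (Nat.choose (n / 2) (D / 2) : ℝ) *
              2 ^ (C * Real.sqrt (D * Real.logb 2 n) * Real.logb 2 ((n : ℝ) / D)) ∧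
        ∀ G : SimpleGraph (Fin n),
          (∀ v : Fin n, (G.neighborSet v).ncard ≤ D) → Nonempty (G ↪g U) := by
  refine ⟨11, by norm_num, fun n D hD hn => ?_⟩
  have hD0 : (0 : ℝ) < D := by exact_mod_cast hD
  have hD1 : (1 : ℝ) ≤ D := by exact_mod_cast hD
  have hn2 : 2 ≤ n := by omega
  have hn2' : (2 : ℝ) ≤ n := by exact_mod_cast hn2
  have hn0 : (0 : ℝ) < n := by linarith
  set L := Real.logb 2 n with hL
  set l := Real.logb 2 ((n : ℝ) / D) with hl
  set Q := Real.sqrt (D * L) with hQ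
  have hL1 : 1 ≤ L := by
    rw [hL, Real.le_logb_iff_rpow_le (by norm_num) hn0]; simpa using hn2'
  have hl1 : 1 ≤ l := by
    rw [hl, Real.le_logb_iff_rpow_le (by norm_num) (by positivity), Real.rpow_one,
      le_div_iff₀ hD0]
    exact_mod_cast hn
  have hQ2 : Q ^ 2 = D * L := Real.sq_sqrt (by positivity)
  have hQ1 : 1 ≤ Q := by
    rw [hQ, Real.one_le_sqrt]; nlinarith
  have hnL : (n : ℝ) = 2 ^ L := (Real.rpow_logb (by norm_num) (by norm_num) hn0).symm
  have hnl : (n : ℝ) / D = 2 ^ l :=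
    (Real.rpow_logb (by norm_num) (by norm_num) (by positivity)).symm
  -- comparison of L with Q * l
  have hLQ : L ≤ 2 * Q * l := by
    have h1 : L = Real.logb 2 D + l := by
      rw [hl, Real.logb_div hn0.ne' hD0.ne']; ring
    have h2 : Real.logb 2 D ≤ D := by
      rw [Real.logb_le_iff_le_rpow (by norm_num) hD0, Real.rpow_natCast]
      exact_mod_cast Nat.lt_two_pow_self.le
    have h3 : L ≤ 2 * D * l ^ 2 := by
      have : (1 : ℝ) ≤ l ^ 2 := one_le_pow₀ hl1
      have : l ≤ l ^ 2 := by nlinarith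
      nlinarith
    refine (abs_le_of_sq_le_sq' ?_ (by positivity)).2
    have : (2 * Q * l) ^ 2 = 4 * (D * L) * l ^ 2 := by rw [← hQ2]; ring
    rw [this]
    nlinarith [mul_le_mul_of_nonneg_left h3 (by linarith : 0 ≤ L), mul_nonneg (mul_nonneg hD0.le (by linarith : 0 ≤ L)) (sq_nonneg l)]
  set m := (n + 1) / 2 with hm
  set k := D / 2 with hk
  set r := ⌊3 * Q⌋₊ with hr
  have hrQ : (r : ℝ) ≤ 3 * Q := Nat.floor_le (by linarith)
  refine ⟨ULab m (k + r), inferInstance, UGraph m (k + r), ?_, ?_⟩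
  · refine (card_bound m n D k r hD hn hm hk).trans ?_
    have e : (n : ℝ) ^ 4 * ((n : ℝ) / D) ^ r ≤ 2 ^ (11 * Q * l) := by
      rw [hnl, hnL, ← Real.rpow_natCast, ← Real.rpow_natCast, ← Real.rpow_mul (by norm_num),
        ← Real.rpow_mul (by norm_num), ← Real.rpow_add (by norm_num)]
      refine Real.rpow_le_rpow_of_exponent_le (by norm_num) ?_
      push_cast
      nlinarith
    calc _ = ((n / 2).choose (D / 2) : ℝ) * ((n : ℝ) ^ 4 * ((n : ℝ) / D) ^ r) := by ring
      _ ≤ _ := mul_le_mul_of_nonneg_left e (by positivity)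
  · intro G hG
    have hcard : Fintype.card (Fin n) ≤ Fintype.card (Fin m × Bool) := by
      simp; omega
    obtain ⟨e⟩ := Function.Embedding.nonempty_of_card_le hcard
    have hG' : ∀ v, ((G.map e).neighborSet v).ncard ≤ D := by
      intro v
      by_cases hv : ∃ u, e u = v
      · obtain ⟨u, rfl⟩ := hv
        have : (G.map e).neighborSet (e u) = e '' G.neighborSet u := by
          ext p
          simp only [SimpleGraph.mem_neighborSet, SimpleGraph.map_adj, Set.mem_image]
          constructor
          · rintro ⟨a, b, hab, h1, h2⟩
            rw [e.injective h1] at hab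
            exact ⟨b, hab, h2⟩
          · rintro ⟨b, hab, h2⟩
            exact ⟨u, b, hab, rfl, h2⟩
        rw [this, Set.ncard_image_of_injective _ e.injective]
        exact hG u
      · have : (G.map e).neighborSet v = ∅ := by
          ext p
          simp only [SimpleGraph.mem_neighborSet, SimpleGraph.map_adj, Set.mem_empty_iff_false,
            iff_false]
          rintro ⟨a, b, hab, h1, h2⟩
          exact hv ⟨a, h1⟩
        rw [this]; simp
    obtain ⟨ε, hε⟩ := lab_bound (G.map e) hG' (Q / D)
    have hlab : ∀ v, (lab (G.map e) ε v).card ≤ k + r := by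
      intro v
      have hpos : 0 < Q / D := by positivity
      have h1 := (hε v).resolve_right (not_lt.2 hpos.le)
      have hlog : Real.log (4 * m) ≤ 3 * L := by
        have a1 : (4 * m : ℝ) ≤ (n : ℝ) ^ 3 := by
          have : 4 * m ≤ n ^ 3 := by
            have b1 : 4 * m ≤ 2 * n + 2 := by omega
            have b2 : 4 ≤ n ^ 2 := by nlinarith
            nlinarith
          exact_mod_cast this
        have a2 : (0 : ℝ) < 4 * m := by
          have : 0 < m := by omega
          positivity
        have a3 := Real.log_le_log a2 a1
        rw [Real.log_pow] at a3
        have a4 : Real.log n ≤ L := by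
          rw [hL, Real.logb, le_div_iff₀ (Real.log_pos (by norm_num))]
          have := Real.log_nonneg (by linarith : (1 : ℝ) ≤ n)
          have := Real.log_two_lt_d9
          nlinarith
        push_cast at a3
        linarith
      have h2 : (Q / D) ^ 2 * D / 2 = L / 2 := by
        rw [div_pow, hQ2]; field_simp
      have h3 : (Q / D) * (2 * ((lab (G.map e) ε v).card : ℝ) - D) ≤ (Q / D) * (3.5 * Q) := by
        have : (Q / D) * (3.5 * Q) = 3.5 * L := by
          have : (Q / D) * (3.5 * Q) = 3.5 * Q ^ 2 / D := by ring
          rw [this, hQ2]; field_simp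
        rw [this]; linarith
      have h4 := le_of_mul_le_mul_left h3 hpos
      have hkD : (D : ℝ) ≤ 2 * k + 1 := by
        have : D ≤ 2 * k + 1 := by omega
        exact_mod_cast this
      have h5 : (((lab (G.map e) ε v).card - k : ℕ) : ℝ) ≤ 3 * Q := by
        rcases le_total k (lab (G.map e) ε v).card with h | h
        · rw [Nat.cast_sub h]; linarith
        · rw [Nat.sub_eq_zero_of_le h]; simp; linarith
      have := Nat.le_floor h5
      omega
    obtain ⟨f⟩ := embed_aux (G.map e) ε hlab
    exact ⟨(SimpleGraph.Embedding.map e G).trans f⟩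
end

section
/- Let n, D be positive integers with n even. The number of simple graphs on the labeled vertex set {0,…,n−1} with maximum degree at most D is at least ((n/2)!)^D / D^{D·n/2} (as a real number). -/
theorem aux_ncard_range {α : Type*} {D : ℕ} (f : Fin D → α) : (Set.range f).ncard ≤ D := by
  rw [← Set.image_univ]
  refine (Set.ncard_image_le Set.finite_univ).trans ?_
  simp [Set.ncard_univ]

def auxG {n m D : ℕ} (e : Fin n ≃ Fin m ⊕ Fin m) (s : Fin D → Equiv.Perm (Fin m)) :
    SimpleGraph (Fin n) where
  Adj x y := (∃ i a, e x = Sum.inl a ∧ e y = Sum.inr (s i a)) ∨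
    (∃ i a, e y = Sum.inl a ∧ e x = Sum.inr (s i a))
  symm := ⟨fun _ _ h => h.symm⟩
  loopless := ⟨by
    rintro x (⟨i, a, h1, h2⟩ | ⟨i, a, h1, h2⟩) <;> simp [h1] at h2⟩

theorem auxG_deg {n m D : ℕ} (e : Fin n ≃ Fin m ⊕ Fin m) (s : Fin D → Equiv.Perm (Fin m))
    (v : Fin n) : ((auxG e s).neighborSet v).ncard ≤ D := by
  rcases h : e v with a | b
  · refine (Set.ncard_le_ncard (t := Set.range fun i => e.symm (Sum.inr (s i a))) ?_
      (Set.toFinite _)).trans (aux_ncard_range _)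
    rintro w (⟨i, a', h1, h2⟩ | ⟨i, a', h1, h2⟩)
    · rw [h] at h1
      cases h1
      exact ⟨i, by simp [← h2]⟩
    · simp [h] at h2
  · refine (Set.ncard_le_ncard (t := Set.range fun i => e.symm (Sum.inl ((s i).symm b))) ?_
      (Set.toFinite _)).trans (aux_ncard_range _)
    rintro w (⟨i, a', h1, h2⟩ | ⟨i, a', h1, h2⟩)
    · simp [h] at h1
    · rw [h] at h2
      cases h2
      exact ⟨i, by simp [← h1]⟩

open Classical in
theorem aux_main (m n D : ℕ) (e : Fin n ≃ Fin m ⊕ Fin m) :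
    (Nat.factorial m) ^ D ≤ D ^ (D * m) *
      {G : SimpleGraph (Fin n) | ∀ v : Fin n, (G.neighborSet v).ncard ≤ D}.ncard := by
  rw [Set.ncard_eq_toFinset_card']
  have key := Finset.card_le_mul_card_image_of_maps_to
    (s := (Finset.univ : Finset (Fin D → Equiv.Perm (Fin m))))
    (t := {G : SimpleGraph (Fin n) | ∀ v : Fin n, (G.neighborSet v).ncard ≤ D}.toFinset)
    (f := auxG e) (by
      intro s _
      simpa using auxG_deg e s) (D ^ (D * m)) ?_
  · simpa [Fintype.card_perm] using key
  · intro G hG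
    have hG' : ∀ v : Fin n, (G.neighborSet v).ncard ≤ D := by simpa using hG
    have := Finset.card_le_card_of_injOn
      (s := Finset.univ.filter fun s : Fin D → Equiv.Perm (Fin m) => auxG e s = G)
      (t := Fintype.piFinset fun p : Fin D × Fin m =>
        (G.neighborSet (e.symm (Sum.inl p.2))).toFinset)
      (fun s p => e.symm (Sum.inr (s p.1 p.2))) ?_ ?_
    · refine this.trans ?_
      rw [Fintype.card_piFinset]
      refine (Finset.prod_le_pow_card _ _ D ?_).trans ?_
      · intro p _
        rw [← Set.ncard_eq_toFinset_card']
        exact hG' _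
      · simp
    · intro s hs
      have hs' : auxG e s = G := by simpa using hs
      subst hs'
      simp only [Finset.mem_coe, Fintype.mem_piFinset, Set.mem_toFinset]
      intro p
      exact Or.inl ⟨p.1, p.2, by simp, by simp⟩
    · intro s _ t _ h
      funext i
      ext a
      have := congrFun h (i, a)
      simp at this
      rw [this]

/-- For positive integers `n, D` with `n` even, the number of simple graphs
on the labeled vertex set `Fin n` with maximum degree at most `D` is at least
`((n/2)!)^D / D^(D·n/2)`. -/
theorem statement4 (n D : ℕ) (hn : 1 ≤ n) (hD : 1 ≤ D) (heven : Even n) :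
    ((Nat.factorial (n / 2) : ℝ)) ^ D / (D : ℝ) ^ (D * n / 2) ≤
      ({G : SimpleGraph (Fin n) | ∀ v : Fin n, (G.neighborSet v).ncard ≤ D}.ncard : ℝ) := by
  obtain ⟨m, rfl⟩ := heven
  have h1 : (m + m) / 2 = m := by omega
  have h2 : D * (m + m) / 2 = D * m := by
    rw [show D * (m + m) = D * m * 2 by ring]
    simp
  rw [h1, h2]
  have hD' : (0 : ℝ) < (D : ℝ) ^ (D * m) := by
    have : (0 : ℝ) < D := by exact_mod_cast hD
    positivity
  rw [div_le_iff₀' hD']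
  exact_mod_cast aux_main m (m + m) D finSumFinEquiv.symm
end

section
/- There exists a constant c > 0 such that for all n, D ∈ ℕ with 1 ≤ D ≤ n, every simple graph U having the property that every simple graph on n vertices with maximum degree at most D is an induced subgraph of U must have at least c · (n/(2eD))^{D/2} vertices (as a real number, where e is Euler's number). -/
theorem aux_count (m n D : ℕ) (hmn : 2 * m ≤ n)
    (V : Type) [Fintype V] (U : SimpleGraph V)
    (hU : ∀ G : SimpleGraph (Fin n),
            (∀ v : Fin n, (G.neighborSet v).ncard ≤ D) → Nonempty (G ↪g U)) :
    (m.factorial) ^ D ≤ (Fintype.card V) ^ (2 * m) * D ^ (m * D) := by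
  classical
  let L : Fin m → Fin n := fun a => ⟨a, by omega⟩
  let R : Fin m → Fin n := fun b => ⟨m + b, by omega⟩
  have hLR : ∀ a b, L a ≠ R b := by
    intro a b h
    have := congrArg Fin.val h
    simp only [L, R] at this
    omega
  have hL : ∀ a b, L a = L b → a = b := by
    intro a b h
    have := congrArg Fin.val h
    simp only [L] at this
    exact Fin.ext this
  have hR : ∀ a b, R a = R b → a = b := by
    intro a b h
    have := congrArg Fin.val h
    simp only [R] at this
    exact Fin.ext (by omega)
  let G : (Fin D → Equiv.Perm (Fin m)) → SimpleGraph (Fin n) := fun σ =>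
    SimpleGraph.fromRel (fun u v => ∃ i a, u = L a ∧ v = R (σ i a))
  have hG : ∀ σ a b, (G σ).Adj (L a) (R b) ↔ ∃ i, σ i a = b := by
    intro σ a b
    simp only [G, SimpleGraph.fromRel_adj]
    constructor
    · rintro ⟨_, ⟨i, a', h1, h2⟩ | ⟨i, a', h1, h2⟩⟩
      · exact ⟨i, by rw [hL _ _ h1, hR _ _ h2]⟩
      · exact absurd h2 (hLR _ _)
    · rintro ⟨i, rfl⟩
      exact ⟨hLR _ _, Or.inl ⟨i, a, rfl, rfl⟩⟩
  have hdeg : ∀ σ v, ((G σ).neighborSet v).ncard ≤ D := by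
    intro σ v
    have key : ∃ f : Fin D → Fin n, (G σ).neighborSet v ⊆ Set.range f := by
      by_cases h1 : ∃ a, v = L a
      · obtain ⟨a, rfl⟩ := h1
        refine ⟨fun i => R (σ i a), ?_⟩
        rintro w hw
        simp only [G, SimpleGraph.mem_neighborSet, SimpleGraph.fromRel_adj] at hw
        obtain ⟨_, ⟨i, a', h1, h2⟩ | ⟨i, a', h1, h2⟩⟩ := hw
        · exact ⟨i, by rw [hL _ _ h1, h2]⟩
        · exact absurd h2 (hLR _ _)
      · by_cases h2 : ∃ b, v = R b
        · obtain ⟨b, rfl⟩ := h2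
          refine ⟨fun i => L ((σ i).symm b), ?_⟩
          rintro w hw
          simp only [G, SimpleGraph.mem_neighborSet, SimpleGraph.fromRel_adj] at hw
          obtain ⟨_, ⟨i, a', h1, h2⟩ | ⟨i, a', h1, h2⟩⟩ := hw
          · exact absurd h1.symm (hLR _ _)
          · exact ⟨i, by rw [hR _ _ h2, h1]; simp⟩
        · have he : (G σ).neighborSet v = ∅ := by
            ext w
            simp only [G, SimpleGraph.mem_neighborSet, SimpleGraph.fromRel_adj,
              Set.mem_empty_iff_false, iff_false]
            rintro ⟨_, ⟨i, a', h3, h4⟩ | ⟨i, a', h3, h4⟩⟩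
            · exact h1 ⟨_, h3⟩
            · exact h2 ⟨_, h4⟩
          exact ⟨fun _ => v, by rw [he]; exact Set.empty_subset _⟩
    obtain ⟨f, hf⟩ := key
    calc _ ≤ (Set.range f).ncard := Set.ncard_le_ncard hf (Set.toFinite _)
      _ ≤ D := by
        rw [← Set.image_univ]
        refine (Set.ncard_image_le (Set.toFinite _)).trans ?_
        simp
  let φ : ∀ σ, G σ ↪g U := fun σ => (hU (G σ) (hdeg σ)).some
  let F : (Fin D → Equiv.Perm (Fin m)) → (Fin m → V) × (Fin m → V) :=
    fun σ => (fun a => φ σ (L a), fun b => φ σ (R b))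
  have hF : ∀ σ σ', F σ = F σ' → ∀ i a, ∃ j, σ' j a = σ i a := by
    intro σ σ' h i a
    have h1 := congrFun (congrArg Prod.fst h) a
    have h2 := congrFun (congrArg Prod.snd h) (σ i a)
    simp only [F] at h1 h2
    rw [← hG, ← (φ σ').map_adj_iff, ← h1, ← h2, (φ σ).map_adj_iff, hG]
    exact ⟨i, rfl⟩
  let T : (Fin m → V) × (Fin m → V) → (Fin D → Equiv.Perm (Fin m)) := Function.invFun F
  have hT : ∀ σ, F (T (F σ)) = F σ := fun σ => Function.invFun_eq ⟨σ, rfl⟩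
  have hc : ∀ σ, ∀ i a, ∃ j, T (F σ) j a = σ i a := fun σ => hF _ _ (hT σ).symm
  choose h hh using hc
  have hinj : Function.Injective
      (fun σ => (F σ, h σ) : (Fin D → Equiv.Perm (Fin m)) →
        ((Fin m → V) × (Fin m → V)) × (Fin D → Fin m → Fin D)) := by
    intro σ σ' e
    have e1 : F σ = F σ' := congrArg Prod.fst e
    have e2 : h σ = h σ' := congrArg Prod.snd e
    funext i
    ext a
    rw [← hh σ i a, ← hh σ' i a, e1, e2]
  have := Fintype.card_le_of_injective _ hinj
  simp only [Fintype.card_pi, Fintype.card_prod, Finset.prod_const, Finset.card_univ,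
    Fintype.card_fin, Fintype.card_perm] at this
  rw [pow_mul D, two_mul, pow_add]
  exact this

theorem aux_sq (m D : ℕ) (hm : 1 ≤ m) (hD : 1 ≤ D) (N : ℕ)
    (h : (m.factorial) ^ D ≤ N ^ (2 * m) * D ^ (m * D)) :
    ((m : ℝ) / (Real.exp 1 * D)) ^ D ≤ (N : ℝ) ^ 2 := by
  have hD' : (0 : ℝ) < D := by exact_mod_cast hD
  have hR : ((m.factorial : ℝ)) ^ D ≤ (N : ℝ) ^ (2 * m) * (D : ℝ) ^ (m * D) := by
    exact_mod_cast h
  have h1 : (m : ℝ) ^ m ≤ Real.exp 1 ^ m * m.factorial := by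
    have := Real.pow_div_factorial_le_exp (m : ℝ) (by positivity) m
    rw [div_le_iff₀ (by positivity)] at this
    rwa [← Real.exp_nat_mul, mul_one]
  have h2 : ((m : ℝ) / Real.exp 1) ^ m ≤ m.factorial := by
    rw [div_pow, div_le_iff₀ (by positivity), mul_comm]
    exact h1
  refine le_of_pow_le_pow_left₀ (n := m) (by omega) (by positivity) ?_
  rw [← div_div, div_pow, div_pow _ _ m, ← pow_mul (D : ℝ), div_le_iff₀ (by positivity), ← pow_mul,
    ← pow_mul (N : ℝ), mul_comm D m, pow_mul]
  exact (pow_le_pow_left₀ (by positivity) h2 D).trans hR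

/-- There is a constant `c > 0` such that for all `n, D` with `1 ≤ D ≤ n`,
every induced universal graph for the family of graphs on `n` vertices with maximum degree at
most `D` has at least `c · (n/(2eD))^(D/2)` vertices. -/
theorem statement5 :
    ∃ c : ℝ, 0 < c ∧ ∀ n D : ℕ, 1 ≤ D → D ≤ n →
      ∀ (V : Type) (_ : Fintype V) (U : SimpleGraph V),
        (∀ G : SimpleGraph (Fin n),
            (∀ v : Fin n, (G.neighborSet v).ncard ≤ D) → Nonempty (G ↪g U)) →
        c * ((n : ℝ) / (2 * Real.exp 1 * D)) ^ ((D : ℝ) / 2) ≤ (Fintype.card V : ℝ) := by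
  refine ⟨Real.exp (-1), Real.exp_pos _, ?_⟩
  intro n D hD hDn V _ U hU
  have hD' : (0 : ℝ) < D := by exact_mod_cast hD
  have hx : (0 : ℝ) ≤ (n : ℝ) / (2 * Real.exp 1 * D) := by positivity
  refine le_of_pow_le_pow_left₀ (n := 2) (by norm_num) (by positivity) ?_
  have e1 : (((n : ℝ) / (2 * Real.exp 1 * D)) ^ ((D : ℝ) / 2)) ^ 2
      = ((n : ℝ) / (2 * Real.exp 1 * D)) ^ D := by
    rw [← Real.rpow_natCast, ← Real.rpow_mul hx, ← Real.rpow_natCast]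
    congr 1
    push_cast
    ring
  rw [mul_pow, e1]
  have he2 : Real.exp (-1) ^ 2 = Real.exp (-2) := by
    rw [← Real.exp_nat_mul]; norm_num
  rw [he2]
  have he1 : 1 ≤ Real.exp 1 := Real.one_le_exp (by norm_num)
  rcases Nat.lt_or_ge n 2 with hn | hn
  · have hn1 : n = 1 := by omega
    have hD1 : D = 1 := by omega
    subst hn1 hD1
    obtain ⟨f⟩ := hU ⊥ (by intro v; simp [SimpleGraph.neighborSet])
    have hV : 1 ≤ Fintype.card V := Fintype.card_pos_iff.mpr ⟨f 0⟩
    have hV' : (1 : ℝ) ≤ Fintype.card V := by exact_mod_cast hV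
    have a1 : Real.exp (-2) ≤ 1 := Real.exp_le_one_iff.mpr (by norm_num)
    have a2 : ((1 : ℕ) : ℝ) / (2 * Real.exp 1 * (1 : ℕ)) ≤ 1 := by
      rw [div_le_one (by positivity)]
      push_cast; linarith
    calc _ ≤ (1 : ℝ) * 1 ^ 1 := by gcongr
      _ ≤ _ := by nlinarith
  · obtain ⟨m, hm⟩ : ∃ m, m = n / 2 := ⟨_, rfl⟩
    have hm1 : 1 ≤ m := by omega
    have hm' : (1 : ℝ) ≤ m := by exact_mod_cast hm1
    have hs := aux_sq m D hm1 hD _ (aux_count m n D (by omega) V U hU)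
    have hnm : (n : ℝ) ≤ 2 * m + 1 := by
      have : n ≤ 2 * m + 1 := by omega
      exact_mod_cast this
    have hDr : (D : ℝ) ≤ n := by exact_mod_cast hDn
    have b1 : (n : ℝ) / (2 * Real.exp 1 * D) ≤
        Real.exp (1 / (2 * m)) * ((m : ℝ) / (Real.exp 1 * D)) := by
      have := Real.add_one_le_exp (1 / (2 * (m : ℝ)))
      calc (n : ℝ) / (2 * Real.exp 1 * D) ≤ (2 * m + 1) / (2 * Real.exp 1 * D) := by gcongr
        _ = (1 / (2 * (m : ℝ)) + 1) * ((m : ℝ) / (Real.exp 1 * D)) := by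
          field_simp
          try ring
        _ ≤ _ := by gcongr
    have b2 : Real.exp (1 / (2 * m)) ^ D ≤ Real.exp 2 := by
      rw [← Real.exp_nat_mul]
      apply Real.exp_le_exp.mpr
      rw [mul_one_div, div_le_iff₀ (by positivity)]
      linarith
    calc _ ≤ Real.exp (-2) * (Real.exp (1 / (2 * m)) * ((m : ℝ) / (Real.exp 1 * D))) ^ D := by
          gcongr
      _ = Real.exp (-2) * (Real.exp (1 / (2 * m)) ^ D * ((m : ℝ) / (Real.exp 1 * D)) ^ D) := by
          rw [mul_pow]
      _ ≤ Real.exp (-2) * (Real.exp 2 * (Fintype.card V : ℝ) ^ 2) := by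
          gcongr
      _ = (Fintype.card V : ℝ) ^ 2 := by
          rw [← mul_assoc, ← Real.exp_add]; norm_num
end

section
/- There exists a constant C > 0 such that for all positive integers n, D with n ≥ 2D, the number of simple graphs on the labeled vertex set {0,…,n−1} with maximum degree at most D is at least C(C(n,2), ⌊nD/2⌋) · 2^{−C·n·√(D·log n)·log(n/D)} (as a real number, where C(a,b) denotes the binomial coefficient and log denotes logarithm base 2). -/
open Finset in
lemma aux_superset {α : Type*} [DecidableEq α] (E T : Finset α) (hT : T ⊆ E) (m : ℕ) :
    (((E.powersetCard m).filter (fun F => T ⊆ F)).card) ≤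
      Nat.choose (E.card - T.card) (m - T.card) := by
  rw [← card_sdiff_of_subset hT, ← card_powersetCard]
  apply card_le_card_of_injOn (fun F => F \ T)
  · intro F hF
    simp only [coe_filter, mem_powersetCard, Set.mem_ofPred_eq] at hF
    simp only [mem_coe, mem_powersetCard]
    obtain ⟨⟨h1, h2⟩, h3⟩ := hF
    exact ⟨sdiff_subset_sdiff h1 (le_refl _), by rw [card_sdiff_of_subset h3, h2]⟩
  · intro F hF G hG h
    simp only [coe_filter, mem_powersetCard, Set.mem_ofPred_eq] at hF hG
    simp only at h
    rw [← sdiff_union_of_subset hF.2, h, sdiff_union_of_subset hG.2]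

open Finset in
lemma aux_bad {α : Type*} [DecidableEq α] (E S : Finset α) (hS : S ⊆ E) (m D r : ℕ) :
    (((E.powersetCard m).filter (fun F => D + 1 ≤ (F ∩ S).card)).card) * Nat.choose (D + 1) r ≤
      Nat.choose S.card r * Nat.choose (E.card - r) (m - r) := by
  set B := (E.powersetCard m).filter (fun F => D + 1 ≤ (F ∩ S).card) with hB
  calc B.card * Nat.choose (D + 1) r = ∑ F ∈ B, Nat.choose (D + 1) r := by simp
    _ ≤ ∑ F ∈ B, ((S.powersetCard r).filter (fun T => T ⊆ F)).card := by
        apply sum_le_sum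
        intro F hF
        rw [hB, mem_filter] at hF
        have : (S.powersetCard r).filter (fun T => T ⊆ F) = (F ∩ S).powersetCard r := by
          ext T
          simp only [mem_filter, mem_powersetCard, subset_inter_iff]
          tauto
        rw [this, card_powersetCard]
        exact Nat.choose_le_choose _ hF.2
    _ = ∑ T ∈ S.powersetCard r, (B.filter (fun F => T ⊆ F)).card := by
        simp only [card_filter]
        rw [sum_comm]
    _ ≤ ∑ T ∈ S.powersetCard r, Nat.choose (E.card - r) (m - r) := by
        apply sum_le_sum
        intro T hT
        rw [mem_powersetCard] at hT
        have := aux_superset E T (hT.1.trans hS) m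
        rw [hT.2] at this
        refine le_trans (card_le_card ?_) this
        exact filter_subset_filter _ (filter_subset _ _)
    _ = _ := by simp

lemma aux_desc (s m N D r : ℕ) (q : ℝ) (hq : 0 ≤ q) (hN : 0 < N) (hsN : s ≤ N)
    (h : (s : ℝ) * m ≤ N * (q * (D + 1 - r))) (hr : r ≤ D) (hrN : r ≤ N) (j : ℕ) (hj : j ≤ r) :
    (s.descFactorial j : ℝ) * m.descFactorial j ≤
      N.descFactorial j * (D + 1).descFactorial j * q ^ j := by
  induction j with
  | zero => simp
  | succ a ih =>
    have ih := ih (by omega)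
    simp only [Nat.descFactorial_succ, Nat.cast_mul]
    have key : ((s - a : ℕ) : ℝ) * ((m - a : ℕ) : ℝ) ≤
        ((N - a : ℕ) : ℝ) * ((D + 1 - a : ℕ) : ℝ) * q := by
      have h1 : ((m - a : ℕ) : ℝ) ≤ m := by exact_mod_cast Nat.sub_le _ _
      have h2 : ((s - a : ℕ) : ℝ) * N ≤ s * ((N - a : ℕ) : ℝ) := by
        rw [Nat.cast_sub (by omega : a ≤ N)]
        rcases le_total a s with has | has
        · rw [Nat.cast_sub has]
          have : (s : ℝ) ≤ N := by exact_mod_cast hsN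
          nlinarith [(Nat.cast_nonneg a : (0 : ℝ) ≤ a)]
        · rw [Nat.sub_eq_zero_of_le has]
          have : (a : ℝ) ≤ N := by exact_mod_cast (by omega : a ≤ N)
          have := mul_nonneg (Nat.cast_nonneg s : (0 : ℝ) ≤ s) (sub_nonneg.2 this)
          simpa using this
      have h3 : ((D : ℝ) + 1 - r) ≤ ((D + 1 - a : ℕ) : ℝ) := by
        rw [Nat.cast_sub (by omega)]
        have : (a : ℝ) ≤ r := by exact_mod_cast (by omega : a ≤ r)
        push_cast; linarith
      have hN' : (0 : ℝ) < N := by exact_mod_cast hN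
      refine le_of_mul_le_mul_left ?_ hN'
      calc (N : ℝ) * (((s - a : ℕ) : ℝ) * ((m - a : ℕ) : ℝ))
          ≤ N * (((s - a : ℕ) : ℝ) * m) := by gcongr
        _ = (((s - a : ℕ) : ℝ) * N) * m := by ring
        _ ≤ (s * ((N - a : ℕ) : ℝ)) * m := by gcongr
        _ = ((N - a : ℕ) : ℝ) * (s * m) := by ring
        _ ≤ ((N - a : ℕ) : ℝ) * (N * (q * (D + 1 - r))) := by gcongr
        _ ≤ ((N - a : ℕ) : ℝ) * (N * (q * ((D + 1 - a : ℕ) : ℝ))) := by gcongr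
        _ = _ := by ring
    calc _ = (((s - a : ℕ) : ℝ) * ((m - a : ℕ) : ℝ)) *
            ((s.descFactorial a : ℝ) * m.descFactorial a) := by ring
      _ ≤ (((N - a : ℕ) : ℝ) * ((D + 1 - a : ℕ) : ℝ) * q) *
            (N.descFactorial a * (D + 1).descFactorial a * q ^ a) := by gcongr
      _ = _ := by ring

lemma aux_choose (s m N D r : ℕ) (q : ℝ) (hq : 0 ≤ q) (hN : 0 < N) (hsN : s ≤ N)
    (h : (s : ℝ) * m ≤ N * (q * (D + 1 - r))) (hr : r ≤ D) (hmN : m ≤ N) (hrm : r ≤ m) :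
    (s.choose r : ℝ) * (N - r).choose (m - r) ≤ N.choose m * (D + 1).choose r * q ^ r := by
  have h0 := aux_desc s m N D r q hq hN hsN h hr (hrm.trans hmN) r le_rfl
  simp only [Nat.descFactorial_eq_factorial_mul_choose, Nat.cast_mul] at h0
  have hf : (0 : ℝ) < (r.factorial : ℝ) := by exact_mod_cast r.factorial_pos
  have h1 : (s.choose r : ℝ) * m.choose r ≤ N.choose r * (D + 1).choose r * q ^ r := by
    refine le_of_mul_le_mul_left ?_ (mul_pos hf hf)
    linarith
  have h2 : (N.choose m : ℝ) * m.choose r = N.choose r * (N - r).choose (m - r) := by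
    exact_mod_cast Nat.choose_mul hrm
  have hp : (0 : ℝ) < N.choose r := by exact_mod_cast Nat.choose_pos (hrm.trans hmN)
  refine le_of_mul_le_mul_left ?_ hp
  calc (N.choose r : ℝ) * (s.choose r * (N - r).choose (m - r))
      = s.choose r * (N.choose m * m.choose r) := by rw [h2]; ring
    _ = N.choose m * (s.choose r * m.choose r) := by ring
    _ ≤ N.choose m * (N.choose r * (D + 1).choose r * q ^ r) := by gcongr
    _ = _ := by ring

/-- Ratio bound. -/
lemma aux_ratio (N k t : ℕ) (R : ℝ) (hR : (N : ℝ) ≤ R * (k + 1)) (hR0 : 0 ≤ R) :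
    (N.choose (k + t) : ℝ) ≤ N.choose k * R ^ t := by
  induction t with
  | zero => simp
  | succ t ih =>
    have h := Nat.choose_succ_right_eq N (k + t)
    have h' : (N.choose (k + t + 1) : ℝ) * (k + t + 1) = N.choose (k + t) * ((N - (k + t) : ℕ) : ℝ) := by
      exact_mod_cast h
    have h1 : ((N - (k + t) : ℕ) : ℝ) ≤ N := by exact_mod_cast Nat.sub_le _ _
    have hpos : (0 : ℝ) < (k + t + 1) := by positivity
    refine le_of_mul_le_mul_right ?_ hpos
    calc (N.choose (k + (t + 1)) : ℝ) * (k + t + 1)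
        = N.choose (k + t) * ((N - (k + t) : ℕ) : ℝ) := h'
      _ ≤ N.choose (k + t) * (R * (k + t + 1)) := by
          gcongr
          have : (0 : ℝ) ≤ R * t := by positivity
          nlinarith
      _ ≤ (N.choose k * R ^ t) * (R * (k + t + 1)) := by gcongr
      _ = _ := by ring

open Finset in
/-- Good edge sets give good graphs. -/
lemma aux_good (n D m : ℕ) :
    ((((⊤ : SimpleGraph (Fin n)).edgeFinset.powersetCard m).filter
      (fun F => ∀ v : Fin n, (F ∩ (⊤ : SimpleGraph (Fin n)).edgeFinset.filter
        (fun e => v ∈ e)).card ≤ D)).card) ≤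
    {G : SimpleGraph (Fin n) | ∀ v : Fin n, (G.neighborSet v).ncard ≤ D}.ncard := by
  classical
  rw [← Set.ncard_coe_finset]
  apply Set.ncard_le_ncard_of_injOn (fun F : Finset (Sym2 (Fin n)) =>
    SimpleGraph.fromEdgeSet (F : Set (Sym2 (Fin n))))
  · intro F hF
    simp only [coe_filter, mem_powersetCard, Set.mem_ofPred_eq] at hF
    intro v
    refine le_trans ?_ (hF.2 v)
    rw [← Set.ncard_coe_finset]
    apply Set.ncard_le_ncard_of_injOn (fun w => s(v, w))
    · intro w hw
      simp only [SimpleGraph.mem_neighborSet, SimpleGraph.fromEdgeSet_adj, mem_coe] at hw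
      simp [hw.1, hw.2]
    · intro a _ b _ hab
      exact Sym2.congr_right.1 hab
  · intro F hF G hG h
    simp only [coe_filter, mem_powersetCard, Set.mem_ofPred_eq] at hF hG
    have key : ∀ F : Finset (Sym2 (Fin n)), F ⊆ (⊤ : SimpleGraph (Fin n)).edgeFinset →
        (SimpleGraph.fromEdgeSet (F : Set (Sym2 (Fin n)))).edgeSet = F := by
      intro F hF
      rw [SimpleGraph.edgeSet_fromEdgeSet, sdiff_eq_left, Set.disjoint_left]
      intro e he hd
      have := hF he
      rw [SimpleGraph.mem_edgeFinset] at this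
      exact SimpleGraph.not_isDiag_of_mem_edgeSet _ this hd
    have := congrArg SimpleGraph.edgeSet h
    simp only [key F hF.1.1, key G hG.1.1] at this
    exact_mod_cast this

open Finset in
lemma aux_star (n : ℕ) (v : Fin n) :
    ((⊤ : SimpleGraph (Fin n)).edgeFinset.filter (fun e => v ∈ e)).card = n - 1 := by
  classical
  rw [← SimpleGraph.incidenceFinset_eq_filter, SimpleGraph.card_incidenceFinset_eq_degree]
  simp

open Finset in
lemma aux_count_s6 (n D m r : ℕ) (q : ℝ) (hq : 0 ≤ q) (hn : 2 ≤ n)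
    (h : ((n - 1 : ℕ) : ℝ) * m ≤ (n.choose 2 : ℕ) * (q * (D + 1 - r))) (hr : r ≤ D)
    (hmN : m ≤ n.choose 2) (hrm : r ≤ m) (hqn : n * q ^ r ≤ 1 / 2) :
    ((n.choose 2).choose m : ℝ) / 2 ≤
     ({G : SimpleGraph (Fin n) | ∀ v : Fin n, (G.neighborSet v).ncard ≤ D}.ncard : ℝ) := by
  classical
  refine le_trans ?_ (Nat.cast_le.2 (aux_good n D m))
  set E := (⊤ : SimpleGraph (Fin n)).edgeFinset with hE
  have hEc : E.card = n.choose 2 := by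
    rw [hE, SimpleGraph.card_edgeFinset_top_eq_card_choose_two]; simp
  set S : Fin n → Finset (Sym2 (Fin n)) := fun v => E.filter (fun e => v ∈ e)
  have hSc : ∀ v, (S v).card = n - 1 := aux_star n
  set B : Fin n → Finset (Finset (Sym2 (Fin n))) := fun v =>
    (E.powersetCard m).filter (fun F => D + 1 ≤ (F ∩ S v).card)
  have hcov : E.powersetCard m ⊆ ((E.powersetCard m).filter
      (fun F => ∀ v : Fin n, (F ∩ S v).card ≤ D)) ∪ univ.biUnion B := by
    intro F hF
    by_cases hg : ∀ v : Fin n, (F ∩ S v).card ≤ D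
    · exact mem_union_left _ (mem_filter.2 ⟨hF, hg⟩)
    · push Not at hg
      obtain ⟨v, hv⟩ := hg
      exact mem_union_right _ (mem_biUnion.2 ⟨v, mem_univ _, mem_filter.2 ⟨hF, hv⟩⟩)
  have hB : ∀ v, ((B v).card : ℝ) ≤ (n.choose 2).choose m * q ^ r := by
    intro v
    have h1 := aux_bad E (S v) (filter_subset _ _) m D r
    rw [hSc, hEc] at h1
    have h2 := aux_choose (n - 1) m (n.choose 2) D r q hq (Nat.choose_pos hn)
      (by
        rw [Nat.choose_two_right, Nat.le_div_iff_mul_le (by norm_num), mul_comm]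
        exact Nat.mul_le_mul_right _ hn) h hr hmN hrm
    have h3 : ((B v).card : ℝ) * (D + 1).choose r ≤
        (n - 1).choose r * (n.choose 2 - r).choose (m - r) := by exact_mod_cast h1
    have hp : (0 : ℝ) < (D + 1).choose r := by exact_mod_cast Nat.choose_pos (by omega)
    refine le_of_mul_le_mul_right ?_ hp
    linarith
  have hc := (card_le_card hcov).trans (card_union_le _ _)
  rw [card_powersetCard, hEc] at hc
  have hc' := hc.trans (Nat.add_le_add_left card_biUnion_le _)
  have hc2 : ((n.choose 2).choose m : ℝ) ≤ (((E.powersetCard m).filter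
      (fun F => ∀ v : Fin n, (F ∩ S v).card ≤ D)).card : ℝ) + ∑ v, ((B v).card : ℝ) := by
    exact_mod_cast hc'
  have hs : ∑ v, ((B v).card : ℝ) ≤ n * ((n.choose 2).choose m * q ^ r) := by
    refine (sum_le_sum (fun v _ => hB v)).trans ?_
    simp
  have : (n : ℝ) * ((n.choose 2).choose m * q ^ r) ≤ (n.choose 2).choose m * (1 / 2) := by
    calc _ = ((n.choose 2).choose m : ℝ) * (n * q ^ r) := by ring
      _ ≤ _ := by gcongr
  linarith

lemma aux_one (n D : ℕ) : (1 : ℝ) ≤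
    ({G : SimpleGraph (Fin n) | ∀ v : Fin n, (G.neighborSet v).ncard ≤ D}.ncard : ℝ) := by
  have : 0 < {G : SimpleGraph (Fin n) | ∀ v : Fin n, (G.neighborSet v).ncard ≤ D}.ncard := by
    rw [Set.ncard_pos (Set.toFinite _)]
    refine ⟨⊥, ?_⟩
    intro v
    have : (⊥ : SimpleGraph (Fin n)).neighborSet v = ∅ := by ext; simp
    rw [this]; simp
  exact_mod_cast this

/-- Trivial bound on the binomial coefficient. -/
lemma aux_triv (n D : ℕ) (hD : 1 ≤ D) (hn : 2 * D ≤ n) :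
    (Nat.choose (Nat.choose n 2) (n * D / 2) : ℝ) ≤
      2 ^ (2 * (n : ℝ) * D * Real.logb 2 ((n : ℝ) / D)) := by
  have hD' : (1 : ℝ) ≤ D := by exact_mod_cast hD
  have hn' : 2 * (D : ℝ) ≤ n := by exact_mod_cast hn
  have hn0 : (0 : ℝ) < n := by linarith
  set N := n.choose 2
  set m := n * D / 2 with hm
  set y : ℝ := (n : ℝ) / D with hy
  have hy2 : 2 ≤ y := by rw [hy, le_div_iff₀ (by linarith)]; linarith
  have hy0 : 0 < y := by linarith
  set x : ℝ := y⁻¹ with hx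
  have hx0 : 0 < x := by positivity
  have h1 : (N.choose m : ℝ) * x ^ m ≤ (1 + x) ^ N := by
    rcases le_or_gt m N with hmN | hmN
    · rw [add_comm, add_pow]
      have := Finset.single_le_sum (f := fun i => x ^ i * 1 ^ (N - i) * (N.choose i : ℝ))
        (s := Finset.range (N + 1)) (fun i _ => by positivity) (Finset.mem_range.2 (by omega : m < N + 1))
      simp only [one_pow, mul_one] at this ⊢
      linarith
    · rw [Nat.choose_eq_zero_of_lt hmN]; simp; positivity
  have h2 : (1 + x) ^ N ≤ Real.exp (n * D / 2) := by
    have : (1 + x) ≤ Real.exp x := by linarith [Real.add_one_le_exp x]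
    calc (1 + x) ^ N ≤ (Real.exp x) ^ N := by gcongr
      _ = Real.exp (N * x) := by rw [← Real.exp_nat_mul]
      _ ≤ _ := by
        apply Real.exp_le_exp.2
        have : (N : ℝ) ≤ n * n / 2 := by
          rw [Nat.cast_choose_two]; nlinarith
        calc (N : ℝ) * x ≤ n * n / 2 * x := by gcongr
          _ = n * D / 2 := by rw [hx, hy]; field_simp
  have h3 : Real.exp (n * D / 2) ≤ (2 : ℝ) ^ ((n : ℝ) * D) := by
    rw [Real.rpow_def_of_pos (by norm_num)]
    apply Real.exp_le_exp.2
    have := Real.log_two_gt_d9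
    have : 0 ≤ (n : ℝ) * D := by positivity
    nlinarith
  have hL : 1 ≤ Real.logb 2 y := by
    rw [Real.le_logb_iff_rpow_le (by norm_num) hy0]; simpa using hy2
  have h4 : y ^ m = (2 : ℝ) ^ (Real.logb 2 y * m) := by
    rw [Real.rpow_mul (by norm_num), Real.rpow_logb (by norm_num) (by norm_num) hy0, Real.rpow_natCast]
  have hmr : (m : ℝ) ≤ n * D / 2 := by
    have : (m : ℝ) ≤ ((n * D : ℕ) : ℝ) / ((2 : ℕ) : ℝ) := Nat.cast_div_le
    push_cast at this; exact this
  calc (N.choose m : ℝ) = (N.choose m * x ^ m) * y ^ m := by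
        rw [mul_assoc, ← mul_pow, hx, inv_mul_cancel₀ hy0.ne', one_pow, mul_one]
    _ ≤ (2 : ℝ) ^ ((n : ℝ) * D) * (2 : ℝ) ^ (Real.logb 2 y * m) := by
        rw [h4]; gcongr; exact h1.trans (h2.trans h3)
    _ = (2 : ℝ) ^ ((n : ℝ) * D + Real.logb 2 y * m) := by rw [Real.rpow_add (by norm_num)]
    _ ≤ _ := by
        apply Real.rpow_le_rpow_of_exponent_le (by norm_num)
        have h5 : 0 ≤ (n : ℝ) * D := by positivity
        have h6 : Real.logb 2 y * m ≤ Real.logb 2 y * (n * D / 2) := by gcongr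
        nlinarith

lemma aux_pow (y : ℝ) (hy0 : 0 < y) (k : ℕ) :
    (y ^ 2) ^ k = (2 : ℝ) ^ (Real.logb 2 y * (2 * (k : ℝ))) := by
  rw [Real.rpow_mul (by norm_num), Real.rpow_logb (by norm_num) (by norm_num) hy0,
    Real.rpow_mul hy0.le, Real.rpow_natCast, Real.rpow_two]

set_option maxHeartbeats 1000000 in
theorem statement6 :
    ∃ C : ℝ, 0 < C ∧ ∀ n D : ℕ, 1 ≤ D → 2 * D ≤ n →
      (Nat.choose (Nat.choose n 2) (n * D / 2) : ℝ) *
          2 ^ (-(C * n * Real.sqrt (D * Real.logb 2 n) * Real.logb 2 ((n : ℝ) / D))) ≤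
        ({G : SimpleGraph (Fin n) | ∀ v : Fin n, (G.neighborSet v).ncard ≤ D}.ncard : ℝ) := by
  refine ⟨24, by norm_num, ?_⟩
  intro n D hD hn
  have hD' : (1 : ℝ) ≤ D := by exact_mod_cast hD
  have hn' : 2 * (D : ℝ) ≤ n := by exact_mod_cast hn
  have hn0 : (0 : ℝ) < n := by linarith
  have hn2 : (2 : ℝ) ≤ n := by linarith
  set L := Real.logb 2 (n : ℝ) with hL
  set y : ℝ := (n : ℝ) / D with hy
  have hy2 : 2 ≤ y := by rw [hy, le_div_iff₀ (by linarith)]; linarith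
  have hy0 : 0 < y := by linarith
  have hl1 : 1 ≤ Real.logb 2 y := by
    rw [Real.le_logb_iff_rpow_le (by norm_num) hy0]; simpa using hy2
  set l := Real.logb 2 y with hl
  have hL1 : 1 ≤ L := by
    rw [hL, Real.le_logb_iff_rpow_le (by norm_num) hn0]; simpa using hn2
  set X := Real.sqrt (D * L) with hX
  have hX1 : 1 ≤ X := by
    rw [hX, Real.one_le_sqrt]; nlinarith
  have hXsq : X ^ 2 = D * L := Real.sq_sqrt (by positivity)
  set r := ⌈2 * X⌉₊ with hr
  have hr1 : 2 * X ≤ r := Nat.le_ceil _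
  have hr2 : (r : ℝ) ≤ 3 * X := by
    have := Nat.ceil_lt_add_one (by positivity : 0 ≤ 2 * X)
    linarith
  set cnt := ({G : SimpleGraph (Fin n) | ∀ v : Fin n, (G.neighborSet v).ncard ≤ D}.ncard : ℝ)
    with hcnt
  -- reduce to a bound
  rcases Nat.lt_or_ge D (4 * r) with hcase | hcase
  · have hD12 : (D : ℝ) ≤ 12 * X := by
      have : (D : ℝ) ≤ 4 * r := by exact_mod_cast hcase.le
      linarith
    have h1 := aux_triv n D hD hn
    refine le_trans ?_ (aux_one n D)
    calc _ ≤ (2 : ℝ) ^ (2 * (n : ℝ) * D * l) * 2 ^ (-(24 * n * X * l)) := by gcongr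
      _ = (2 : ℝ) ^ (2 * (n : ℝ) * D * l + (-(24 * n * X * l))) := by
          rw [Real.rpow_add (by norm_num)]
      _ ≤ 1 := by
          apply Real.rpow_le_one_of_one_le_of_nonpos (by norm_num)
          have : 2 * (n : ℝ) * D * l ≤ 2 * n * (12 * X) * l := by gcongr
          linarith
  · have hcaseR : 4 * (r : ℝ) ≤ D := by exact_mod_cast hcase
    have hrpos : (0 : ℝ) < r := by linarith
    set m := n * (D - 2 * r) / 2 with hm
    have hsplit : n * D / 2 = m + n * r := by
      have : n * D = n * (D - 2 * r) + (n * r) * 2 := by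
        have : D = (D - 2 * r) + 2 * r := by omega
        conv_lhs => rw [this]
        ring
      rw [this, Nat.add_mul_div_right _ _ (by norm_num)]
    have hcast : ((D - 2 * r : ℕ) : ℝ) = D - 2 * r := by
      rw [Nat.cast_sub (by omega)]; push_cast; ring
    have hmle : (m : ℝ) ≤ n * (D - 2 * r) / 2 := by
      have : (m : ℝ) ≤ ((n * (D - 2 * r) : ℕ) : ℝ) / ((2 : ℕ) : ℝ) := Nat.cast_div_le
      rw [Nat.cast_mul, hcast] at this; exact_mod_cast this
    have hmge : (n : ℝ) * (D - 2 * r) / 2 ≤ m + 1 := by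
      have h : n * (D - 2 * r) ≤ 2 * (m + 1) := by omega
      have h' : (n : ℝ) * ((D - 2 * r : ℕ) : ℝ) ≤ 2 * (m + 1) := by exact_mod_cast h
      rw [hcast] at h'; linarith
    have hNc : ((n.choose 2 : ℕ) : ℝ) = n * (n - 1) / 2 := Nat.cast_choose_two ℝ n
    have hDr : (0 : ℝ) < D - r := by linarith
    set q : ℝ := (D - 2 * r) / (D - r) with hq
    have hq0 : 0 ≤ q := div_nonneg (by linarith) hDr.le
    have hqle : q ≤ Real.exp (-(r / D)) := by
      have h1 : q ≤ 1 - r / D := by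
        rw [hq, div_le_iff₀ hDr]
        have : (1 - (r : ℝ) / D) * (D - r) = D - 2 * r + r * r / D := by field_simp; ring
        rw [this]
        have : 0 ≤ (r : ℝ) * r / D := by positivity
        linarith
      linarith [Real.add_one_le_exp (-((r : ℝ) / D))]
    have hqn : n * q ^ r ≤ 1 / 2 := by
      have h1 : q ^ r ≤ Real.exp (-(2 * Real.log n)) := by
        calc q ^ r ≤ (Real.exp (-(r / D))) ^ r := by gcongr
          _ = Real.exp (r * (-(r / D))) := by rw [← Real.exp_nat_mul]
          _ ≤ _ := by
            apply Real.exp_le_exp.2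
            have h4 : 4 * L ≤ r * (r / D) := by
              rw [← mul_div_assoc, le_div_iff₀ (by linarith)]
              nlinarith
            have h5 : Real.log n ≤ L := by
              rw [hL, Real.logb, le_div_iff₀ (Real.log_pos (by norm_num))]
              have := Real.log_two_lt_d9
              have := Real.log_nonneg (by linarith : (1 : ℝ) ≤ n)
              nlinarith
            linarith
      have h2 : Real.exp (-(2 * Real.log n)) = ((n : ℝ) * n)⁻¹ := by
        rw [Real.exp_neg, two_mul, Real.exp_add, Real.exp_log hn0]
      rw [h2] at h1
      calc (n : ℝ) * q ^ r ≤ n * ((n : ℝ) * n)⁻¹ := by gcongr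
        _ = 1 / n := by field_simp
        _ ≤ 1 / 2 := by gcongr
    have hmN : m ≤ n.choose 2 := by
      have : (m : ℝ) ≤ ((n.choose 2 : ℕ) : ℝ) := by
        rw [hNc]
        refine hmle.trans ?_
        have : (D : ℝ) - 2 * r ≤ n - 1 := by linarith
        gcongr
      exact_mod_cast this
    have hrm : r ≤ m := by
      rw [hm, Nat.le_div_iff_mul_le (by norm_num)]
      have h1 : 2 * r ≤ D - 2 * r := by omega
      calc r * 2 ≤ 1 * (D - 2 * r) := by omega
        _ ≤ _ := Nat.mul_le_mul_right _ (by omega)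
    have hmain := aux_count_s6 n D m r q hq0 (by omega) (by
      rw [hNc, Nat.cast_sub (by omega)]
      have h1 : (D : ℝ) - 2 * r ≤ q * (D + 1 - r) := by
        have : q * (D - r) = D - 2 * r := by rw [hq]; field_simp
        nlinarith
      have hn1 : (0 : ℝ) ≤ n - 1 := by linarith
      push_cast
      calc ((n : ℝ) - 1) * m ≤ (n - 1) * (n * (D - 2 * r) / 2) := by gcongr
        _ = n * (n - 1) / 2 * (D - 2 * r) := by ring
        _ ≤ _ := by gcongr) (by omega) hmN hrm hqn
    have hrat := aux_ratio (n.choose 2) m (n * r) (y ^ 2) (by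
      rw [hNc]
      have h1 : (n : ℝ) * D / 4 ≤ m + 1 := by
        have := mul_nonneg hn0.le (sub_nonneg.2 hcaseR)
        linarith
      have h2 : 2 * y ≤ y ^ 2 := by
        rw [pow_two]; exact mul_le_mul_of_nonneg_right hy2 hy0.le
      calc (n : ℝ) * (n - 1) / 2 ≤ n * n / 2 := by nlinarith
        _ = (2 * y) * (n * D / 4) := by rw [hy]; field_simp; ring
        _ ≤ _ := by gcongr) (by positivity)
    rw [hsplit]
    have hpow : (y ^ 2) ^ (n * r) = (2 : ℝ) ^ (l * (2 * (n * r))) := by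
      have := aux_pow y hy0 (n * r)
      rw [Nat.cast_mul] at this
      exact this
    rw [hpow] at hrat
    refine le_trans ?_ hmain
    calc _ ≤ ((n.choose 2).choose m * (2 : ℝ) ^ (l * (2 * (n * r)))) * 2 ^ (-(24 * n * X * l)) := by
          gcongr
      _ = (n.choose 2).choose m * (2 : ℝ) ^ (l * (2 * (n * r)) + -(24 * n * X * l)) := by
          rw [Real.rpow_add (by norm_num)]; ring
      _ ≤ (n.choose 2).choose m * (2 : ℝ) ^ (-1 : ℝ) := by
          gcongr
          · norm_num
          · have h1 : l * (2 * (n * r)) ≤ l * (2 * (n * (3 * X))) := by gcongr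
            have h2 : 1 ≤ n * X * l := by
              have : 1 ≤ n * X := by nlinarith
              nlinarith
            nlinarith
      _ = _ := by rw [Real.rpow_neg_one]; ring
end

section
/- There exists a constant C > 0 such that for all positive integers n, D with n ≥ 2D, every simple graph U having the property that every simple graph on n vertices with maximum degree at most D is an induced subgraph of U must have at least C(⌊n/2⌋, ⌊D/2⌋) · 2^{−C·√(D·log n)·log(n/D)} vertices (as a real number, where C(a,b) denotes the binomial coefficient and log denotes logarithm base 2). -/
lemma sum_single (m d : ℕ) (j : Fin m) (x : ℝ) (hd : d ≤ m) :
    ∑ S ∈ Finset.powersetCard d (Finset.univ : Finset (Fin m)),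
      (if j ∈ S then 1 + x else 1) = (m.choose d : ℝ) * (1 + x * d / m) := by
  have hm : 0 < m := j.pos
  have h1 : (Finset.powersetCard d (Finset.univ : Finset (Fin m))).filter (fun S => j ∉ S)
      = Finset.powersetCard d (Finset.univ.erase j) := by
    ext S
    simp only [Finset.mem_filter, Finset.mem_powersetCard, Finset.subset_univ, true_and]
    constructor
    · rintro ⟨h, h'⟩
      exact ⟨fun a ha => Finset.mem_erase.2 ⟨fun h => h' (h ▸ ha), Finset.mem_univ _⟩, h⟩
    · rintro ⟨h, h'⟩
      exact ⟨h', fun hj => by simpa using h hj⟩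
  have h2 : ((Finset.powersetCard d (Finset.univ : Finset (Fin m))).filter
      (fun S => j ∉ S)).card = (m - 1).choose d := by
    rw [h1, Finset.card_powersetCard, Finset.card_erase_of_mem (Finset.mem_univ _)]
    simp
  have h3 : ((m-1).choose d : ℝ) * m = m.choose d * (m - d) := by
    have := Nat.choose_mul_succ_eq (m-1) d
    rw [Nat.sub_add_cancel hm] at this
    have h := congrArg (Nat.cast (R := ℝ)) this
    push_cast [Nat.cast_sub hd] at h
    exact h
  have h4 : ∀ S : Finset (Fin m), (if j ∈ S then 1 + x else 1)
      = (1 + x) - (if j ∉ S then x else 0) := by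
    intro S; by_cases h : j ∈ S <;> simp [h]
  rw [Finset.sum_congr rfl (fun S _ => h4 S), Finset.sum_sub_distrib, ← Finset.sum_filter,
    Finset.sum_const, Finset.sum_const, h2, Finset.card_powersetCard]
  simp only [Finset.card_univ, Fintype.card_fin, nsmul_eq_mul]
  have hm' : (m : ℝ) ≠ 0 := by positivity
  field_simp
  linear_combination (-x) * h3

section
variable {A : Type} [AddCommGroup A] [Fintype A] [DecidableEq A] {m : ℕ}

def indeg (e : Fin m → A) (f : A → Finset (Fin m)) (u : A) : ℕ :=
  (Finset.univ.filter (fun j => j ∈ f (u - e j))).card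

lemma chernoff (d t : ℕ) (e : Fin m → A) (he : Function.Injective e) (hd : d ≤ m) (x : ℝ)
    (hx : 0 ≤ x) (u : A) :
    (((Fintype.piFinset (fun _ : A => Finset.powersetCard d (Finset.univ : Finset (Fin m)))).filter
      (fun f => t ≤ indeg e f u)).card : ℝ) * (1 + x) ^ t
      ≤ (m.choose d : ℝ) ^ (Fintype.card A) * Real.exp (x * d) := by
  set P := Finset.powersetCard d (Finset.univ : Finset (Fin m)) with hP
  set F := Fintype.piFinset (fun _ : A => P) with hF
  let φ : A → Finset (Fin m) → ℝ := fun w S =>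
    ∏ j ∈ Finset.univ.filter (fun j => u - e j = w), (if j ∈ S then 1 + x else 1)
  have key : ∀ f : A → Finset (Fin m), (1 + x) ^ indeg e f u = ∏ w, φ w (f w) := by
    intro f
    have h1 : ∏ w, φ w (f w) = ∏ j : Fin m, (if j ∈ f (u - e j) then 1 + x else 1) := by
      rw [← Finset.prod_fiberwise (s := Finset.univ) (g := fun j => u - e j)]
      refine Finset.prod_congr rfl fun w _ => Finset.prod_congr rfl fun j hj => ?_
      rw [(Finset.mem_filter.1 hj).2]
    rw [h1, Finset.prod_ite]
    simp [indeg]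
  have hφ : ∀ w, ∑ S ∈ P, φ w S ≤ m.choose d *
      ∏ j ∈ Finset.univ.filter (fun j => u - e j = w), (1 + x * d / m) := by
    intro w
    by_cases h : ∃ j, u - e j = w
    · obtain ⟨j, hj⟩ := h
      have : Finset.univ.filter (fun j => u - e j = w) = {j} := by
        ext i
        simp only [Finset.mem_filter, Finset.mem_univ, true_and, Finset.mem_singleton]
        constructor
        · intro h; exact he (by rw [← hj] at h; simpa using h)
        · rintro rfl; exact hj
      simp only [φ, this, Finset.prod_singleton]
      exact (sum_single m d j x hd).le
    · have : Finset.univ.filter (fun j => u - e j = w) = ∅ := by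
        ext i
        simpa using fun hi => h ⟨i, hi⟩
      simp [φ, this, hP]
  have hφ0 : ∀ w S, 0 ≤ φ w S := by
    intro w S
    refine Finset.prod_nonneg fun j _ => ?_
    split_ifs <;> linarith
  calc _ = ∑ f ∈ F.filter (fun f => t ≤ indeg e f u), (1 + x) ^ t := by
        rw [Finset.sum_const, nsmul_eq_mul]
    _ ≤ ∑ f ∈ F.filter (fun f => t ≤ indeg e f u), (1 + x) ^ indeg e f u := by
        refine Finset.sum_le_sum fun f hf => ?_
        exact pow_le_pow_right₀ (by linarith) (Finset.mem_filter.1 hf).2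
    _ ≤ ∑ f ∈ F, (1 + x) ^ indeg e f u :=
        Finset.sum_le_sum_of_subset_of_nonneg (Finset.filter_subset _ _)
          (fun _ _ _ => by positivity)
    _ = ∏ w, ∑ S ∈ P, φ w S := by
        rw [Finset.prod_univ_sum]
        exact Finset.sum_congr rfl fun f _ => key f
    _ ≤ ∏ w, (m.choose d * ∏ j ∈ Finset.univ.filter (fun j => u - e j = w), (1 + x * d / m)) :=
        Finset.prod_le_prod (fun w _ => Finset.sum_nonneg fun S _ => hφ0 w S) (fun w _ => hφ w)
    _ = (m.choose d : ℝ) ^ (Fintype.card A) * (1 + x * d / m) ^ m := by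
        rw [Finset.prod_mul_distrib, Finset.prod_fiberwise]
        simp
    _ ≤ _ := by
        refine mul_le_mul_of_nonneg_left ?_ (by positivity)
        rcases Nat.eq_zero_or_pos m with h | h
        · subst h
          simp only [pow_zero]
          exact Real.one_le_exp (by positivity)
        · calc (1 + x * d / m) ^ m ≤ (Real.exp (x * d / m)) ^ m := by
                refine pow_le_pow_left₀ (by positivity) ?_ _
                linarith [Real.add_one_le_exp (x * d / m)]
            _ = _ := by
                rw [← Real.exp_nat_mul]
                congr 1
                field_simp

def gr (e : Fin m → A) (hee : ∀ i j, e i + e j ≠ 0) (f : A → Finset (Fin m)) : SimpleGraph A where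
  Adj u v := (∃ j ∈ f u, v = u + e j) ∨ (∃ j ∈ f v, u = v + e j)
  symm := ⟨fun _ _ h => h.symm⟩
  loopless := ⟨by
    rintro u (⟨j, -, h⟩ | ⟨j, -, h⟩) <;>
    · have : e j = 0 := by simpa using h
      exact hee j j (by simp [this])⟩

lemma gr_inj (e : Fin m → A) (he : Function.Injective e) (hee : ∀ i j, e i + e j ≠ 0) :
    Function.Injective (gr e hee) := by
  have key : ∀ f u j, (gr e hee f).Adj u (u + e j) ↔ j ∈ f u := by
    intro f u j
    constructor
    · rintro (⟨i, hi, h⟩ | ⟨i, hi, h⟩)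
      · rw [he (add_left_cancel h)]; exact hi
      · exact absurd (by simpa [add_assoc] using h) (hee j i)
    · intro h; exact Or.inl ⟨j, h, rfl⟩
  intro f g h
  ext u j
  rw [← key f, ← key g, h]

lemma gr_deg (e : Fin m → A) (hee : ∀ i j, e i + e j ≠ 0) (f : A → Finset (Fin m)) (u : A) :
    ((gr e hee f).neighborSet u).ncard ≤ (f u).card + indeg e f u := by
  have : (gr e hee f).neighborSet u ⊆
      (((f u).image (fun j => u + e j) ∪
        (Finset.univ.filter (fun j => j ∈ f (u - e j))).image (fun j => u - e j) : Finset A) : Set A) := by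
    intro v hv
    simp only [Finset.coe_union, Finset.coe_image, Set.mem_union, Set.mem_image, Finset.mem_coe,
      Finset.mem_filter, Finset.mem_univ, true_and]
    rcases hv with ⟨j, hj, h⟩ | ⟨j, hj, h⟩
    · exact Or.inl ⟨j, hj, h.symm⟩
    · have : u - e j = v := by rw [h]; simp
      exact Or.inr ⟨j, by rwa [this], this⟩
  refine (Set.ncard_le_ncard this (Finset.finite_toSet _)).trans ?_
  rw [Set.ncard_coe_finset]
  exact (Finset.card_union_le _ _).trans (add_le_add Finset.card_image_le Finset.card_image_le)

lemma count (d t D : ℕ) (e : Fin m → A) (he : Function.Injective e)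
    (hee : ∀ i j, e i + e j ≠ 0) (hD : d + t ≤ D)
    (V : Type) [Fintype V] (U : SimpleGraph V)
    (H : ∀ G : SimpleGraph A, (∀ v, (G.neighborSet v).ncard ≤ D) → Nonempty (G ↪g U)) :
    ((Fintype.piFinset (fun _ : A => Finset.powersetCard d (Finset.univ : Finset (Fin m)))).filter
      (fun f => ∀ u, ¬ t ≤ indeg e f u)).card ≤ (Fintype.card V) ^ (Fintype.card A) := by
  classical
  have H' : ∀ G : SimpleGraph A, ∃ φ : A → V, (∀ v, (G.neighborSet v).ncard ≤ D) →
      G = U.comap φ := by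
    intro G
    by_cases h : ∀ v, (G.neighborSet v).ncard ≤ D
    · obtain ⟨ψ⟩ := H G h
      refine ⟨ψ, fun _ => ?_⟩
      ext a b
      simp
    · obtain ⟨ψ⟩ := H ⊥ (by simp [SimpleGraph.neighborSet])
      exact ⟨ψ, fun h' => absurd h' h⟩
  choose φ hφ using H'
  rw [← Fintype.card_fun, ← Finset.card_univ]
  refine Finset.card_le_card_of_injOn (fun f => φ (gr e hee f)) (fun _ _ => Finset.mem_coe.2 (Finset.mem_univ _)) ?_
  have hg : ∀ f ∈ ((Fintype.piFinset (fun _ : A => Finset.powersetCard d (Finset.univ : Finset (Fin m)))).filter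
      (fun f => ∀ u, ¬ t ≤ indeg e f u)), gr e hee f = U.comap (φ (gr e hee f)) := by
    intro f hf
    rw [Finset.mem_filter, Fintype.mem_piFinset] at hf
    refine hφ _ fun v => (gr_deg e hee f v).trans ?_
    have h1 := (Finset.mem_powersetCard.1 (hf.1 v)).2
    have h2 := hf.2 v
    omega
  intro f hf g hg' h
  apply gr_inj e he hee
  rw [hg f hf, hg g hg']
  exact congrArg (fun ψ => SimpleGraph.comap ψ U) h

lemma choose_le (d t D : ℕ) (e : Fin m → A) (he : Function.Injective e)
    (hee : ∀ i j, e i + e j ≠ 0) (hD : d + t ≤ D) (hd : d ≤ m)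
    (V : Type) [Fintype V] (U : SimpleGraph V)
    (H : ∀ G : SimpleGraph A, (∀ v, (G.neighborSet v).ncard ≤ D) → Nonempty (G ↪g U))
    (x : ℝ) (hx : 0 ≤ x)
    (hc : 2 * (Fintype.card A : ℝ) * Real.exp (x * d) ≤ (1 + x) ^ t) :
    m.choose d ≤ 2 * Fintype.card V := by
  classical
  set F := (Fintype.piFinset (fun _ : A => Finset.powersetCard d (Finset.univ : Finset (Fin m)))) with hF
  have hFc : F.card = (m.choose d) ^ (Fintype.card A) := by simp [hF]
  have h1 : F ⊆ F.filter (fun f => ∀ u, ¬ t ≤ indeg e f u) ∪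
      Finset.univ.biUnion (fun u => F.filter (fun f => t ≤ indeg e f u)) := by
    intro f hf
    by_cases h : ∀ u, ¬ t ≤ indeg e f u
    · exact Finset.mem_union_left _ (Finset.mem_filter.2 ⟨hf, h⟩)
    · push Not at h
      obtain ⟨u, hu⟩ := h
      exact Finset.mem_union_right _ (Finset.mem_biUnion.2 ⟨u, Finset.mem_univ _, Finset.mem_filter.2 ⟨hf, hu⟩⟩)
  have h2 := (Finset.card_le_card h1).trans ((Finset.card_union_le _ _).trans
    (add_le_add (count d t D e he hee hD V U H) Finset.card_biUnion_le))
  have hp : (0:ℝ) < (1 + x) ^ t := by positivity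
  have hn : 0 < Fintype.card A := Fintype.card_pos_iff.2 ⟨0⟩
  have h3 : (∑ u : A, ((F.filter (fun f => t ≤ indeg e f u)).card : ℝ)) * (1+x)^t ≤
      Fintype.card A * ((m.choose d : ℝ) ^ (Fintype.card A) * Real.exp (x * d)) := by
    rw [Finset.sum_mul]
    refine (Finset.sum_le_sum fun u _ => chernoff d t e he hd x hx u).trans ?_
    simp
  have h4 : 2 * (∑ u : A, ((F.filter (fun f => t ≤ indeg e f u)).card : ℝ)) ≤
      (m.choose d : ℝ) ^ (Fintype.card A) := by
    refine le_of_mul_le_mul_right ?_ hp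
    have : (0:ℝ) ≤ (m.choose d : ℝ) ^ (Fintype.card A) := by positivity
    nlinarith [mul_le_mul_of_nonneg_left hc this]
  have h5 : (m.choose d : ℝ) ^ (Fintype.card A) ≤ (Fintype.card V : ℝ) ^ (Fintype.card A) +
      ∑ u : A, ((F.filter (fun f => t ≤ indeg e f u)).card : ℝ) := by
    rw [hFc] at h2
    exact_mod_cast h2
  have h6 : (m.choose d : ℝ) ^ (Fintype.card A) ≤ (2 * Fintype.card V : ℝ) ^ (Fintype.card A) := by
    rw [mul_pow]
    have : (2:ℝ) ≤ 2 ^ (Fintype.card A) := le_self_pow₀ (by norm_num) hn.ne'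
    have h0 : (0:ℝ) ≤ (Fintype.card V : ℝ) ^ (Fintype.card A) := by positivity
    nlinarith [mul_le_mul_of_nonneg_right this h0]
  have := le_of_pow_le_pow_left₀ hn.ne' (by positivity) h6
  exact_mod_cast this

end

lemma choose_le_fin (n d t D : ℕ) (hn : 0 < n) (hD : d + t ≤ D) (hd : d ≤ (n-1)/2)
    (V : Type) [Fintype V] (U : SimpleGraph V)
    (H : ∀ G : SimpleGraph (Fin n), (∀ v, (G.neighborSet v).ncard ≤ D) → Nonempty (G ↪g U))
    (x : ℝ) (hx : 0 ≤ x)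
    (hc : 2 * (n : ℝ) * Real.exp (x * d) ≤ (1 + x) ^ t) :
    ((n-1)/2).choose d ≤ 2 * Fintype.card V := by
  obtain ⟨n, rfl⟩ : ∃ k, n = k + 1 := ⟨n - 1, by omega⟩
  refine choose_le (A := ZMod (n+1)) (m := (n+1-1)/2) d t D (fun j => ((j.1 + 1 : ℕ) : ZMod (n+1)))
    ?_ ?_ hD hd V U H x hx (by simpa [ZMod.card] using hc)
  · intro i j h
    have h' := (ZMod.natCast_eq_natCast_iff' _ _ _).1 h
    have := i.2
    have := j.2
    rw [Nat.mod_eq_of_lt (by omega), Nat.mod_eq_of_lt (by omega)] at h'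
    exact Fin.ext (by omega)
  · intro i j h
    have := i.2
    have := j.2
    rw [← Nat.cast_add, ZMod.natCast_eq_zero_iff] at h
    have := Nat.le_of_dvd (by omega) h
    omega

lemma choose_shift (M d s : ℕ) : M.choose (d + s) * d ^ s ≤ M.choose d * M ^ s := by
  induction s with
  | zero => simp
  | succ s ih =>
    have h := Nat.choose_succ_right_eq M (d + s)
    calc M.choose (d + (s+1)) * d ^ (s+1) = (M.choose (d + s + 1) * d) * d ^ s := by ring_nf
      _ ≤ (M.choose (d + s + 1) * (d + s + 1)) * d ^ s := by gcongr; omega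
      _ = (M.choose (d + s) * d ^ s) * (M - (d + s)) := by rw [h]; ring
      _ ≤ (M.choose d * M ^ s) * M := by gcongr; omega
      _ = _ := by ring

lemma choose_half (n d : ℕ) (hn : 2 ≤ n) (h : 4 * d ≤ n) :
    (n/2).choose d ≤ 2 * ((n-1)/2).choose d := by
  rcases Nat.even_or_odd n with h' | h'
  · obtain ⟨q, rfl⟩ := h'
    have e1 : (q+q)/2 = (q - 1) + 1 := by omega
    have e2 : (q+q-1)/2 = q - 1 := by omega
    have := Nat.choose_mul_succ_eq (q-1) d
    rw [e1, e2]
    have h3 : q - 1 + 1 ≤ 2 * (q - 1 + 1 - d) := by omega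
    have h4 : 0 < q - 1 + 1 - d := by omega
    refine Nat.le_of_mul_le_mul_right ?_ h4
    rw [← this]
    calc _ ≤ (q-1).choose d * (2 * (q - 1 + 1 - d)) := Nat.mul_le_mul_left _ h3
      _ = _ := by ring
  · obtain ⟨q, rfl⟩ := h'
    have e1 : (2*q+1)/2 = q := by omega
    have e2 : (2*q+1-1)/2 = q := by omega
    rw [e1, e2]; omega

/-- the crude bound -/
lemma choose_crude (n D : ℕ) (hD : 1 ≤ D) (h2 : 2 * D ≤ n) :
    ((n/2).choose (D/2) : ℝ) ≤ 2 ^ (4 * ((D/2 : ℕ) : ℝ) * Real.logb 2 ((n : ℝ) / D)) := by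
  have hDr : (0:ℝ) < D := by exact_mod_cast hD
  have hnr : (2:ℝ) * D ≤ n := by exact_mod_cast h2
  have hL : (2:ℝ) ≤ (n:ℝ)/D := by rw [le_div_iff₀ hDr]; exact hnr
  have e : (2:ℝ) ^ (4 * ((D/2 : ℕ) : ℝ) * Real.logb 2 ((n : ℝ) / D)) = (((n:ℝ)/D)^4) ^ (D/2) := by
    rw [mul_comm, Real.rpow_mul (by norm_num), Real.rpow_logb (by norm_num) (by norm_num) (by linarith), ← pow_mul]
    exact_mod_cast Real.rpow_natCast _ _
  rw [e]
  rcases Nat.eq_zero_or_pos (D/2) with h0 | h0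
  · simp [h0]
  set k := D/2 with hk
  have hkr : (0:ℝ) < k := by exact_mod_cast h0
  have hkD : (D:ℝ) ≤ 3 * k := by
    have : D ≤ 3 * k := by omega
    exact_mod_cast this
  have hM : ((n/2 : ℕ) : ℝ) ≤ n / 2 := Nat.cast_div_le
  have h1 := Nat.choose_le_pow_div (α := ℝ) k (n/2)
  have h3 := Real.pow_div_factorial_le_exp (x := (k:ℝ)) hkr.le k
  refine h1.trans ?_
  have hf : (0:ℝ) < (k.factorial : ℝ) := by exact_mod_cast Nat.factorial_pos k
  have h4 : ((n/2 : ℕ) : ℝ) ≤ k * (3/2 * (n/D)) := by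
    refine hM.trans ?_
    rw [show (k:ℝ) * (3/2 * (n/D)) = (3 * k / D) * (n / 2) by ring]
    refine le_mul_of_one_le_left (by positivity) ?_
    rw [le_div_iff₀ hDr]; linarith
  have h5 : Real.exp k = (Real.exp 1) ^ k := by rw [← Real.exp_nat_mul]; simp
  have h6 : Real.exp 1 ≤ 3 := Real.exp_one_lt_three.le
  calc ((n/2 : ℕ) : ℝ)^k / k.factorial ≤ (k * (3/2 * (n/D)))^k / k.factorial := by gcongr
    _ = (k^k / k.factorial) * (3/2 * (n/D))^k := by rw [mul_pow]; ring
    _ ≤ 3 ^ k * (3/2 * (n/D))^k := by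
        gcongr
        refine h3.trans ?_
        rw [h5]; gcongr
    _ = (9/2 * (n/D)) ^ k := by rw [← mul_pow]; ring
    _ ≤ _ := by
        gcongr
        nlinarith [mul_le_mul hL hL (by norm_num) (by linarith), sq_nonneg ((n:ℝ)/D),
          pow_le_pow_left₀ (by norm_num) hL 3]

lemma main_ineq (n D s : ℕ) (hD : 1 ≤ D) (h2 : 2 * D ≤ n) (hs : 1 ≤ s)
    (hs2 : (D : ℝ) * Real.logb 2 n ≤ (s:ℝ) ^ 2)
    (V : Type) [Fintype V] (U : SimpleGraph V)
    (H : ∀ G : SimpleGraph (Fin n), (∀ v, (G.neighborSet v).ncard ≤ D) → Nonempty (G ↪g U)) :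
    ((n/2).choose (D/2) : ℝ) ≤ Fintype.card V *
      2 ^ (8 * (s:ℝ) * Real.logb 2 ((n : ℝ) / D)) := by
  have hDr : (0:ℝ) < D := by exact_mod_cast hD
  have hnr : (2:ℝ) * D ≤ n := by exact_mod_cast h2
  have hL : (2:ℝ) ≤ (n:ℝ)/D := by rw [le_div_iff₀ hDr]; exact hnr
  have hl1 : 1 ≤ Real.logb 2 ((n:ℝ)/D) := by
    rw [Real.le_logb_iff_rpow_le (by norm_num) (by linarith)]; simpa using hL
  have hsr : (1:ℝ) ≤ s := by exact_mod_cast hs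
  rcases lt_or_ge (D/2) (2 * s) with hc | hc
  · have hN : (1:ℝ) ≤ Fintype.card V := by
      obtain ⟨φ⟩ := H ⊥ (by simp [SimpleGraph.neighborSet])
      have : 0 < Fintype.card V := Fintype.card_pos_iff.2 ⟨φ ⟨0, by omega⟩⟩
      exact_mod_cast this
    have hcr : ((D/2 : ℕ) : ℝ) ≤ 2 * s := by exact_mod_cast hc.le
    refine (choose_crude n D hD h2).trans ?_
    refine le_trans ?_ (le_mul_of_one_le_left (by positivity) hN)
    refine Real.rpow_le_rpow_of_exponent_le (by norm_num) ?_
    nlinarith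
  · obtain ⟨k, hk⟩ : ∃ k, k = D/2 := ⟨_, rfl⟩
    obtain ⟨d, hd⟩ : ∃ d, k = d + s := ⟨k - s, by omega⟩
    have hds : s ≤ d := by omega
    have hkr : (0:ℝ) < k := by
      have : 0 < k := by omega
      exact_mod_cast this
    have hdr : (k:ℝ) = d + s := by rw [hd]; push_cast; ring
    have hdpos : (0:ℝ) < d := by
      have : 0 < d := by omega
      exact_mod_cast this
    have hkD : 2 * (k:ℝ) ≤ D := by
      have : 2 * k ≤ D := by omega
      exact_mod_cast this
    have hDk : (D:ℝ) ≤ 6 * d := by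
      have : D ≤ 6 * d := by omega
      exact_mod_cast this
    have hn2 : (2:ℝ) ≤ n := by
      have : 2 ≤ n := by omega
      exact_mod_cast this
    have hB := choose_le_fin n d (k + s) D (by omega) (by omega) (by omega) V U H
      ((s:ℝ)/k) (by positivity) (by
        have g1 : Real.exp (s:ℝ) ≤ (1 + (s:ℝ)/k) ^ (k + s) := by
          have g := Real.one_sub_inv_le_log_of_pos (x := 1 + (s:ℝ)/k) (by positivity)
          have g' : 1 - (1 + (s:ℝ)/k)⁻¹ = s / (k + s) := by
            field_simp; ring
          rw [g'] at g
          rw [← Real.log_le_log_iff (Real.exp_pos _) (by positivity), Real.log_exp, Real.log_pow]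
          push_cast
          rw [div_le_iff₀ (by positivity)] at g
          linarith
        refine le_trans ?_ g1
        have g2 : 2 * Real.log n ≤ (s:ℝ)^2 / k := by
          rw [le_div_iff₀ hkr]
          refine le_trans ?_ hs2
          have hlog0 : 0 ≤ Real.log n := Real.log_nonneg (by linarith)
          have : Real.log n ≤ Real.logb 2 n := by
            rw [Real.logb, le_div_iff₀ (Real.log_pos (by norm_num))]
            nlinarith [Real.log_two_lt_d9]
          nlinarith
        have g3 : 2 * (n:ℝ) ≤ Real.exp ((s:ℝ)^2/k) := by
          calc 2 * (n:ℝ) ≤ n ^ 2 := by nlinarith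
            _ = Real.exp (2 * Real.log n) := by
              rw [two_mul, Real.exp_add, Real.exp_log (by linarith)]; ring
            _ ≤ _ := Real.exp_le_exp.2 g2
        calc _ ≤ Real.exp ((s:ℝ)^2/k) * Real.exp (s/k*d) := by gcongr
          _ = Real.exp s := by
            rw [← Real.exp_add]; congr 1
            have : (d:ℝ) = k - s := by linarith
            rw [this]; field_simp; ring)
    have hC := choose_half n d (by omega) (by omega)
    have hS := choose_shift (n/2) d s
    rw [← hk]
    rw [← hd] at hS
    have hSr : ((n/2).choose k : ℝ) * (d:ℝ)^s ≤ (n/2).choose d * ((n/2 : ℕ):ℝ)^s := by exact_mod_cast hS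
    have hCB : ((n/2).choose d : ℝ) ≤ 4 * Fintype.card V := by
      have : (n/2).choose d ≤ 4 * Fintype.card V := by omega
      exact_mod_cast this
    have hM : ((n/2 : ℕ) : ℝ) ≤ n / 2 := Nat.cast_div_le
    have hM2 : ((n/2 : ℕ) : ℝ) ≤ (3 * (n/D)) * d := by
      refine hM.trans ?_
      rw [show (3 * ((n:ℝ)/D)) * d = (6 * d / D) * (n/2) by ring]
      refine le_mul_of_one_le_left (by positivity) ?_
      rw [le_div_iff₀ hDr]; linarith
    have e : (2:ℝ) ^ (8 * (s:ℝ) * Real.logb 2 ((n : ℝ) / D)) = (((n:ℝ)/D)^8) ^ s := by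
      rw [mul_comm, Real.rpow_mul (by norm_num), Real.rpow_logb (by norm_num) (by norm_num) (by linarith), ← pow_mul]
      exact_mod_cast Real.rpow_natCast _ _
    rw [e]
    have h7 : ((n/2).choose k : ℝ) ≤ (n/2).choose d * (3 * ((n:ℝ)/D))^s := by
      refine le_of_mul_le_mul_right ?_ (pow_pos hdpos s)
      refine hSr.trans ?_
      rw [mul_assoc, ← mul_pow]
      gcongr
    have h4s : (4:ℝ) ≤ 4 ^ s := le_self_pow₀ (by norm_num) (by omega)
    calc _ ≤ _ := h7
      _ ≤ (4 * Fintype.card V) * (3 * ((n:ℝ)/D))^s := by gcongr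
      _ ≤ (4 ^ s * Fintype.card V) * (3 * ((n:ℝ)/D))^s := by gcongr
      _ = Fintype.card V * (12 * ((n:ℝ)/D))^s := by
        rw [show (12 * ((n:ℝ)/D)) = 4 * (3 * ((n:ℝ)/D)) by ring, mul_pow 4]; ring
      _ ≤ _ := by
        gcongr
        have : (2:ℝ)^7 ≤ ((n:ℝ)/D)^7 := pow_le_pow_left₀ (by norm_num) hL 7
        rw [pow_succ _ 7]
        gcongr
        linarith

theorem statement7 :
    ∃ C : ℝ, 0 < C ∧ ∀ n D : ℕ, 1 ≤ D → 2 * D ≤ n →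
      ∀ (V : Type) (_ : Fintype V) (U : SimpleGraph V),
        (∀ G : SimpleGraph (Fin n),
            (∀ v : Fin n, (G.neighborSet v).ncard ≤ D) → Nonempty (G ↪g U)) →
        (Nat.choose (n / 2) (D / 2) : ℝ) *
            2 ^ (-(C * Real.sqrt (D * Real.logb 2 n) * Real.logb 2 ((n : ℝ) / D))) ≤
          (Fintype.card V : ℝ) := by
  refine ⟨16, by norm_num, fun n D hD h2 V _ U H => ?_⟩
  have hDr : (1:ℝ) ≤ D := by exact_mod_cast hD
  have hnr : (2:ℝ) * D ≤ n := by exact_mod_cast h2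
  have hL : (2:ℝ) ≤ (n:ℝ)/D := by rw [le_div_iff₀ (by linarith)]; exact hnr
  have hl1 : 1 ≤ Real.logb 2 ((n:ℝ)/D) := by
    rw [Real.le_logb_iff_rpow_le (by norm_num) (by linarith)]; simpa using hL
  have hl2 : 1 ≤ Real.logb 2 (n:ℝ) := by
    rw [Real.le_logb_iff_rpow_le (by norm_num) (by linarith)]; simp; linarith
  set q := Real.sqrt (D * Real.logb 2 n) with hq
  have hq1 : 1 ≤ q := by
    rw [hq, Real.one_le_sqrt]; nlinarith
  have hq2 : q ^ 2 = D * Real.logb 2 n := Real.sq_sqrt (by nlinarith)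
  have hle := Nat.le_ceil q
  have hlt := Nat.ceil_lt_add_one (by linarith : 0 ≤ q)
  have := main_ineq n D ⌈q⌉₊ hD h2 (by exact_mod_cast hq1.trans hle)
    (by rw [← hq2]; gcongr) V U H
  rw [Real.rpow_neg (by norm_num), ← div_eq_mul_inv, div_le_iff₀ (by positivity)]
  refine this.trans ?_
  refine mul_le_mul_of_nonneg_left ?_ (by positivity)
  refine Real.rpow_le_rpow_of_exponent_le (by norm_num) ?_
  refine mul_le_mul_of_nonneg_right ?_ (by linarith)
  linarith
end

section
/- For every n ∈ ℕ, every simple graph U having the property that every acyclic simple graph on n vertices with maximum degree at most 2 is an induced subgraph of U must have at least ⌊3n/2⌋ vertices. -/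
/-- Every induced universal graph for the family of acyclic graphs on `n`
vertices with maximum degree at most `2` has at least `⌊3n/2⌋` vertices. -/
theorem statement8 (n : ℕ) (V : Type) [Fintype V] (U : SimpleGraph V)
    (hU : ∀ G : SimpleGraph (Fin n),
      G.IsAcyclic → (∀ v : Fin n, (G.neighborSet v).ncard ≤ 2) → Nonempty (G ↪g U)) :
    3 * n / 2 ≤ Fintype.card V := by
  classical
  let M : SimpleGraph (Fin n) :=
    { Adj := fun i j => i ≠ j ∧ i.val / 2 = j.val / 2
      symm := ⟨fun i j h => ⟨h.1.symm, h.2.symm⟩⟩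
      loopless := ⟨fun i h => h.1 rfl⟩ }
  have hM : ∀ i j, M.Adj i j ↔ i ≠ j ∧ i.val / 2 = j.val / 2 := fun i j => Iff.rfl
  have huniq : ∀ v a b, M.Adj v a → M.Adj v b → a = b := by
    intro v a b ha hb
    rw [hM] at ha hb
    ext
    have h1 := Fin.val_ne_of_ne ha.1
    have h2 := Fin.val_ne_of_ne hb.1
    omega
  have hacyc : ∀ G : SimpleGraph (Fin n), (∀ v a b, G.Adj v a → G.Adj v b → a = b) →
      G.IsAcyclic := by
    intro G hG v c hc
    apply hc.snd_ne_penultimate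
    exact hG v _ _ (c.adj_snd hc.not_nil) (c.adj_penultimate hc.not_nil).symm
  have hdeg : ∀ G : SimpleGraph (Fin n), (∀ v a b, G.Adj v a → G.Adj v b → a = b) →
      ∀ v, (G.neighborSet v).ncard ≤ 2 := by
    intro G hG v
    have : (G.neighborSet v).ncard ≤ 1 := by
      rw [Set.ncard_le_one]
      intro a ha b hb
      exact hG v a b ha hb
    omega
  have hbot : ∀ v a b, (⊥ : SimpleGraph (Fin n)).Adj v a →
      (⊥ : SimpleGraph (Fin n)).Adj v b → a = b := fun v a b h => h.elim
  obtain ⟨f⟩ := hU ⊥ (hacyc _ hbot) (hdeg _ hbot)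
  obtain ⟨g⟩ := hU M (hacyc _ huniq) (hdeg _ huniq)
  let A : Finset V := Finset.univ.image f
  let B : Finset V := Finset.univ.image g
  have hA : A.card = n := by
    simp [A, Finset.card_image_of_injective _ f.injective]
  have hB : B.card = n := by
    simp [B, Finset.card_image_of_injective _ g.injective]
  let S : Finset (Fin n) := Finset.univ.filter fun i => g i ∈ A
  have hS : S.card ≤ (n + 1) / 2 := by
    rw [← Finset.card_range ((n + 1) / 2)]
    apply Finset.card_le_card_of_injOn (fun i => i.val / 2)
    · intro i _
      have := i.isLt
      simp only [Finset.coe_range, Set.mem_Iio]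
      omega
    · intro i hi j hj hij
      by_contra hne
      have hadj : U.Adj (g i) (g j) := g.map_adj_iff.2 ⟨hne, hij⟩
      simp only [S, A, Finset.coe_filter, Finset.mem_univ, true_and, Finset.mem_image,
        Set.mem_setOf_eq] at hi hj
      obtain ⟨a, ha⟩ := hi
      obtain ⟨b, hb⟩ := hj
      rw [← ha, ← hb] at hadj
      exact (f.map_adj_iff.1 hadj).elim
  have hAB : (A ∩ B).card ≤ S.card := by
    refine le_trans (Finset.card_le_card ?_) (Finset.card_image_le (s := S) (f := g))
    intro x hx
    obtain ⟨hxA, hxB⟩ := Finset.mem_inter.1 hx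
    obtain ⟨i, -, rfl⟩ := Finset.mem_image.1 hxB
    exact Finset.mem_image_of_mem _ (Finset.mem_filter.2 ⟨Finset.mem_univ _, hxA⟩)
  have h1 := Finset.card_union_add_card_inter A B
  have h2 := Finset.card_le_univ (A ∪ B)
  omega
end

section
/- For every n ≥ 1, the graph U^p_n satisfies: (a) U^p_n has ⌊3n/2⌋ vertices and max{0, 3⌊n/2⌋ − 1} edges; (b) U^p_n is an induced subgraph of U^p_{n+1}; (c) every acyclic simple graph on n vertices with maximum degree at most 2 is an induced subgraph of U^p_n. -/
/-- The successor function used to define `Upath`: `s x = x + 2` if `x ≡ 2 (mod 3)`,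
and `s x = x + 1` otherwise. -/
def pathSucc (x : ℕ) : ℕ := if x % 3 = 2 then x + 2 else x + 1

/-- The graph `U^p_n` on vertex set `{0, …, ⌊3n/2⌋ − 1}`, where `u < v` are adjacent iff
`v = pathSucc u`. -/
def Upath (n : ℕ) : SimpleGraph (Fin (3 * n / 2)) where
  Adj u v := v.val = pathSucc u.val ∨ u.val = pathSucc v.val
  symm := by constructor; intro u v h; tauto
  loopless := by
    constructor
    intro u h
    rcases h with h | h <;> unfold pathSucc at h <;> split_ifs at h <;> omega

instance (n : ℕ) : DecidableRel (Upath n).Adj := fun u v =>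
  inferInstanceAs (Decidable (_ ∨ _))


lemma edges_count (n : ℕ) (hn : 1 ≤ n) :
    (Upath n).edgeFinset.card = 3 * (n / 2) - 1 := by
  have hs : ∀ u, u < 3 * (n / 2) - 1 ↔ pathSucc u < 3 * n / 2 := by
    intro u
    unfold pathSucc
    split_ifs <;> omega
  have hlt : ∀ u, u < pathSucc u := by
    intro u
    unfold pathSucc
    split_ifs <;> omega
  rw [← Finset.card_range (3 * (n / 2) - 1)]
  symm
  refine Finset.card_bij
    (fun u hu => s((⟨u, (hlt u).trans ((hs u).1 (Finset.mem_range.1 hu))⟩ : Fin (3 * n / 2)),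
      ⟨pathSucc u, (hs u).1 (Finset.mem_range.1 hu)⟩)) ?_ ?_ ?_
  · intro u hu
    rw [SimpleGraph.mem_edgeFinset, SimpleGraph.mem_edgeSet]
    exact Or.inl rfl
  · intro u hu v hv h
    rw [Sym2.eq_iff] at h
    simp only [Fin.mk.injEq] at h
    have := hlt u
    have := hlt v
    omega
  · intro e he
    induction e using Sym2.ind with
    | _ x y =>
      rw [SimpleGraph.mem_edgeFinset, SimpleGraph.mem_edgeSet] at he
      rcases he with h | h
      · refine ⟨x.val, Finset.mem_range.2 ((hs _).2 (h ▸ y.2)), ?_⟩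
        rw [Sym2.eq_iff]
        left
        exact ⟨rfl, Fin.ext h.symm⟩
      · refine ⟨y.val, Finset.mem_range.2 ((hs _).2 (h ▸ x.2)), ?_⟩
        rw [Sym2.eq_iff]
        right
        exact ⟨rfl, Fin.ext h.symm⟩

def sadj (x y : ℕ) : Prop := y = pathSucc x ∨ x = pathSucc y

/-- `φ` realises the disjoint union of paths of sizes `m i`, `i ∈ S`, below `N`. -/
def Good {ι : Type*} (S : Finset ι) (m : ι → ℕ) (N : ℕ) (φ : ι → ℕ → ℕ) : Prop :=
  (∀ i ∈ S, ∀ a < m i, φ i a < N) ∧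
  ∀ i ∈ S, ∀ j ∈ S, ∀ a < m i, ∀ b < m j,
    (φ i a = φ j b → i = j ∧ a = b) ∧
    (sadj (φ i a) (φ j b) ↔ i = j ∧ (b = a + 1 ∨ a = b + 1))

lemma front {ι : Type*} [DecidableEq ι] (S T : Finset ι) (m : ι → ℕ) (K N : ℕ) (hT : T ⊆ S)
    (φ ψ : ι → ℕ → ℕ) (h1 : Good T m (3 * K - 1) φ) (h2 : Good (S \ T) m N ψ) :
    Good S m (3 * K + N) (fun i a => if i ∈ T then φ i a else 3 * K + ψ i a) := by
  obtain ⟨b1, a1⟩ := h1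
  obtain ⟨b2, a2⟩ := h2
  have key : ∀ x y, x < 3 * K - 1 → x ≠ 3 * K + y ∧ ¬ sadj x (3 * K + y) ∧
      ¬ sadj (3 * K + y) x := by
    intro x y h
    unfold sadj pathSucc
    split_ifs <;> omega
  have sh : ∀ x y, sadj (3 * K + x) (3 * K + y) ↔ sadj x y := by
    intro x y
    unfold sadj pathSucc
    split_ifs <;> omega
  constructor
  · intro i hi a ha
    by_cases h : i ∈ T
    · simp only [h, if_true]
      have := b1 i h a ha
      omega
    · simp only [h, if_false]
      have := b2 i (by simp [hi, h]) a ha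
      omega
  · intro i hi j hj a ha b hb
    by_cases h : i ∈ T <;> by_cases h' : j ∈ T
    · simp only [h, h', if_true]
      exact a1 i h j h' a ha b hb
    · simp only [h, h', if_true, if_false]
      have hne : i ≠ j := by rintro rfl; exact h' h
      have := key _ (ψ j b) (b1 i h a ha)
      tauto
    · simp only [h, h', if_true, if_false]
      have hne : i ≠ j := by rintro rfl; exact h h'
      have := key _ (ψ i a) (b1 j h' b hb)
      have := this.1.symm
      tauto
    · simp only [h, h', if_false]
      rw [sh]
      have := a2 i (by simp [hi, h]) j (by simp [hj, h']) a ha b hb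
      refine ⟨fun e => this.1 (by omega), this.2⟩

def ev (a : ℕ) : ℕ := a + (a - 1) / 2

lemma ev_adj (a b : ℕ) : (ev a = ev b → a = b) ∧ (sadj (ev a) (ev b) ↔ b = a + 1 ∨ a = b + 1) := by
  unfold sadj pathSucc ev
  split_ifs <;> omega

lemma good_single {ι : Type*} (i : ι) (m : ι → ℕ) (N : ℕ) (h : ∀ a < m i, ev a < N) :
    Good {i} m N (fun _ a => ev a) := by
  constructor
  · intro j hj a ha
    rw [Finset.mem_singleton] at hj
    subst hj
    exact h a ha
  · intro j hj k hk a ha b hb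
    rw [Finset.mem_singleton] at hj hk
    subst hj hk
    simpa using ev_adj a b

def od (k l b : ℕ) : ℕ := if b = 2 * l then 3 * (k + l) else 3 * k + 2 + b + (b + 1) / 2

lemma od_adj (k l a b : ℕ) (ha : a < 2 * l + 1) (hb : b < 2 * l + 1) :
    (od k l a = od k l b → a = b) ∧
      (sadj (od k l a) (od k l b) ↔ b = a + 1 ∨ a = b + 1) := by
  unfold sadj pathSucc od
  split_ifs <;> omega

lemma evod (k l a b : ℕ) (hk : 1 ≤ k) (ha : a < 2 * k + 1) (hb : b < 2 * l + 1) :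
    ev a ≠ od k l b ∧ ¬ sadj (ev a) (od k l b) ∧ ¬ sadj (od k l b) (ev a) := by
  unfold sadj pathSucc od ev
  split_ifs <;> omega

lemma good_pair {ι : Type*} [DecidableEq ι] (i j : ι) (hij : i ≠ j) (m : ι → ℕ) (k l : ℕ)
    (hk : 1 ≤ k) (hi : m i = 2 * k + 1) (hj : m j = 2 * l + 1) :
    Good {i, j} m (3 * (k + l + 1) - 1) (fun x a => if x = i then ev a else od k l a) := by
  have hji := hij.symm
  constructor
  · intro x hx a ha
    rw [Finset.mem_insert, Finset.mem_singleton] at hx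
    rcases hx with rfl | rfl
    · simp only [if_true]
      unfold ev
      omega
    · simp only [hji, if_false]
      unfold od
      split_ifs <;> omega
  · intro x hx y hy a ha b hb
    rw [Finset.mem_insert, Finset.mem_singleton] at hx hy
    rcases hx with rfl | rfl <;> rcases hy with rfl | rfl
    · simpa using ev_adj a b
    · have := evod k l a b hk (by omega) (by omega)
      simp only [hji, if_true, if_false]
      tauto
    · have := evod k l b a hk (by omega) (by omega)
      have := this.1.symm
      simp only [hji, if_true, if_false]
      tauto
    · simpa [hji] using od_adj k l a b (by omega) (by omega)

lemma good_ones {ι : Type*} (S : Finset ι) (m : ι → ℕ) (h : ∀ i ∈ S, m i = 1) :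
    ∃ φ, Good S m (3 * (∑ i ∈ S, m i) / 2) φ := by
  classical
  have hs : ∑ i ∈ S, m i = S.card := by
    rw [Finset.sum_congr rfl h]; simp
  rw [hs]
  let e := S.equivFin
  let q : ι → ℕ := fun i => if hi : i ∈ S then (e ⟨i, hi⟩ : ℕ) else 0
  have hq : ∀ i ∈ S, q i < S.card := by
    intro i hi
    simp only [q, hi, dif_pos]
    exact (e ⟨i, hi⟩).2
  have hinj : ∀ i ∈ S, ∀ j ∈ S, q i = q j → i = j := by
    intro i hi j hj hh
    simp only [q, hi, hj, dif_pos] at hh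
    have := e.injective (Fin.ext hh)
    simpa using this
  refine ⟨fun i _ => 3 * (q i / 2) + 2 * (q i % 2), ?_, ?_⟩
  · intro i hi a ha
    have := hq i hi
    simp only
    omega
  · intro i hi j hj a ha b hb
    rw [h i hi] at ha
    rw [h j hj] at hb
    simp only
    constructor
    · intro hh
      exact ⟨hinj i hi j hj (by omega), by omega⟩
    · have : ¬ sadj (3 * (q i / 2) + 2 * (q i % 2)) (3 * (q j / 2) + 2 * (q j % 2)) := by
        rcases Nat.mod_two_eq_zero_or_one (q i) with h1 | h1 <;>
        rcases Nat.mod_two_eq_zero_or_one (q j) with h2 | h2 <;>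
        rw [h1, h2] <;> generalize q i / 2 = x <;> generalize q j / 2 = y <;>
        unfold sadj pathSucc <;>
        split_ifs <;> omega
      constructor
      · intro h; exact absurd h this
      · rintro ⟨-, h⟩; omega

lemma good_exists {ι : Type*} (m : ι → ℕ) (hm : ∀ i, 1 ≤ m i) (c : ℕ) :
    ∀ S : Finset ι, S.card = c → ∃ φ, Good S m (3 * (∑ i ∈ S, m i) / 2) φ := by
  classical
  induction c using Nat.strong_induction_on with
  | _ c ih =>
  intro S hc
  -- the general front step
  have step : ∀ (T : Finset ι) (K : ℕ) (φ : ι → ℕ → ℕ), T ⊆ S → T.Nonempty →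
      ∑ i ∈ T, m i = 2 * K → Good T m (3 * K - 1) φ →
      ∃ φ, Good S m (3 * (∑ i ∈ S, m i) / 2) φ := by
    intro T K φ hT hne hK hg
    obtain ⟨ψ, hψ⟩ := ih (S \ T).card
      (hc ▸ Finset.card_lt_card (Finset.sdiff_ssubset hT hne)) (S \ T) rfl
    have := front S T m K _ hT φ ψ hg hψ
    have hsum := Finset.sum_sdiff (f := m) hT
    have e : 3 * (∑ i ∈ S, m i) / 2 = 3 * K + 3 * (∑ i ∈ S \ T, m i) / 2 := by omega
    rw [e]
    exact ⟨_, this⟩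
  by_cases h1 : ∃ i ∈ S, m i % 2 = 0
  · obtain ⟨i, hi, he⟩ := h1
    have := hm i
    refine step {i} (m i / 2) _ (by simpa using hi) (by simp) (by simp; omega)
      (good_single i m _ ?_)
    intro a ha
    unfold ev
    omega
  by_cases h2 : ∃ i ∈ S, m i ≠ 1
  · obtain ⟨i, hi, hi1⟩ := h2
    have hodd : ∀ j ∈ S, m j % 2 = 1 := by
      intro j hj
      by_contra hh
      exact h1 ⟨j, hj, by omega⟩
    have := hodd i hi
    have := hm i
    by_cases h3 : ∃ j ∈ S, i ≠ j
    · obtain ⟨j, hj, hij⟩ := h3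
      have := hodd j hj
      refine step {i, j} (m i / 2 + m j / 2 + 1) _ ?_ (by simp) ?_
        (good_pair i j hij m (m i / 2) (m j / 2) (by omega) (by omega) (by omega))
      · intro x hx
        rw [Finset.mem_insert, Finset.mem_singleton] at hx
        rcases hx with rfl | rfl <;> assumption
      · rw [Finset.sum_pair hij]
        omega
    · have hS : S = {i} := by
        ext x
        rw [Finset.mem_singleton]
        constructor
        · intro hx
          by_contra hne
          exact h3 ⟨x, hx, fun h => hne h.symm⟩
        · rintro rfl; exact hi
      rw [hS]
      refine ⟨_, good_single i m _ ?_⟩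
      intro a ha
      rw [Finset.sum_singleton]
      unfold ev
      omega
  · push Not at h2
    exact good_ones S m h2

open SimpleGraph in
lemma comp_path {V : Type*} [Finite V] (G : SimpleGraph V) (hG : G.IsAcyclic)
    (hd : ∀ v, (G.neighborSet v).ncard ≤ 2) (C : G.ConnectedComponent) :
    ∃ (m : ℕ) (g : ℕ → V), 1 ≤ m ∧ (∀ v, G.connectedComponentMk v = C ↔ ∃ i < m, g i = v) ∧
      (∀ i < m, ∀ j < m, g i = g j → i = j) ∧
      (∀ i < m, ∀ j < m, G.Adj (g i) (g j) ↔ (j = i + 1 ∨ i = j + 1)) := by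
  classical
  have := Fintype.ofFinite V
  obtain ⟨v0, rfl⟩ := C.exists_rep
  change ∃ (m : ℕ) (g : ℕ → V), 1 ≤ m ∧
    (∀ v, G.connectedComponentMk v = G.connectedComponentMk v0 ↔ ∃ i < m, g i = v) ∧ _
  -- maximal path
  let P : ℕ → Prop := fun k => ∃ (r e : V) (w : G.Walk r e), w.IsPath ∧
    G.connectedComponentMk r = G.connectedComponentMk v0 ∧ w.length = k
  have hP0 : P 0 := ⟨v0, v0, Walk.nil, by simp, rfl, rfl⟩
  have hb : ∀ k, P k → k ≤ Fintype.card V := by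
    rintro k ⟨r, e, w, hw, -, rfl⟩
    exact hw.length_lt.le
  have hPM := Nat.findGreatest_spec (P := P) (Nat.zero_le (Fintype.card V)) hP0
  have hmax : ∀ k, P k → k ≤ Nat.findGreatest P (Fintype.card V) :=
    fun k hk => Nat.le_findGreatest (hb k hk) hk
  obtain ⟨r, e, w, hw, hr, hlen⟩ := hPM
  rw [← hlen] at hmax
  have hinj : ∀ i < w.length + 1, ∀ j < w.length + 1, w.getVert i = w.getVert j → i = j := by
    intro i hi j hj h
    exact hw.getVert_injOn (by simp; omega) (by simp; omega) h
  have hcons : ∀ i j, i < j → j < w.length + 1 → G.Adj (w.getVert i) (w.getVert j) →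
      j = i + 1 := by
    intro i j hij hj ha
    let q := (w.drop i).take (j - i)
    have hq : q.IsPath := (hw.drop i).take (j - i)
    have hend : (w.drop i).getVert (j - i) = w.getVert j := by
      rw [Walk.drop_getVert]; congr 1; omega
    have hl : q.length = j - i := by
      simp [q, Walk.take_length, Walk.drop_length]; omega
    have ha' : G.Adj (w.getVert i) ((w.drop i).getVert (j - i)) := by rw [hend]; exact ha
    have := (hG.subsingleton_path _ _).elim ⟨q, hq⟩ (Path.singleton ha')
    have h2 := congrArg (fun p : G.Path _ _ => p.1.length) this
    simp [Path.singleton, hl] at h2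
    omega
  have hclosed : ∀ i < w.length + 1, ∀ x, G.Adj (w.getVert i) x →
      ∃ j < w.length + 1, w.getVert j = x := by
    intro i hi x hx
    by_contra hno
    have hns : x ∉ w.support := by
      intro hm
      rw [Walk.mem_support_iff_exists_getVert] at hm
      obtain ⟨j, hj, hj'⟩ := hm
      exact hno ⟨j, by omega, hj⟩
    rcases Nat.eq_zero_or_pos i with rfl | hpos
    · rw [Walk.getVert_zero] at hx
      have := hmax (w.length + 1) ⟨x, e, Walk.cons hx.symm w, by simp [hw, hns], by
        rw [← hr]; exact ConnectedComponent.sound hx.symm.reachable, by simp⟩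
      omega
    rcases Nat.lt_or_ge i w.length with hlt | hge
    · have h1 : G.Adj (w.getVert i) (w.getVert (i + 1)) := w.adj_getVert_succ hlt
      have h2 : G.Adj (w.getVert i) (w.getVert (i - 1)) := by
        have := w.adj_getVert_succ (i := i - 1) (by omega)
        rw [Nat.sub_add_cancel hpos] at this
        exact this.symm
      have h3 : ({w.getVert (i+1), w.getVert (i-1), x} : Finset V).card = 3 := by
        rw [Finset.card_eq_three]
        refine ⟨_, _, _, ?_, ?_, ?_, rfl⟩
        · intro h
          have := hinj _ (by omega) _ (by omega) h
          omega
        · intro h; exact hno ⟨i+1, by omega, h⟩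
        · intro h; exact hno ⟨i-1, by omega, h⟩
      have h4 : ((({w.getVert (i+1), w.getVert (i-1), x} : Finset V)) : Set V) ⊆
          G.neighborSet (w.getVert i) := by
        intro y hy
        simp only [Finset.coe_insert, Finset.coe_singleton, Set.mem_insert_iff,
          Set.mem_singleton_iff] at hy
        rcases hy with rfl | rfl | rfl <;> assumption
      have h5 := Set.ncard_le_ncard h4 (Set.toFinite _)
      rw [Set.ncard_coe_finset, h3] at h5
      have := hd (w.getVert i)
      omega
    · have : i = w.length := by omega
      subst this
      rw [Walk.getVert_length] at hx
      have := hmax (w.length + 1) ⟨r, x, w.concat hx, hw.concat hns hx, hr, by simp⟩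
      omega
  refine ⟨w.length + 1, w.getVert, by omega, ?_, hinj, ?_⟩
  · intro v
    rw [← hr]
    constructor
    · intro h
      obtain ⟨p⟩ := (ConnectedComponent.exact h).symm
      have : ∀ (a b : V) (p : G.Walk a b), (∃ i < w.length + 1, w.getVert i = a) →
          ∃ i < w.length + 1, w.getVert i = b := by
        intro a b p
        induction p with
        | nil => exact id
        | cons h p ih =>
          rintro ⟨i, hi, rfl⟩
          exact ih (hclosed i hi _ h)
      exact this r v p ⟨0, by omega, by simp⟩
    · rintro ⟨i, hi, rfl⟩
      exact ConnectedComponent.sound (w.take i).reachable.symm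
  · intro i hi j hj
    constructor
    · intro h
      rcases lt_trichotomy i j with hlt | rfl | hgt
      · exact Or.inl (hcons i j hlt hj h)
      · exact absurd h (G.loopless.irrefl _)
      · exact Or.inr (hcons j i hgt hi h.symm)
    · rintro (rfl | rfl)
      · exact w.adj_getVert_succ (by omega)
      · exact (w.adj_getVert_succ (by omega)).symm

lemma part_c (n : ℕ) (G : SimpleGraph (Fin n)) (hG : G.IsAcyclic)
    (hd : ∀ v, (G.neighborSet v).ncard ≤ 2) : Nonempty (G ↪g Upath n) := by
  classical
  have : Fintype G.ConnectedComponent := Fintype.ofFinite _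
  choose m g hm hc hi ha using comp_path G hG hd
  have hp : ∀ v, ∃ i < m (G.connectedComponentMk v), g (G.connectedComponentMk v) i = v :=
    fun v => (hc _ v).1 rfl
  choose p hp1 hp2 using hp
  obtain ⟨φ, hφ⟩ := good_exists m hm _ (Finset.univ : Finset G.ConnectedComponent) rfl
  have hsum : ∑ C, m C = n := by
    have hbij : Function.Bijective
        (fun x : (Σ C : G.ConnectedComponent, Fin (m C)) => g x.1 x.2) := by
      constructor
      · rintro ⟨C, i⟩ ⟨D, j⟩ h
        simp only at h
        have h1 := (hc C (g C i)).2 ⟨i, i.2, rfl⟩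
        have h2 := (hc D (g D j)).2 ⟨j, j.2, rfl⟩
        rw [← h, h1] at h2
        subst h2
        have := hi C i i.2 j j.2 h
        rw [Fin.ext this]
      · intro v
        exact ⟨⟨_, ⟨p v, hp1 v⟩⟩, hp2 v⟩
    have := Fintype.card_of_bijective hbij
    simpa using this
  rw [hsum] at hφ
  obtain ⟨hb, hφ⟩ := hφ
  have key := fun u v => hφ (G.connectedComponentMk u) (Finset.mem_univ _)
    (G.connectedComponentMk v) (Finset.mem_univ _) (p u) (hp1 u) (p v) (hp1 v)
  have back : ∀ u v, G.connectedComponentMk u = G.connectedComponentMk v →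
      g (G.connectedComponentMk u) (p v) = v ∧ p v < m (G.connectedComponentMk u) := by
    intro u v h
    rw [h]
    exact ⟨hp2 v, hp1 v⟩
  refine ⟨⟨⟨fun v => ⟨φ (G.connectedComponentMk v) (p v),
    hb _ (Finset.mem_univ _) _ (hp1 v)⟩, ?_⟩, ?_⟩⟩
  · intro u v h
    obtain ⟨h1, h2⟩ := (key u v).1 (Fin.mk.inj h)
    have := (back u v h1).1
    rw [← h2, hp2 u] at this
    exact this
  · intro u v
    change sadj (φ (G.connectedComponentMk u) (p u)) (φ (G.connectedComponentMk v) (p v)) ↔ _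
    rw [(key u v).2]
    constructor
    · rintro ⟨h1, h2⟩
      have := (ha _ (p u) (hp1 u) (p v) (back u v h1).2).2 h2
      rwa [hp2 u, (back u v h1).1] at this
    · intro h
      have h1 : G.connectedComponentMk u = G.connectedComponentMk v :=
        SimpleGraph.ConnectedComponent.sound h.reachable
      refine ⟨h1, (ha _ (p u) (hp1 u) (p v) (back u v h1).2).1 ?_⟩
      rwa [hp2 u, (back u v h1).1]

/-- For every `n ≥ 1`: (a) `U^p_n` has `⌊3n/2⌋` vertices and
`max {0, 3⌊n/2⌋ − 1}` edges; (b) `U^p_n` is an induced subgraph of `U^p_{n+1}`;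
(c) every acyclic graph on `n` vertices with maximum degree at most `2` is an induced
subgraph of `U^p_n`. -/
theorem statement9 (n : ℕ) (hn : 1 ≤ n) :
    (Fintype.card (Fin (3 * n / 2)) = 3 * n / 2 ∧
      (Upath n).edgeFinset.card = max 0 (3 * (n / 2) - 1)) ∧
    Nonempty (Upath n ↪g Upath (n + 1)) ∧
    (∀ G : SimpleGraph (Fin n),
      G.IsAcyclic → (∀ v : Fin n, (G.neighborSet v).ncard ≤ 2) →
        Nonempty (G ↪g Upath n)) := by
  refine ⟨⟨Fintype.card_fin _, ?_⟩, ?_, part_c n⟩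
  · rw [edges_count n hn]
    simp
  · refine ⟨⟨Fin.castLEEmb (by omega), ?_⟩⟩
    intro u v
    exact Iff.rfl
end

section
/- For every k ≥ 1, the path graph P_{2k} on 2k vertices is an induced subgraph of the graph U^p_{2k}. -/
/-- For every `k ≥ 1`, the path graph on `2k` vertices is an induced
subgraph of `U^p_{2k}`. -/
theorem statement10 (k : ℕ) (hk : 1 ≤ k) :
    Nonempty (SimpleGraph.pathGraph (2 * k) ↪g Upath (2 * k)) := by
  refine ⟨⟨⟨fun i => ⟨3 * (i.val / 2) + 1 + i.val % 2, by have := i.isLt; omega⟩, ?_⟩, ?_⟩⟩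
  · intro a b h
    simp only [Fin.mk.injEq] at h
    ext
    omega
  · intro a b
    rw [SimpleGraph.pathGraph_adj]
    change (3 * (b.val / 2) + 1 + b.val % 2 = pathSucc (3 * (a.val / 2) + 1 + a.val % 2) ∨
      3 * (a.val / 2) + 1 + a.val % 2 = pathSucc (3 * (b.val / 2) + 1 + b.val % 2)) ↔ _
    unfold pathSucc
    split_ifs <;> omega
end

section
/- For every k ≥ 2, the path graph P_{2k+1} on 2k+1 vertices is an induced subgraph of the graph U^p_{2k}. -/
/-- For every `k ≥ 2`, the path graph on `2k+1` vertices is an induced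
subgraph of `U^p_{2k}`. -/
theorem statement11 (k : ℕ) (hk : 2 ≤ k) :
    Nonempty (SimpleGraph.pathGraph (2 * k + 1) ↪g Upath (2 * k)) := by
  have hs : ∀ i : ℕ, pathSucc (i + (i - 1) / 2) = (i + 1) + i / 2 := by
    intro i
    unfold pathSucc
    split_ifs <;> omega
  refine ⟨⟨⟨fun i => ⟨i.val + (i.val - 1) / 2, by have := i.isLt; omega⟩, ?_⟩, ?_⟩⟩
  · intro a b h
    simp only [Fin.mk.injEq] at h
    ext
    omega
  · intro a b
    rw [SimpleGraph.pathGraph_adj]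
    change (b.val + (b.val - 1) / 2 = pathSucc (a.val + (a.val - 1) / 2) ∨
      a.val + (a.val - 1) / 2 = pathSucc (b.val + (b.val - 1) / 2)) ↔ _
    rw [hs, hs]
    omega
end

section
/- For every n ∈ ℕ, the graph U_n satisfies: (a) U_n has max{0, 2n − 1} vertices and max{0, n − 1, 3n − 5, 4n − 9} edges (the maxima taken over the integers); (b) U_n is an induced subgraph of U_{n+1}; (c) every simple graph on n vertices with maximum degree at most 2 is an induced subgraph of U_n. -/
/-- The shift function used to define `Umax2`: `s x = x + 4` if `x` is even,
and `s x = x + 3` if `x` is odd. -/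
def maxTwoSucc (x : ℕ) : ℕ := if x % 2 = 0 then x + 4 else x + 3

/-- The graph `U_n` on vertex set `{0, …, 2n − 2}`, where distinct `u, v` are adjacent iff
`u ≠ 2`, `v ≠ 2`, and (`|u − v| = 1` or `u = maxTwoSucc v` or `v = maxTwoSucc u`). -/
def Umax2 (n : ℕ) : SimpleGraph (Fin (2 * n - 1)) where
  Adj u v := u.val ≠ 2 ∧ v.val ≠ 2 ∧
    (u.val + 1 = v.val ∨ v.val + 1 = u.val ∨
      u.val = maxTwoSucc v.val ∨ v.val = maxTwoSucc u.val)
  symm := by constructor; intro u v h; tauto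
  loopless := by
    constructor
    intro u h
    obtain ⟨-, -, h⟩ := h
    simp only [maxTwoSucc] at h
    rcases h with h | h | h | h <;> first | omega | (split_ifs at h <;> omega)

instance (n : ℕ) : DecidableRel (Umax2 n).Adj := fun u v =>
  inferInstanceAs (Decidable (_ ∧ _))


namespace U2

/-- Adjacency pattern on the naturals, ignoring the exceptional vertex. -/
def R (x y : ℕ) : Prop :=
  x + 1 = y ∨ y + 1 = x ∨ (y % 2 = 0 ∧ x = y + 4) ∨ (y % 2 = 1 ∧ x = y + 3) ∨
    (x % 2 = 0 ∧ y = x + 4) ∨ (x % 2 = 1 ∧ y = x + 3)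

lemma R_iff (x y : ℕ) : R x y ↔
    (x + 1 = y ∨ y + 1 = x ∨ x = maxTwoSucc y ∨ y = maxTwoSucc x) := by
  unfold R maxTwoSucc
  split_ifs <;> omega

lemma R_symm {x y : ℕ} (h : R x y) : R y x := by
  unfold R at *; omega

instance (x y : ℕ) : Decidable (R x y) := by unfold R; infer_instance

/-! ### Edge count -/

/-- Neighbours of `v` below `v`. -/
def back (v : ℕ) : Finset ℕ := (Finset.range v).filter (fun u => u ≠ 2 ∧ v ≠ 2 ∧ R u v)

lemma edge_card (n : ℕ) :
    (Umax2 n).edgeFinset.card = ∑ v ∈ Finset.range (2 * n - 1), (back v).card := by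
  classical
  rw [← Finset.card_sigma]
  symm
  rw [← Finset.card_map (⟨Sym2.map (Fin.val : Fin (2 * n - 1) → ℕ),
    Sym2.map.injective Fin.val_injective⟩ : Sym2 (Fin (2*n-1)) ↪ Sym2 ℕ)]
  refine Finset.card_bij (fun p _ => s(p.2, p.1)) ?_ ?_ ?_
  · rintro ⟨v, u⟩ h
    simp only [Finset.mem_sigma, Finset.mem_range, back, Finset.mem_filter] at h
    obtain ⟨hv, hu, h2, h3, hR⟩ := h
    rw [Finset.mem_map]
    refine ⟨s(⟨u, by omega⟩, ⟨v, hv⟩), ?_, rfl⟩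
    rw [SimpleGraph.mem_edgeFinset, SimpleGraph.mem_edgeSet]
    exact ⟨h2, h3, (R_iff _ _).1 hR⟩
  · rintro ⟨v, u⟩ h ⟨v', u'⟩ h' he
    simp only [Finset.mem_sigma, Finset.mem_range, back, Finset.mem_filter] at h h'
    simp only [Sym2.eq_iff] at he
    have : u = u' ∧ v = v' := by omega
    obtain ⟨rfl, rfl⟩ := this
    rfl
  · intro e he
    rw [Finset.mem_map] at he
    obtain ⟨e, he, rfl⟩ := he
    induction e using Sym2.ind with
    | _ x y =>
    rw [SimpleGraph.mem_edgeFinset, SimpleGraph.mem_edgeSet] at he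
    have hne : x.val ≠ y.val := fun h => he.ne (Fin.ext h)
    obtain ⟨h2, h3, h⟩ := he
    have hR := (R_iff _ _).2 h
    rcases lt_or_gt_of_ne hne with hl | hl
    · refine ⟨⟨y.val, x.val⟩, ?_, rfl⟩
      simp only [Finset.mem_sigma, Finset.mem_range, back, Finset.mem_filter]
      exact ⟨y.2, hl, h2, h3, hR⟩
    · refine ⟨⟨x.val, y.val⟩, ?_, Sym2.eq_swap⟩
      simp only [Finset.mem_sigma, Finset.mem_range, back, Finset.mem_filter]
      exact ⟨x.2, hl, h3, h2, R_symm hR⟩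

lemma back_odd (m : ℕ) (hm : 3 ≤ m) : (back (2 * m + 1)).card = 1 := by
  have : back (2 * m + 1) = {2 * m} := by
    ext u
    unfold back
    rw [Finset.mem_filter]
    simp only [R, Finset.mem_range, Finset.mem_singleton]
    omega
  rw [this]; rfl

lemma back_even (m : ℕ) (hm : 3 ≤ m) : (back (2 * m + 2)).card = 3 := by
  have : back (2 * m + 2) = {2 * m + 1, 2 * m - 1, 2 * m - 2} := by
    ext u
    unfold back
    rw [Finset.mem_filter]
    simp only [R, Finset.mem_range, Finset.mem_singleton,
      Finset.mem_insert]
    omega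
  rw [this, Finset.card_insert_of_notMem, Finset.card_insert_of_notMem, Finset.card_singleton]
  · simp only [Finset.mem_singleton]; omega
  · simp only [Finset.mem_singleton, Finset.mem_insert]; omega

lemma sum_back (k : ℕ) :
    ∑ v ∈ Finset.range (2 * (k + 4) - 1), (back v).card = 4 * k + 7 := by
  induction k with
  | zero => decide
  | succ k ih =>
    have e : 2 * (k + 1 + 4) - 1 = (2 * (k + 4) - 1) + 1 + 1 := by omega
    rw [e, Finset.sum_range_succ, Finset.sum_range_succ, ih]
    have e1 : 2 * (k + 4) - 1 = 2 * (k + 3) + 1 := by omega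
    rw [e1, back_odd _ (by omega), back_even _ (by omega)]
    omega

lemma edges (n : ℕ) : ((Umax2 n).edgeFinset.card : ℤ) =
    max 0 (max ((n : ℤ) - 1) (max (3 * (n : ℤ) - 5) (4 * (n : ℤ) - 9))) := by
  rw [edge_card]
  by_cases h : 4 ≤ n
  · obtain ⟨k, rfl⟩ := Nat.exists_eq_add_of_le' h
    rw [sum_back]; push_cast; omega
  · have : n = 0 ∨ n = 1 ∨ n = 2 ∨ n = 3 := by omega
    rcases this with rfl | rfl | rfl | rfl <;> decide

/-! ### Components -/

variable {V : Type} [Fintype V] [DecidableEq V] (G : SimpleGraph V)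

/-- adjacency pattern of a path / cycle on `m` vertices -/
def Pat (m : ℕ) (c : Prop) (i j : ℕ) : Prop :=
  i + 1 = j ∨ j + 1 = i ∨ (c ∧ ((i = 0 ∧ j + 1 = m) ∨ (j = 0 ∧ i + 1 = m)))

structure Comp (S : Finset V) (m : ℕ) (c : Prop) (g : ℕ → V) : Prop where
  pos : 0 < m
  notin : ∀ i < m, g i ∉ S
  inj : ∀ i < m, ∀ j < m, g i = g j → i = j
  adj : ∀ i < m, ∀ j < m, (G.Adj (g i) (g j) ↔ Pat m c i j)
  closed : ∀ i < m, ∀ w, G.Adj (g i) w → ∃ j < m, w = g j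
  three : c → 3 ≤ m

structure IsPth (S : Finset V) (m : ℕ) (g : ℕ → V) : Prop where
  pos : 0 < m
  notin : ∀ i < m, g i ∉ S
  inj : ∀ i < m, ∀ j < m, g i = g j → i = j
  adj : ∀ i, i + 1 < m → G.Adj (g i) (g (i + 1))

structure Placed (S : Finset V) (f : V → ℕ) : Prop where
  closed : ∀ u ∈ S, ∀ w, G.Adj u w → w ∈ S
  inj : ∀ u ∈ S, ∀ v ∈ S, f u = f v → u = v
  adj : ∀ u ∈ S, ∀ v ∈ S, (G.Adj u v ↔ R (f u) (f v))
  ne2 : ∀ u ∈ S, f u ≠ 2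

variable {G}

lemma deg_use (hd : ∀ v, (G.neighborSet v).ncard ≤ 2) {v a b w : V} (hab : a ≠ b)
    (ha : G.Adj v a) (hb : G.Adj v b) (hw : G.Adj v w) : w = a ∨ w = b := by
  by_contra hcon
  push Not at hcon
  have h3 : ({w, a, b} : Set V).ncard = 3 := Set.ncard_eq_three.2 ⟨w, a, b, hcon.1, hcon.2, hab, rfl⟩
  have hsub : ({w, a, b} : Set V) ⊆ G.neighborSet v := by
    intro x hx
    simp only [Set.mem_insert_iff, Set.mem_singleton_iff] at hx
    rcases hx with rfl | rfl | rfl <;> assumption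
  have := Set.ncard_le_ncard hsub (Set.toFinite _)
  have := hd v
  omega

lemma exists_comp (hd : ∀ v, (G.neighborSet v).ncard ≤ 2) (S : Finset V)
    (hS : ∀ u ∈ S, ∀ w, G.Adj u w → w ∈ S) (v : V) (hv : v ∉ S) :
    ∃ m c g, Comp G S m c g := by
  classical
  have hle : ∀ m g, IsPth G S m g → m ≤ Fintype.card V := by
    intro m g h
    have : Function.Injective (fun i : Fin m => g i) := by
      intro i j hij
      exact Fin.ext (h.inj _ i.2 _ j.2 hij)
    simpa using Fintype.card_le_of_injective _ this
  have h1 : IsPth G S 1 (fun _ => v) :=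
    ⟨by omega, fun _ _ => hv, fun i hi j hj _ => by omega, fun i hi => by omega⟩
  let P : ℕ → Prop := fun m => ∃ g, IsPth G S m g
  have hP1 : P 1 := ⟨_, h1⟩
  obtain ⟨g, hg⟩ : P (Nat.findGreatest P (Fintype.card V)) :=
    Nat.findGreatest_spec (hle _ _ h1) hP1
  set m := Nat.findGreatest P (Fintype.card V) with hm
  have hmax : ∀ g', ¬ IsPth G S (m + 1) g' := by
    intro g' h'
    have := Nat.le_findGreatest (P := P) (hle _ _ h') ⟨g', h'⟩
    omega
  clear_value m
  have hnS : ∀ i < m, ∀ w, G.Adj (g i) w → w ∉ S := by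
    intro i hi w hw hwS
    exact hg.notin i hi (hS w hwS _ hw.symm)
  have ext0 : ∀ w, G.Adj (g 0) w → ∃ j < m, w = g j := by
    intro w hw
    by_contra hcon
    push Not at hcon
    refine hmax (fun i => if i = 0 then w else g (i - 1)) ⟨by omega, ?_, ?_, ?_⟩
    · intro i hi
      split_ifs with h
      · exact hnS 0 hg.pos w hw
      · exact hg.notin _ (by omega)
    · intro i hi j hj hij
      split_ifs at hij with h h' h'
      · omega
      · exact absurd hij (hcon _ (by omega))
      · exact absurd hij.symm (hcon _ (by omega))
      · have := hg.inj _ (by omega) _ (by omega) hij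
        omega
    · intro i hi
      rw [if_neg (by omega : ¬ (i + 1 = 0))]
      split_ifs with h
      · subst h; exact hw.symm
      · have := hg.adj (i - 1) (by omega)
        rw [show i - 1 + 1 = i + 1 - 1 by omega] at this
        exact this
  have extl : ∀ w, G.Adj (g (m - 1)) w → ∃ j < m, w = g j := by
    intro w hw
    by_contra hcon
    push Not at hcon
    have := hg.pos
    refine hmax (fun i => if i = m then w else g i) ⟨by omega, ?_, ?_, ?_⟩
    · intro i hi
      split_ifs with h
      · exact hnS (m - 1) (by omega) w hw
      · exact hg.notin _ (by omega)
    · intro i hi j hj hij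
      split_ifs at hij with h h' h'
      · omega
      · exact absurd hij (hcon _ (by omega))
      · exact absurd hij.symm (hcon _ (by omega))
      · exact hg.inj _ (by omega) _ (by omega) hij
    · intro i hi
      rw [if_neg (by omega : ¬ (i = m))]
      split_ifs with h
      · rw [show i = m - 1 by omega]; exact hw
      · exact hg.adj i (by omega)
  have hint : ∀ i, 0 < i → i + 1 < m → ∀ w, G.Adj (g i) w → w = g (i - 1) ∨ w = g (i + 1) := by
    intro i h0 hi w hw
    refine deg_use hd (v := g i) ?_ ?_ (hg.adj i hi) hw
    · intro h
      have := hg.inj _ (by omega) _ (by omega) h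
      omega
    · have := hg.adj (i - 1) (by omega)
      rw [show i - 1 + 1 = i by omega] at this
      exact this.symm
  have hlt : ∀ i j, i < j → j < m → G.Adj (g i) (g j) → i + 1 = j ∨ (i = 0 ∧ j + 1 = m) := by
    intro i j hij hj h
    by_contra hcon
    by_cases hi0 : i = 0
    · have hjm : j + 1 < m := by omega
      rcases hint j (by omega) hjm _ h.symm with h' | h' <;>
        have := hg.inj _ (by omega) _ (by omega) h' <;> omega
    · rcases hint i (by omega) (by omega) _ h with h' | h' <;>
        have := hg.inj _ (by omega) _ (by omega) h' <;> omega
  refine ⟨m, 3 ≤ m ∧ G.Adj (g 0) (g (m - 1)), g, hg.pos, hg.notin, hg.inj, ?_, ?_, fun h => h.1⟩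
  · intro i hi j hj
    unfold Pat
    constructor
    · intro h
      have hne : i ≠ j := by rintro rfl; exact G.irrefl h
      rcases lt_or_gt_of_ne hne with hl | hl
      · rcases hlt i j hl hj h with h' | ⟨rfl, h'⟩
        · exact Or.inl h'
        · by_cases h3 : 3 ≤ m
          · right; right
            refine ⟨⟨h3, ?_⟩, Or.inl ⟨rfl, h'⟩⟩
            rw [show m - 1 = j by omega]; exact h
          · left; omega
      · rcases hlt j i hl hi h.symm with h' | ⟨rfl, h'⟩
        · exact Or.inr (Or.inl h')
        · by_cases h3 : 3 ≤ m
          · right; right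
            refine ⟨⟨h3, ?_⟩, Or.inr ⟨rfl, h'⟩⟩
            rw [show m - 1 = i by omega]; exact h.symm
          · right; left; omega
    · rintro (rfl | rfl | ⟨⟨_, h⟩, ⟨rfl, h'⟩ | ⟨rfl, h'⟩⟩)
      · exact hg.adj i hj
      · exact (hg.adj j hi).symm
      · rw [show j = m - 1 by omega]; exact h
      · rw [show i = m - 1 by omega]; exact h.symm
  · intro i hi w hw
    by_cases h0 : i = 0
    · subst h0; exact ext0 w hw
    · by_cases hl : i + 1 = m
      · rw [show i = m - 1 by omega] at hw; exact extl w hw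
      · rcases hint i (by omega) (by omega) w hw with h | h
        · exact ⟨_, by omega, h⟩
        · exact ⟨_, by omega, h⟩

lemma add_comp {S : Finset V} {f : V → ℕ} (hP : Placed G S f) {m : ℕ} {c : Prop} {g : ℕ → V}
    (hc : Comp G S m c g) (h : ℕ → ℕ)
    (hinj : ∀ i < m, ∀ j < m, h i = h j → i = j)
    (hadj : ∀ i < m, ∀ j < m, (Pat m c i j ↔ R (h i) (h j)))
    (h2 : ∀ i < m, h i ≠ 2)
    (hx : ∀ u ∈ S, ∀ i < m, f u ≠ h i ∧ ¬ R (f u) (h i)) :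
    ∃ T f', S ⊆ T ∧ T.card = S.card + m ∧ Placed G T f' ∧
      (∀ u ∈ T, (u ∈ S ∧ f' u = f u) ∨ ∃ i < m, u = g i ∧ f' u = h i) ∧
      (∀ u ∈ T, u ∈ S ∨ ∃ i < m, u = g i) := by
  classical
  let C := (Finset.range m).image g
  have hC : ∀ u, u ∈ C ↔ ∃ i < m, u = g i := by
    intro u; simp only [C, Finset.mem_image, Finset.mem_range]
    constructor
    · rintro ⟨i, hi, rfl⟩; exact ⟨i, hi, rfl⟩
    · rintro ⟨i, hi, rfl⟩; exact ⟨i, hi, rfl⟩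
  have hcard : C.card = m := by
    rw [Finset.card_image_of_injOn, Finset.card_range]
    intro i hi j hj hij
    exact hc.inj i (by simpa using hi) j (by simpa using hj) hij
  have hdis : Disjoint S C := by
    rw [Finset.disjoint_right]
    intro u hu
    obtain ⟨i, hi, rfl⟩ := (hC u).1 hu
    exact hc.notin i hi
  have hidx : ∃ k : V → ℕ, ∀ i < m, k (g i) = i := by
    refine ⟨fun v => if hv : ∃ i < m, v = g i then hv.choose else 0, ?_⟩
    intro i hi
    have hv : ∃ j < m, g i = g j := ⟨i, hi, rfl⟩
    dsimp only
    rw [dif_pos hv]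
    exact (hc.inj _ hi _ hv.choose_spec.1 hv.choose_spec.2).symm
  obtain ⟨k, hk⟩ := hidx
  let f' : V → ℕ := fun v => if v ∈ S then f v else h (k v)
  have hfS : ∀ u ∈ S, f' u = f u := fun u hu => if_pos hu
  have hfg : ∀ i < m, f' (g i) = h i := by
    intro i hi
    simp only [f']
    rw [if_neg (hc.notin i hi), hk i hi]
  have key : ∀ u ∈ S ∪ C, u ∈ S ∨ ∃ i < m, u = g i := by
    intro u hu
    rcases Finset.mem_union.1 hu with hu | hu
    · exact Or.inl hu
    · exact Or.inr ((hC u).1 hu)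
  have hna : ∀ u ∈ S, ∀ i < m, ¬ G.Adj u (g i) :=
    fun u hu i hi ha => hc.notin i hi (hP.closed u hu _ ha)
  refine ⟨S ∪ C, f', Finset.subset_union_left, ?_, ⟨?_, ?_, ?_, ?_⟩, ?_, key⟩
  · rw [Finset.card_union_of_disjoint hdis, hcard]
  · intro u hu w hw
    rcases key u hu with hu | ⟨i, hi, rfl⟩
    · exact Finset.mem_union_left _ (hP.closed u hu w hw)
    · exact Finset.mem_union_right _ ((hC w).2 (hc.closed i hi w hw))
  · intro u hu v hv huv
    rcases key u hu with hu | ⟨i, hi, rfl⟩ <;> rcases key v hv with hv | ⟨j, hj, rfl⟩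
    · rw [hfS u hu, hfS v hv] at huv; exact hP.inj u hu v hv huv
    · rw [hfS u hu, hfg j hj] at huv; exact absurd huv (hx u hu j hj).1
    · rw [hfS v hv, hfg i hi] at huv; exact absurd huv.symm (hx v hv i hi).1
    · rw [hfg j hj, hfg i hi] at huv; rw [hinj i hi j hj huv]
  · intro u hu v hv
    rcases key u hu with hu | ⟨i, hi, rfl⟩ <;> rcases key v hv with hv | ⟨j, hj, rfl⟩
    · rw [hfS u hu, hfS v hv]; exact hP.adj u hu v hv
    · rw [hfS u hu, hfg j hj]
      exact iff_of_false (hna u hu j hj) (hx u hu j hj).2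
    · rw [hfS v hv, hfg i hi]
      exact iff_of_false (fun ha => hna v hv i hi ha.symm) (fun hr => (hx v hv i hi).2 (R_symm hr))
    · rw [hfg j hj, hfg i hi, hc.adj i hi j hj]; exact hadj i hi j hj
  · intro u hu
    rcases key u hu with hu | ⟨i, hi, rfl⟩
    · rw [hfS u hu]; exact hP.ne2 u hu
    · rw [hfg i hi]; exact h2 i hi
  · intro u hu
    rcases key u hu with hu | ⟨i, hi, rfl⟩
    · exact Or.inl ⟨hu, hfS u hu⟩
    · exact Or.inr ⟨i, hi, rfl, hfg i hi⟩


variable (G) in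
def Strong (S : Finset V) : Prop :=
  S.card ≠ 1 ∧ ∃ f, Placed G S f ∧ ∀ u ∈ S, f u + 2 = 2 * S.card ∨ f u + 5 ≤ 2 * S.card

variable (G) in
def Weak (S : Finset V) : Prop :=
  ∃ f, Placed G S f ∧ ∀ u ∈ S, f u + 2 ≤ 2 * S.card

lemma strong_tri {S : Finset V} (hS : Strong G S) {c : Prop} {g : ℕ → V} (hc1 : c)
    (hc : Comp G S 3 c g) : ∃ T, S.card < T.card ∧ Strong G T := by
  obtain ⟨h1, f, hP, hb⟩ := hS
  obtain ⟨T, f', hsub, hcard, hP', hv, -⟩ := add_comp hP hc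
    (fun i => if i = 0 then 2 * S.card else if i = 1 then 2 * S.card + 1 else 2 * S.card + 4)
    (by intro i hi j hj; split_ifs <;> omega)
    (by intro i hi j hj; simp only [Pat, R, hc1, true_and]; split_ifs <;> omega)
    (by intro i hi; split_ifs <;> omega)
    (by intro u hu i hi; have := hb u hu; simp only [R]; split_ifs <;> omega)
  refine ⟨T, by omega, by omega, f', hP', ?_⟩
  intro u hu
  rcases hv u hu with ⟨hu, h⟩ | ⟨i, hi, -, h⟩
  · have := hb u hu; omega
  · split_ifs at h <;> omega

lemma strong_two {S : Finset V} (hS : Strong G S) {c : Prop} {g : ℕ → V}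
    (hc : Comp G S 2 c g) : ∃ T, S ⊆ T ∧ T.card = S.card + 2 ∧ Weak G T ∧
      ∀ c' g', Comp G T 2 c' g' → ∃ T', S.card < T'.card ∧ Strong G T' := by
  obtain ⟨h1, f, hP, hb⟩ := hS
  have hnc : ¬ c := fun h => by have := hc.three h; omega
  obtain ⟨T, f', hsub, hcard, hP', hv, -⟩ := add_comp hP hc
    (fun i => if i = 0 then 2 * S.card else 2 * S.card + 1)
    (by intro i hi j hj; split_ifs <;> omega)
    (by intro i hi j hj; simp only [Pat, R, hnc, false_and, or_false]; split_ifs <;> omega)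
    (by intro i hi; split_ifs <;> omega)
    (by intro u hu i hi; have := hb u hu; simp only [R]; split_ifs <;> omega)
  have hb' : ∀ u ∈ T, f' u + 2 = 2 * S.card ∨ f' u + 5 ≤ 2 * S.card ∨ f' u = 2 * S.card ∨
      f' u = 2 * S.card + 1 := by
    intro u hu
    rcases hv u hu with ⟨hu, h⟩ | ⟨i, hi, -, h⟩
    · have := hb u hu; omega
    · split_ifs at h <;> omega
  refine ⟨T, hsub, hcard, ⟨f', hP', ?_⟩, ?_⟩
  · intro u hu
    have := hb' u hu; omega
  · intro c' g' hc'
    have hnc' : ¬ c' := fun h => by have := hc'.three h; omega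
    obtain ⟨T', f'', hsub', hcard', hP'', hv', -⟩ := add_comp hP' hc'
      (fun i => if i = 0 then 2 * S.card + 3 else 2 * S.card + 6)
      (by intro i hi j hj; split_ifs <;> omega)
      (by intro i hi j hj; simp only [Pat, R, hnc', false_and, or_false]; split_ifs <;> omega)
      (by intro i hi; split_ifs <;> omega)
      (by intro u hu i hi; have := hb' u hu; simp only [R]; split_ifs <;> omega)
    refine ⟨T', by omega, by omega, f'', hP'', ?_⟩
    intro u hu
    rcases hv' u hu with ⟨hu, h⟩ | ⟨i, hi, -, h⟩
    · have := hb' u hu; omega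
    · split_ifs at h <;> omega

/-- positions for long paths and cycles -/
def pos (k m z i : ℕ) : ℕ :=
  if i = 0 then z else if i ≤ (m - 1) / 2 then 2 * (k + 2 * i)
  else if i = (m - 1) / 2 + 1 then 2 * (k + m - 2) + 1
  else 2 * (k + 3 + 2 * (m - 1 - i))

set_option maxHeartbeats 2000000 in
lemma weak_cycle {S : Finset V} (hS : Weak G S) {m : ℕ} {c : Prop} {g : ℕ → V} (hc1 : c)
    (hm : 4 ≤ m) (hc : Comp G S m c g) : ∃ T, S ⊆ T ∧ S.card < T.card ∧ Weak G T := by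
  obtain ⟨f, hP, hb⟩ := hS
  obtain ⟨T, f', hsub, hcard, hP', hv, -⟩ := add_comp hP hc
    (pos S.card m (2 * S.card + 3))
    (by intro i hi j hj; unfold pos; split_ifs <;> omega)
    (by intro i hi j hj; simp only [Pat, R, hc1, true_and, pos]; split_ifs <;> omega)
    (by intro i hi; unfold pos; split_ifs <;> omega)
    (by intro u hu i hi; have := hb u hu; simp only [R, pos]; split_ifs <;> omega)
  refine ⟨T, hsub, by omega, f', hP', ?_⟩
  intro u hu
  rcases hv u hu with ⟨hu, h⟩ | ⟨i, hi, -, h⟩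
  · have := hb u hu; omega
  · unfold pos at h; split_ifs at h <;> omega

set_option maxHeartbeats 2000000 in
lemma weak_path {S : Finset V} (hS : Weak G S) {m : ℕ} {c : Prop} {g : ℕ → V} (hc1 : ¬ c)
    (hm : 3 ≤ m) (hc : Comp G S m c g) : ∃ T, S ⊆ T ∧ S.card < T.card ∧ Weak G T := by
  obtain ⟨f, hP, hb⟩ := hS
  obtain ⟨T, f', hsub, hcard, hP', hv, -⟩ := add_comp hP hc
    (pos S.card m (2 * S.card + 1))
    (by intro i hi j hj; unfold pos; split_ifs <;> omega)
    (by intro i hi j hj; simp only [Pat, R, hc1, false_and, or_false, pos]; split_ifs <;> omega)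
    (by intro i hi; unfold pos; split_ifs <;> omega)
    (by intro u hu i hi; have := hb u hu; simp only [R, pos]; split_ifs <;> omega)
  refine ⟨T, hsub, by omega, f', hP', ?_⟩
  intro u hu
  rcases hv u hu with ⟨hu, h⟩ | ⟨i, hi, -, h⟩
  · have := hb u hu; omega
  · unfold pos at h; split_ifs at h <;> omega

lemma exists_max (P : Finset V → Prop) (S0 : Finset V) (h0 : P S0) :
    ∃ S, P S ∧ ∀ T, P T → T.card ≤ S.card := by
  classical
  obtain ⟨S, hS, hmax⟩ := Finset.exists_max_image (Finset.univ.filter P) Finset.card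
    ⟨S0, by simpa using h0⟩
  exact ⟨S, by simpa using hS, fun T hT => hmax T (by simpa using hT)⟩

lemma Comp.mono {S T : Finset V} (h : S ⊆ T) {m : ℕ} {c : Prop} {g : ℕ → V}
    (hc : Comp G T m c g) : Comp G S m c g :=
  ⟨hc.pos, fun i hi hS => hc.notin i hi (h hS), hc.inj, hc.adj, hc.closed, hc.three⟩

lemma main_weak : ∃ S, Weak G S ∧ ∀ m c g, Comp G S m c g → m = 1 := by
  obtain ⟨S, hS, hmax⟩ := exists_max (Strong G) ∅
    ⟨by simp, fun _ => 0, ⟨by simp, by simp, by simp, by simp⟩, by simp⟩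
  have hT : ∀ c g, c → ¬ Comp G S 3 c g := by
    intro c g h hc
    obtain ⟨T, h1, h2⟩ := strong_tri hS h hc
    have := hmax T h2; omega
  obtain ⟨S1, hSS, hS1, hno2⟩ : ∃ S1, S ⊆ S1 ∧ Weak G S1 ∧ ∀ c g, ¬ Comp G S1 2 c g := by
    by_cases h : ∃ c g, Comp G S 2 c g
    · obtain ⟨c, g, hc⟩ := h
      obtain ⟨T, h1, -, h2, h3⟩ := strong_two hS hc
      refine ⟨T, h1, h2, fun c' g' hc' => ?_⟩
      obtain ⟨T', h4, h5⟩ := h3 c' g' hc'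
      have := hmax T' h5; omega
    · push Not at h
      obtain ⟨-, f, hP, hb⟩ := hS
      exact ⟨S, subset_rfl, ⟨f, hP, fun u hu => by have := hb u hu; omega⟩, h⟩
  obtain ⟨S2, ⟨hS12, hS2⟩, hmax2⟩ := exists_max (fun T => S1 ⊆ T ∧ Weak G T) S1
    ⟨subset_rfl, hS1⟩
  refine ⟨S2, hS2, fun m c g hc => ?_⟩
  by_contra hm1
  have hm0 := hc.pos
  by_cases hm2 : m = 2
  · subst hm2; exact hno2 c g (hc.mono hS12)
  by_cases hcc : c
  · by_cases hm3 : m = 3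
    · subst hm3; exact hT c g hcc (hc.mono (hSS.trans hS12))
    · obtain ⟨T, h1, h2, h3⟩ := weak_cycle hS2 hcc (by omega) hc
      have := hmax2 T ⟨hS12.trans h1, h3⟩; omega
  · obtain ⟨T, h1, h2, h3⟩ := weak_path hS2 hcc (by omega) hc
    have := hmax2 T ⟨hS12.trans h1, h3⟩; omega

lemma main_emb (hd : ∀ v, (G.neighborSet v).ncard ≤ 2) :
    ∃ f : V → ℕ, Function.Injective f ∧ (∀ u, f u < 2 * Fintype.card V - 1) ∧
      ∀ u v, G.Adj u v ↔ (f u ≠ 2 ∧ f v ≠ 2 ∧ R (f u) (f v)) := by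
  by_cases hV : Fintype.card V = 1
  · have hs : ∀ u v : V, u = v := fun u v => Fintype.card_le_one_iff.1 hV.le u v
    refine ⟨fun _ => 0, fun u v _ => hs u v, fun u => by simp [hV], fun u v => ?_⟩
    refine iff_of_false (fun h => h.ne (hs u v)) ?_
    simp [R]
  obtain ⟨S, hS, hone⟩ := main_weak (G := G)
  by_cases hall : ∃ v0, v0 ∉ S
  · obtain ⟨v1, hv1⟩ := hall
    obtain ⟨f, hP, hb⟩ := hS
    obtain ⟨m0, c0, g0, hc0⟩ := exists_comp hd S hP.closed v1 hv1
    obtain rfl : m0 = 1 := hone _ _ _ hc0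
    obtain ⟨v0, hv0e⟩ : ∃ v0, v0 = g0 0 := ⟨_, rfl⟩
    have hv0 : v0 ∉ S := hv0e ▸ hc0.notin 0 (by omega)
    have hiso : ∀ x, ¬ G.Adj v0 x := by
      intro x hx
      rw [hv0e] at hx
      obtain ⟨j, hj, rfl⟩ := hc0.closed 0 (by omega) x hx
      obtain rfl : j = 0 := by omega
      exact G.irrefl hx
    obtain ⟨T, ⟨hST, hvT, f', hP', hb'⟩, hmax⟩ := exists_max
      (fun T => S ⊆ T ∧ v0 ∉ T ∧ ∃ f, Placed G T f ∧ ∀ u ∈ T, f u + 1 ≤ 2 * T.card) S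
      ⟨subset_rfl, hv0, f, hP, fun u hu => by have := hb u hu; omega⟩
    have hTall : ∀ w, w ≠ v0 → w ∈ T := by
      intro w hw0
      by_contra hw
      obtain ⟨m, c, g, hcI⟩ := exists_comp hd (insert v0 T) (by
        intro u hu x hx
        rcases Finset.mem_insert.1 hu with rfl | hu
        · exact absurd hx (hiso x)
        · exact Finset.mem_insert_of_mem (hP'.closed u hu x hx)) w
        (by simp [hw0, hw])
      have hc : Comp G T m c g := hcI.mono (Finset.subset_insert _ _)
      obtain rfl : m = 1 := hone _ _ _ (hc.mono hST)
      have hnc : ¬ c := fun h => by have := hc.three h; omega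
      obtain ⟨T', f'', hsub', hcard', hP'', hv', hm'⟩ := add_comp hP' hc
        (fun _ => 2 * T.card + 1)
        (by intro i hi j hj; omega)
        (by intro i hi j hj; simp only [Pat, R, hnc, false_and, or_false]; omega)
        (by intro i hi; omega)
        (by intro u hu i hi; have := hb' u hu; simp only [R]; omega)
      have := hmax T' ⟨hST.trans hsub', ?_, f'', hP'', ?_⟩
      · omega
      · intro h
        rcases hm' v0 h with h | ⟨i, hi, h⟩
        · exact hvT h
        · exact hcI.notin i hi (h ▸ Finset.mem_insert_self _ _)
      · intro u hu
        rcases hv' u hu with ⟨hu, h⟩ | ⟨i, hi, -, h⟩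
        · have := hb' u hu; omega
        · omega
    have hTc : T.card + 1 = Fintype.card V := by
      rw [← Finset.card_insert_of_notMem hvT, ← Finset.card_univ]
      congr 1
      ext x
      by_cases hx : x = v0
      · simp [hx]
      · simp [hTall x hx]
    refine ⟨fun v => if v = v0 then 2 else f' v, ?_, ?_, ?_⟩
    · intro u v h
      simp only at h
      split_ifs at h with h1 h2 h2
      · rw [h1, h2]
      · exact absurd h.symm (hP'.ne2 v (hTall v h2))
      · exact absurd h (hP'.ne2 u (hTall u h1))
      · exact hP'.inj u (hTall u h1) v (hTall v h2) h
    · intro u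
      simp only
      split_ifs with h1
      · omega
      · have := hb' u (hTall u h1); omega
    · intro u v
      by_cases h1 : u = v0
      · subst h1
        simp [hiso v]
      · by_cases h2 : v = v0
        · subst h2
          have h3 : ¬ G.Adj u v := fun h => hiso u h.symm
          simp [h3]
        · simp only [h1, h2, if_false]
          rw [hP'.adj u (hTall u h1) v (hTall v h2)]
          exact ⟨fun h => ⟨hP'.ne2 u (hTall u h1), hP'.ne2 v (hTall v h2), h⟩, fun h => h.2.2⟩
  · push Not at hall
    obtain ⟨f, hP, hb⟩ := hS
    refine ⟨f, fun u v h => hP.inj u (hall u) v (hall v) h, fun u => ?_, fun u v => ?_⟩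
    · have := hb u (hall u)
      have h2 : S.card ≤ Fintype.card V := Finset.card_le_univ S
      omega
    · rw [hP.adj u (hall u) v (hall v)]
      exact ⟨fun h => ⟨hP.ne2 u (hall u), hP.ne2 v (hall v), h⟩, fun h => h.2.2⟩

end U2

/-- For every `n`: (a) `U_n` has `max {0, 2n − 1}` vertices and
`max {0, n − 1, 3n − 5, 4n − 9}` edges (maxima over the integers); (b) `U_n` is an induced
subgraph of `U_{n+1}`; (c) every graph on `n` vertices with maximum degree at most `2` is an
induced subgraph of `U_n`. -/
theorem statement12 (n : ℕ) :
    ((Fintype.card (Fin (2 * n - 1)) : ℤ) = max 0 (2 * (n : ℤ) - 1) ∧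
      ((Umax2 n).edgeFinset.card : ℤ) =
        max 0 (max ((n : ℤ) - 1) (max (3 * (n : ℤ) - 5) (4 * (n : ℤ) - 9)))) ∧
    Nonempty (Umax2 n ↪g Umax2 (n + 1)) ∧
    (∀ G : SimpleGraph (Fin n),
      (∀ v : Fin n, (G.neighborSet v).ncard ≤ 2) → Nonempty (G ↪g Umax2 n)) := by
  refine ⟨⟨?_, U2.edges n⟩, ?_, ?_⟩
  · rw [Fintype.card_fin]; omega
  · exact ⟨⟨⟨Fin.castLE (by omega), Fin.castLE_injective _⟩, Iff.rfl⟩⟩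
  · intro G hd
    obtain ⟨f, hinj, hlt, hadj⟩ := U2.main_emb hd
    rw [Fintype.card_fin] at hlt
    refine ⟨⟨⟨fun v => ⟨f v, hlt v⟩, fun u v h => hinj (congrArg Fin.val h)⟩, ?_⟩⟩
    intro u v
    rw [hadj u v, U2.R_iff]
    exact Iff.rfl
end

section
/- There exists a constant C > 0 such that for every n ∈ ℕ there exists a simple graph U with at most 11n/6 + C vertices (as a real number) such that every simple graph on n vertices with maximum degree at most 2 in which every connected component has at most 6 vertices is an induced subgraph of U. -/
namespace IndU

/-- Size of component type `t`: types 0..5 are the paths with 1..6 vertices,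
types 6..9 are the cycles with 3..6 vertices. -/
def sz (t : ℕ) : ℕ := if t < 6 then t + 1 else t - 3

/-- Adjacency in the component of type `t`. -/
def tadj (t i j : ℕ) : Bool :=
  i + 1 == j || j + 1 == i ||
    (Nat.ble 6 t && ((i == 0 && j + 1 == sz t) || (j == 0 && i + 1 == sz t)))

def bigAdj : ℕ := 860041336421090906981239111743235909918986082314441255913490616803115178766755584420369552373403317904045234749301911895547582733645527086142868932302035794419526430349289473087666588199349206296040646120404618671622594710618263666843951270452738495326152192565592318724082336183215080289551387236334299076982123589040205040456913505509656395740850247103759905226691942165411105766562710737740620845086059355588765157483554113278200724311499780195252787030968033733173258643367548760708145731298498743109760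

def bigPos : List ℕ := [
  2195828820509414472347354469148128620016443066566621065083229350101887514413753909497330357409387153936854398469851148323946624,
  2279954628461083739165348319603388084872723480586471647170563736103527108307296992016120592467109517076642415252555947835409280,
  2069891050886762642917821273588238471774543367210568317836921343464215879236797170256956951624276739278088433480795622673023872,
  2280283855314277216047509519480887793420267747873223128983621281528242719728277991990765923921534295298957946811532034822964096,
  2112040026742253812390857463938507357969146336751496721917201435757553578193454271374993469605506967101527166838759073396097920,
  2279958552191005392923341358836137209322563092290215023604042394785623662240806676089062925750902643684171240679408409512002944,
  2323247439581812826708799449122140928153571298319240335022440931209806969626684803856884021677363819905235516379613008807248768,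
  2280449159655976242654668731055359804202345635026179373907251034966532760425943693331304576260678158929937290332192179251905666,
  2323248720233259424979527701517488569601158723257069591070819026984109381786227583230166753489746572986697565046649049181144065,
  2301930977004538577609325320775022319125454475781363396335303682016307893880503912875465173467997581060947554524218367389287425]

def up (u v : ℕ) : Bool :=
  Nat.blt u v && (Nat.blt v (u + 16) && Nat.testBit bigAdj (16 * u + (v - u)))

/-- Adjacency of the 110-vertex gadget. -/
def gadj (u v : ℕ) : Bool := up u v || up v u

/-- Packing of copies of the component of type `t` in the gadget. -/
def pos (t x : ℕ) : ℕ := (bigPos.getD t 0 >>> (7 * x)) % 128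

theorem pos_data : ∀ t : Fin 10, ∀ x y : Fin 60,
    pos t x < 110 ∧ (pos t x = pos t y → x = y) ∧
    gadj (pos t x) (pos t y) =
      (x.1 / sz t == y.1 / sz t && tadj t (x.1 % sz t) (y.1 % sz t)) := by
  decide +kernel

theorem sz_data : ∀ t : Fin 10, 0 < sz t ∧ sz t * (60 / sz t) = 60 := by
  decide

theorem gadj_symm (u v : ℕ) : gadj u v = gadj v u := by
  unfold gadj; exact Bool.or_comm _ _

theorem up_irrefl (u : ℕ) : up u u = false := by
  simp [up, Nat.blt]

theorem gadj_irrefl (u : ℕ) : gadj u u = false := by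
  simp [gadj, up_irrefl]

/-- `M` disjoint copies of the gadget. -/
def bigU (M : ℕ) : SimpleGraph (Fin M × Fin 110) where
  Adj a b := a.1 = b.1 ∧ gadj a.2 b.2 = true
  symm := ⟨fun a b h => ⟨h.1.symm, by rw [gadj_symm]; exact h.2⟩⟩
  loopless := ⟨fun a h => by simp [gadj_irrefl] at h⟩

/-- Structure of a component. -/
theorem comp_struct {V : Type} [Finite V] (G : SimpleGraph V)
    (hdeg : ∀ v, (G.neighborSet v).ncard ≤ 2)
    (hcomp : ∀ v, (G.connectedComponentMk v).supp.ncard ≤ 6)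
    (K : G.ConnectedComponent) :
    ∃ (t : Fin 10) (p : ℕ → V), Set.InjOn p (Set.Iio (sz t)) ∧
      (∀ v, G.connectedComponentMk v = K ↔ ∃ i < sz t, p i = v) ∧
      (∀ i < sz t, ∀ j < sz t, G.Adj (p i) (p j) ↔ tadj t i j = true) := by
  classical
  let P : ℕ → Prop := fun k => 1 ≤ k ∧ ∃ p : ℕ → V, Set.InjOn p (Set.Iio k) ∧
    (∀ i < k, G.connectedComponentMk (p i) = K) ∧ ∀ i, i + 1 < k → G.Adj (p i) (p (i + 1))
  have hP1 : P 1 := by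
    obtain ⟨v, hv⟩ := K.exists_rep
    refine ⟨le_rfl, fun _ => v, ?_, fun i _ => hv, fun i hi => by omega⟩
    intro a ha b hb _
    simp only [Set.mem_Iio] at ha hb
    omega
  have hP6 : ∀ k, P k → k ≤ 6 := by
    rintro k ⟨hk, p, hinj, hK, -⟩
    have h1 : (p '' Set.Iio k) ⊆ (G.connectedComponentMk (p 0)).supp := by
      rintro _ ⟨i, hi, rfl⟩
      rw [SimpleGraph.ConnectedComponent.mem_supp_iff, hK i hi, hK 0 (by omega)]
    have h2 := Set.ncard_le_ncard h1 (Set.toFinite _)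
    rw [hinj.ncard_image] at h2
    have h3 : (Set.Iio k).ncard = k := by
      rw [← Finset.coe_Iio, Set.ncard_coe_finset]; simp
    have := hcomp (p 0)
    omega
  obtain ⟨k, hk, hmax⟩ : ∃ k, P k ∧ ∀ l, P l → l ≤ k := by
    refine ⟨Nat.findGreatest P 6, Nat.findGreatest_spec (by norm_num : 1 ≤ 6) hP1, ?_⟩
    intro l hl
    exact Nat.le_findGreatest (hP6 l hl) hl
  have hk6 := hP6 k hk
  have hnot : ¬ P (k + 1) := fun h => by have := hmax _ h; omega
  obtain ⟨hk1, p, hinj, hK, hadj⟩ := hk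
  have hne : ∀ i < k, ∀ j < k, p i = p j → i = j := fun i hi j hj h => hinj hi hj h
  have hmemK : ∀ i < k, ∀ w, G.Adj (p i) w → G.connectedComponentMk w = K := by
    intro i hi w hw
    rw [← hK i hi]
    exact (SimpleGraph.ConnectedComponent.connectedComponentMk_eq_of_adj hw).symm
  -- interior vertices
  have hint : ∀ i, 0 < i → i + 1 < k → ∀ w, G.Adj (p i) w → w = p (i - 1) ∨ w = p (i + 1) := by
    intro i hi hik w hw
    by_contra! hcon
    have hsub : (({p (i - 1), p (i + 1), w} : Finset V) : Set V) ⊆ G.neighborSet (p i) := by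
      intro x hx
      simp only [Finset.coe_insert, Finset.coe_singleton, Set.mem_insert_iff,
        Set.mem_singleton_iff] at hx
      rw [SimpleGraph.mem_neighborSet]
      rcases hx with rfl | rfl | rfl
      · have := hadj (i - 1) (by omega)
        rw [Nat.sub_add_cancel hi] at this
        exact this.symm
      · exact hadj i hik
      · exact hw
    have h2 := Set.ncard_le_ncard hsub (Set.toFinite _)
    rw [Set.ncard_coe_finset, Finset.card_eq_three.2 ⟨p (i - 1), p (i + 1), w, ?_, hcon.1.symm,
      hcon.2.symm, rfl⟩] at h2
    · have := hdeg (p i); omega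
    · intro h
      have := hne _ (by omega) _ (by omega) h
      omega
  have hlast : ∀ w, G.Adj (p (k - 1)) w → ∃ i < k, p i = w := by
    intro w hw
    by_contra! hcon
    apply hnot
    refine ⟨by omega, fun i => if i < k then p i else w, ?_, ?_, ?_⟩
    · intro a ha b hb hab
      simp only [Set.mem_Iio] at ha hb
      by_cases h1 : a < k <;> by_cases h2 : b < k <;> simp only [h1, h2, if_true, if_false] at hab
      · exact hne _ h1 _ h2 hab
      · exact absurd hab (hcon a h1)
      · exact absurd hab.symm (hcon b h2)
      · omega
    · intro i hi
      by_cases h1 : i < k <;> simp only [h1, if_true, if_false]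
      · exact hK i h1
      · exact hmemK _ (by omega) w hw
    · intro i hi
      have h1 : i < k := by omega
      by_cases h2 : i + 1 < k <;> simp only [h1, h2, if_true, if_false]
      · exact hadj i h2
      · have : i = k - 1 := by omega
        rw [this]; exact hw
  have hfirst : ∀ w, G.Adj (p 0) w → ∃ i < k, p i = w := by
    intro w hw
    by_contra! hcon
    apply hnot
    refine ⟨by omega, fun i => if i = 0 then w else p (i - 1), ?_, ?_, ?_⟩
    · intro a ha b hb hab
      simp only [Set.mem_Iio] at ha hb
      by_cases h1 : a = 0 <;> by_cases h2 : b = 0 <;> simp only [h1, h2, if_true, if_false] at hab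
      · omega
      · exact absurd hab.symm (hcon _ (by omega))
      · exact absurd hab (hcon _ (by omega))
      · have := hne _ (by omega) _ (by omega) hab
        omega
    · intro i hi
      by_cases h1 : i = 0 <;> simp only [h1, if_true, if_false]
      · exact hmemK _ (by omega) w hw
      · exact hK _ (by omega)
    · intro i hi
      by_cases h1 : i = 0
      · subst h1; simpa using hw.symm
      · simp only [h1, if_false, Nat.add_eq_zero_iff, one_ne_zero, and_false, Nat.add_sub_cancel]
        have := hadj (i - 1) (by omega)
        rwa [Nat.sub_add_cancel (by omega)] at this
  have hclosed : ∀ i < k, ∀ w, G.Adj (p i) w → ∃ j < k, p j = w := by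
    intro i hi w hw
    by_cases h0 : i = 0
    · subst h0; exact hfirst w hw
    by_cases h1 : i + 1 < k
    · rcases hint i (by omega) h1 w hw with h | h
      · exact ⟨i - 1, by omega, h.symm⟩
      · exact ⟨i + 1, by omega, h.symm⟩
    · have : i = k - 1 := by omega
      subst this; exact hlast w hw
  have hall : ∀ v, G.connectedComponentMk v = K ↔ ∃ i < k, p i = v := by
    intro v
    constructor
    · intro hv
      rw [← hK 0 (by omega), SimpleGraph.ConnectedComponent.eq] at hv
      obtain ⟨W⟩ := hv.symm
      have key : ∀ (a b : V), G.Walk a b → (∃ i < k, p i = a) → ∃ i < k, p i = b := by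
        intro a b W
        induction W with
        | nil => exact id
        | cons h _ ih =>
          rintro ⟨i, hi, rfl⟩
          exact ih (hclosed i hi _ h)
      exact key _ _ W ⟨0, by omega, rfl⟩
    · rintro ⟨i, hi, rfl⟩
      exact hK i hi
  have hlt : ∀ i < k, ∀ j < k, i < j → G.Adj (p i) (p j) →
      j = i + 1 ∨ (i = 0 ∧ j + 1 = k ∧ 3 ≤ k) := by
    intro i hi j hj hij hA
    by_contra! hcon
    obtain ⟨hc1, hc2⟩ := hcon
    by_cases h0 : i = 0
    · have hjk : j + 1 < k := by
        by_contra hh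
        have := hc2 h0 (by omega)
        omega
      rcases hint j (by omega) hjk _ hA.symm with h | h
      · have := hne _ hi _ (by omega) h; omega
      · have := hne _ hi _ (by omega) h; omega
    · rcases hint i (by omega) (by omega) _ hA with h | h
      · have := hne _ hj _ (by omega) h; omega
      · have := hne _ hj _ (by omega) h; omega
  by_cases hcyc : 3 ≤ k ∧ G.Adj (p 0) (p (k - 1))
  · obtain ⟨h3, hc⟩ := hcyc
    have hs : sz (k + 3) = k := by unfold sz; split <;> omega
    refine ⟨⟨k + 3, by omega⟩, p, ?_, ?_, ?_⟩
    · simpa only [hs] using hinj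
    · simpa only [hs] using hall
    · simp only [hs]
      intro i hi j hj
      simp only [tadj, hs, Bool.or_eq_true, Bool.and_eq_true, beq_iff_eq, Nat.ble_eq]
      constructor
      · intro hA
        rcases lt_trichotomy i j with h | h | h
        · have := hlt i hi j hj h hA; omega
        · subst h; exact absurd hA (G.loopless.irrefl _)
        · have := hlt j hj i hi h hA.symm; omega
      · rintro ((h | h) | ⟨-, ⟨h, h'⟩ | ⟨h, h'⟩⟩)
        · subst h; exact hadj i hj
        · subst h; exact (hadj j hi).symm
        · subst h; have : j = k - 1 := by omega
          rw [this]; exact hc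
        · subst h; have : i = k - 1 := by omega
          rw [this]; exact hc.symm
  · have hs : sz (k - 1) = k := by unfold sz; split <;> omega
    refine ⟨⟨k - 1, by omega⟩, p, ?_, ?_, ?_⟩
    · simpa only [hs] using hinj
    · simpa only [hs] using hall
    · simp only [hs]
      intro i hi j hj
      simp only [tadj, hs, Bool.or_eq_true, Bool.and_eq_true, beq_iff_eq, Nat.ble_eq]
      have aux : ∀ i < k, ∀ j < k, i < j → G.Adj (p i) (p j) → j = i + 1 := by
        intro i hi j hj h hA
        rcases hlt i hi j hj h hA with h' | ⟨h1, h2, h3⟩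
        · exact h'
        · exfalso; apply hcyc; refine ⟨h3, ?_⟩
          have : j = k - 1 := by omega
          rw [← this, ← h1]; exact hA
      constructor
      · intro hA
        rcases lt_trichotomy i j with h | h | h
        · have := aux i hi j hj h hA; omega
        · subst h; exact absurd hA (G.loopless.irrefl _)
        · have := aux j hj i hi h hA.symm; omega
      · rintro ((h | h) | ⟨h, -⟩)
        · subst h; exact hadj i hj
        · subst h; exact (hadj j hi).symm
        · omega

theorem embed (n : ℕ) (G : SimpleGraph (Fin n))
    (hdeg : ∀ v, (G.neighborSet v).ncard ≤ 2)
    (hcomp : ∀ v, (G.connectedComponentMk v).supp.ncard ≤ 6) :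
    Nonempty (G ↪g bigU (n / 60 + 10)) := by
  classical
  choose t p hinj hall hadj using comp_struct G hdeg hcomp
  let x : Fin 10 → ℕ := fun s => Fintype.card {K : G.ConnectedComponent // t K = s}
  let e : ∀ s, {K : G.ConnectedComponent // t K = s} ≃ Fin (x s) := fun s => Fintype.equivFin _
  let q : Fin 10 → ℕ := fun s => 60 / sz s
  have hsz0 : ∀ s : Fin 10, 0 < sz s := fun s => (sz_data s).1
  have hq : ∀ s : Fin 10, sz s * q s = 60 := fun s => (sz_data s).2
  have hq0 : ∀ s, 0 < q s := fun s => Nat.pos_of_ne_zero fun h => by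
    have := hq s; rw [h] at this; omega
  -- counting
  have hcount : ∑ s, x s * sz s ≤ n := by
    have h1 : ∑ s, x s * sz s = ∑ K : G.ConnectedComponent, sz (t K) := by
      rw [← Finset.sum_fiberwise (s := Finset.univ) (g := t)]
      refine Finset.sum_congr rfl fun s _ => ?_
      rw [Finset.sum_congr rfl (g := fun _ => sz s)]
      · simp [x, Fintype.card_subtype]
      · intro K hK
        simp only [Finset.mem_filter] at hK
        rw [hK.2]
    have h2 : Fintype.card (Σ K : G.ConnectedComponent, Fin (sz (t K))) ≤
        Fintype.card (Fin n) := by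
      refine Fintype.card_le_of_injective (fun a => p a.1 a.2) ?_
      rintro ⟨K, i⟩ ⟨K', i'⟩ h
      simp only at h
      have hK := (hall K (p K i)).2 ⟨i, i.2, rfl⟩
      have hK' := (hall K' (p K' i')).2 ⟨i', i'.2, rfl⟩
      rw [h, hK'] at hK
      subst hK
      have := hinj K' i.2 i'.2 h
      rw [Fin.ext this]
    rw [h1]
    simpa using h2
  have hcard : Fintype.card (Σ s : Fin 10, Fin (x s / q s + 1)) ≤
      Fintype.card (Fin (n / 60 + 10)) := by
    simp only [Fintype.card_sigma, Fintype.card_fin]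
    have h1 : 60 * ∑ s, (x s / q s + 1) ≤ ∑ s, (x s * sz s + 60) := by
      rw [Finset.mul_sum]
      refine Finset.sum_le_sum fun s _ => ?_
      have h2 : x s / q s * q s ≤ x s := Nat.div_mul_le_self _ _
      calc 60 * (x s / q s + 1) = (x s / q s * q s) * sz s + 60 := by
            rw [← hq s]; ring
        _ ≤ _ := by gcongr
    have h3 : ∑ s : Fin 10, (x s * sz s + 60) = ∑ s, x s * sz s + 600 := by
      rw [Finset.sum_add_distrib]; simp
    omega
  obtain ⟨ι⟩ := Function.Embedding.nonempty_of_card_le hcard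
  let r : G.ConnectedComponent → ℕ := fun K => (e (t K) ⟨K, rfl⟩ : ℕ)
  have hr : ∀ K, r K < x (t K) := fun K => (e (t K) ⟨K, rfl⟩).2
  have hrinj : ∀ K K', t K = t K' → r K = r K' → K = K' := by
    intro K K' h h'
    have aux : ∀ s (h1 : t K = s) (h2 : t K' = s), (e (t K) ⟨K, rfl⟩ : ℕ) = e s ⟨K, h1⟩ ∧
        (e (t K') ⟨K', rfl⟩ : ℕ) = e s ⟨K', h2⟩ := by
      intro s h1 h2
      constructor
      · subst h1; rfl
      · subst h2; rfl
    obtain ⟨a1, a2⟩ := aux (t K') h rfl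
    have : e (t K') ⟨K, h⟩ = e (t K') ⟨K', rfl⟩ := by
      apply Fin.ext; rw [← a1, ← a2]; exact h'
    have := (e (t K')).injective this
    exact congrArg Subtype.val this
  have hidx : ∀ v, ∃ i < sz (t (G.connectedComponentMk v)), p (G.connectedComponentMk v) i = v :=
    fun v => (hall _ v).1 rfl
  choose idx hidx1 hidx2 using hidx
  let c : Fin n → G.ConnectedComponent := fun v => G.connectedComponentMk v
  let keyK : G.ConnectedComponent → Σ s : Fin 10, Fin (x s / q s + 1) := fun K =>
    ⟨t K, ⟨r K / q (t K), Nat.lt_succ_of_le (Nat.div_le_div_right (hr _).le)⟩⟩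
  let key : Fin n → Σ s : Fin 10, Fin (x s / q s + 1) := fun v => keyK (c v)
  let loc : Fin n → ℕ := fun v => (r (c v) % q (t (c v))) * sz (t (c v)) + idx v
  have hloc : ∀ v, loc v < 60 := by
    intro v
    have h1 := Nat.mod_lt (r (c v)) (hq0 (t (c v)))
    have h2 := hidx1 v
    calc loc v < (r (c v) % q (t (c v))) * sz (t (c v)) + sz (t (c v)) := by
          simp only [loc]; exact Nat.add_lt_add_left h2 _
      _ = (r (c v) % q (t (c v)) + 1) * sz (t (c v)) := by ring
      _ ≤ q (t (c v)) * sz (t (c v)) := Nat.mul_le_mul_right _ h1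
      _ = 60 := by rw [mul_comm]; exact hq _
  have hdiv : ∀ v, loc v / sz (t (c v)) = r (c v) % q (t (c v)) := by
    intro v
    simp only [loc]
    rw [mul_comm, Nat.mul_add_div (hsz0 _), Nat.div_eq_of_lt (hidx1 v), add_zero]
  have hmod : ∀ v, loc v % sz (t (c v)) = idx v := by
    intro v
    simp only [loc]
    rw [mul_comm, Nat.mul_add_mod, Nat.mod_eq_of_lt (hidx1 v)]
  have hkey : ∀ v w, key v = key w → t (c v) = t (c w) ∧
      r (c v) / q (t (c v)) = r (c w) / q (t (c w)) := by
    intro v w h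
    refine ⟨congrArg Sigma.fst h, ?_⟩
    exact congrArg (fun a : (Σ s : Fin 10, Fin (x s / q s + 1)) => (a.2 : ℕ)) h
  have hcc : ∀ v w, key v = key w → loc v / sz (t (c v)) = loc w / sz (t (c w)) → c v = c w := by
    intro v w h h'
    obtain ⟨h1, h2⟩ := hkey v w h
    refine hrinj _ _ h1 ?_
    rw [hdiv, hdiv] at h'
    rw [← Nat.div_add_mod (r (c v)) (q (t (c v))), h2, h', h1,
      Nat.div_add_mod (r (c w)) (q (t (c w)))]
  let f : Fin n → Fin (n / 60 + 10) × Fin 110 := fun v =>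
    (ι (key v), ⟨pos (t (c v)) (loc v), (pos_data (t (c v)) ⟨loc v, hloc v⟩ ⟨0, by norm_num⟩).1⟩)
  have hkeyc : ∀ v w, c v = c w → key v = key w := by
    intro v w h
    exact congrArg keyK h
  have hidxeq : ∀ v w, c v = c w → idx v = idx w → v = w := by
    intro v w h h'
    have h1 := hidx2 v
    have h2 := hidx2 w
    change p (c v) (idx v) = v at h1
    change p (c w) (idx w) = w at h2
    rw [← h1, ← h2, h, h']
  refine ⟨⟨⟨f, ?_⟩, ?_⟩⟩
  · intro v w h
    simp only [f, Prod.mk.injEq, Fin.mk.injEq] at h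
    obtain ⟨h1, h2⟩ := h
    have hk := ι.injective h1
    have ht := (hkey v w hk).1
    rw [← ht] at h2
    have h3 := (pos_data (t (c v)) ⟨loc v, hloc v⟩ ⟨loc w, hloc w⟩).2.1 h2
    have h4 : loc v = loc w := congrArg Fin.val h3
    have h5 := hcc v w hk (by rw [h4, ht])
    refine hidxeq v w h5 ?_
    rw [← hmod v, ← hmod w, h4, ht]
  · intro v w
    change (ι (key v) = ι (key w) ∧
      gadj (pos (t (c v)) (loc v)) (pos (t (c w)) (loc w)) = true) ↔ G.Adj v w
    have hA : c v = c w → (G.Adj v w ↔ tadj (t (c v)) (idx v) (idx w) = true) := by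
      intro h
      have h1 := hidx2 v
      have h2 := hidx2 w
      have h3 := hidx1 w
      change p (c v) (idx v) = v at h1
      change p (c w) (idx w) = w at h2
      change idx w < sz (t (c w)) at h3
      rw [← h] at h2 h3
      have := hadj (c v) (idx v) (hidx1 v) (idx w) h3
      rwa [h1, h2] at this
    constructor
    · rintro ⟨h1, h2⟩
      have hk := ι.injective h1
      have ht := (hkey v w hk).1
      rw [← ht] at h2
      have h3 := (pos_data (t (c v)) ⟨loc v, hloc v⟩ ⟨loc w, hloc w⟩).2.2
      simp only at h3
      rw [h2] at h3
      have h4 := h3.symm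
      rw [Bool.and_eq_true, beq_iff_eq] at h4
      have h5 := hcc v w hk (by rw [h4.1, ht])
      rw [hA h5]
      have h6 := h4.2
      rw [hmod v, ht, hmod w] at h6
      rw [ht]; exact h6
    · intro h
      have hc : c v = c w := SimpleGraph.ConnectedComponent.connectedComponentMk_eq_of_adj h
      have hk := hkeyc v w hc
      have ht := (hkey v w hk).1
      refine ⟨by rw [hk], ?_⟩
      rw [← ht]
      have h3 := (pos_data (t (c v)) ⟨loc v, hloc v⟩ ⟨loc w, hloc w⟩).2.2
      simp only at h3
      rw [h3, Bool.and_eq_true, beq_iff_eq]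
      have e1 : loc w / sz (t (c v)) = r (c w) % q (t (c w)) := by rw [ht]; exact hdiv w
      have e2 : loc w % sz (t (c v)) = idx w := by rw [ht]; exact hmod w
      rw [e1, e2, hmod v, hdiv v, ← hc]
      exact ⟨rfl, (hA hc).1 h⟩

end IndU

/-- There is a constant `C > 0` such that for every `n` there is a graph with
at most `11n/6 + C` vertices embedding, as induced subgraphs, all graphs on `n` vertices with
maximum degree at most `2` whose connected components all have at most `6` vertices. -/
theorem statement13 :
    ∃ C : ℝ, 0 < C ∧ ∀ n : ℕ,
      ∃ (V : Type) (_ : Fintype V) (U : SimpleGraph V),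
        (Fintype.card V : ℝ) ≤ 11 * n / 6 + C ∧
        ∀ G : SimpleGraph (Fin n),
          (∀ v : Fin n, (G.neighborSet v).ncard ≤ 2) →
          (∀ v : Fin n, (G.connectedComponentMk v).supp.ncard ≤ 6) →
          Nonempty (G ↪g U) := by
  refine ⟨1100, by norm_num, fun n => ⟨Fin (n / 60 + 10) × Fin 110, inferInstance,
    IndU.bigU (n / 60 + 10), ?_, fun G h1 h2 => IndU.embed n G h1 h2⟩⟩
  simp only [Fintype.card_prod, Fintype.card_fin]
  have h : (((n / 60 : ℕ)) : ℝ) ≤ (n : ℝ) / 60 := Nat.cast_div_le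
  push_cast
  linarith
end

section
/- There exists a constant C > 0 such that for every n ∈ ℕ there exists a simple graph U with at most 11n/6 + C vertices (as a real number) such that every simple graph on n vertices with maximum degree at most 2 in which every connected component has at least 10 vertices is an induced subgraph of U. -/
/-- The infinite strip graph. -/
def stripAdj : ℕ ⊕ ℕ → ℕ ⊕ ℕ → Prop
  | Sum.inl i, Sum.inl j => i + 2 = j ∨ j + 2 = i
  | Sum.inl j, Sum.inr s => j = s ∨ j + 1 = s
  | Sum.inr s, Sum.inl j => j = s ∨ j + 1 = s
  | Sum.inr _, Sum.inr _ => False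

def strip : SimpleGraph (ℕ ⊕ ℕ) where
  Adj := stripAdj
  symm := ⟨by rintro (a | a) (b | b) h <;> simp only [stripAdj] at * <;> omega⟩
  loopless := ⟨by rintro (a | a) h <;> simp only [stripAdj] at * ; omega⟩

/-- position window condition -/
def inWin (lo hi : ℕ) : ℕ ⊕ ℕ → Prop
  | Sum.inl j => lo ≤ j + 1 ∧ j + 4 ≤ hi
  | Sum.inr s => lo ≤ s ∧ s + 4 ≤ hi ∧ s % 3 ≠ 1

def Emb {V : Type} (G : SimpleGraph V) (S : Set V) (lo hi : ℕ) : Prop :=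
  ∃ f : V → ℕ ⊕ ℕ, Set.InjOn f S ∧
    (∀ u ∈ S, ∀ v ∈ S, G.Adj u v ↔ stripAdj (f u) (f v)) ∧ ∀ v ∈ S, inWin lo hi (f v)

def PathPos {V : Type} (G : SimpleGraph V) (S : Set V) (k : ℕ) : Prop :=
  ∃ p : V → ℕ, Set.InjOn p S ∧
    (∀ u ∈ S, ∀ v ∈ S, G.Adj u v ↔ (p u + 1 = p v ∨ p v + 1 = p u)) ∧ ∀ v ∈ S, p v < k

def CycPos {V : Type} (G : SimpleGraph V) (S : Set V) (k : ℕ) : Prop :=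
  ∃ p : V → ℕ, Set.InjOn p S ∧
    (∀ u ∈ S, ∀ v ∈ S, G.Adj u v ↔ (p u + 1 = p v ∨ p v + 1 = p u ∨
      (p u = 0 ∧ p v + 1 = k) ∨ (p v = 0 ∧ p u + 1 = k))) ∧ ∀ v ∈ S, p v < k

theorem inWin_mono {lo hi lo' hi' : ℕ} (h1 : lo' ≤ lo) (h2 : hi ≤ hi') (w : ℕ ⊕ ℕ)
    (h : inWin lo hi w) : inWin lo' hi' w := by
  rcases w with j | s <;> simp only [inWin] at * <;> omega

theorem Emb.mono {V : Type} {G : SimpleGraph V} {S : Set V} {lo hi lo' hi' : ℕ}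
    (h : Emb G S lo hi) (h1 : lo' ≤ lo) (h2 : hi ≤ hi') : Emb G S lo' hi' := by
  obtain ⟨f, a, b, c⟩ := h
  exact ⟨f, a, b, fun v hv => inWin_mono h1 h2 _ (c v hv)⟩

theorem win_sep {lo mid hi : ℕ} (w w' : ℕ ⊕ ℕ) (h : inWin lo mid w) (h' : inWin mid hi w') :
    w ≠ w' ∧ ¬ stripAdj w w' ∧ ¬ stripAdj w' w := by
  rcases w with j | s <;> rcases w' with j' | s' <;>
    simp only [inWin, stripAdj, ne_eq, Sum.inl.injEq, Sum.inr.injEq, reduceCtorEq,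
      not_false_eq_true, true_and, and_true, and_self] at * <;> omega

theorem Emb.union {V : Type} {G : SimpleGraph V} {S K : Set V} {lo mid hi : ℕ}
    (h : Emb G S lo mid) (h' : Emb G K mid hi) (hlm : lo ≤ mid) (hmh : mid ≤ hi)
    (hd : ∀ u ∈ S, u ∉ K)
    (hn : ∀ u ∈ S, ∀ v ∈ K, ¬ G.Adj u v) : Emb G (S ∪ K) lo hi := by
  classical
  obtain ⟨f, a, b, c⟩ := h
  obtain ⟨f', a', b', c'⟩ := h'
  have e1 : ∀ v ∈ S, (if v ∈ K then f' v else f v) = f v := fun v hv => if_neg (hd v hv)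
  have e2 : ∀ v ∈ K, (if v ∈ K then f' v else f v) = f' v := fun v hv => if_pos hv
  refine ⟨fun v => if v ∈ K then f' v else f v, ?_, ?_, ?_⟩
  · rintro u (hu | hu) v (hv | hv) huv <;> dsimp only at huv
    · rw [e1 u hu, e1 v hv] at huv; exact a hu hv huv
    · rw [e1 u hu, e2 v hv] at huv
      exact absurd huv (win_sep _ _ (c u hu) (c' v hv)).1
    · rw [e2 u hu, e1 v hv] at huv
      exact absurd huv.symm (win_sep _ _ (c v hv) (c' u hu)).1
    · rw [e2 u hu, e2 v hv] at huv; exact a' hu hv huv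
  · rintro u (hu | hu) v (hv | hv) <;> dsimp only
    · rw [e1 u hu, e1 v hv]; exact b u hu v hv
    · rw [e1 u hu, e2 v hv]
      exact iff_of_false (hn u hu v hv) (win_sep _ _ (c u hu) (c' v hv)).2.1
    · rw [e2 u hu, e1 v hv]
      exact iff_of_false (fun h => hn v hv u hu h.symm) (win_sep _ _ (c v hv) (c' u hu)).2.2
    · rw [e2 u hu, e2 v hv]; exact b' u hu v hv
  · rintro v (hv | hv) <;> dsimp only
    · rw [e1 v hv]; exact inWin_mono le_rfl hmh _ (c v hv)
    · rw [e2 v hv]; exact inWin_mono hlm le_rfl _ (c' v hv)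

def cycMap (k s t : ℕ) : ℕ ⊕ ℕ :=
  if t = 0 then Sum.inr s
  else if t < k / 2 then Sum.inl (s + 2 * (t - 1))
  else if t = k / 2 then Sum.inr (s + k - 4)
  else Sum.inl (s + 2 * (k - 1 - t) - 1)

theorem cycMap_inj (k s t t' : ℕ) (hk : 10 ≤ k) (hs : 1 ≤ s) (ht : t < k) (ht' : t' < k)
    (h : cycMap k s t = cycMap k s t') : t = t' := by
  unfold cycMap at h
  split_ifs at h <;> simp only [Sum.inl.injEq, Sum.inr.injEq, reduceCtorEq] at h <;> omega

theorem cycMap_adj (k s t t' : ℕ) (hk : 10 ≤ k) (hs : 1 ≤ s) (ht : t < k) (ht' : t' < k) :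
    (t + 1 = t' ∨ t' + 1 = t ∨ (t = 0 ∧ t' + 1 = k) ∨ (t' = 0 ∧ t + 1 = k)) ↔
      stripAdj (cycMap k s t) (cycMap k s t') := by
  unfold cycMap
  split_ifs <;> simp only [stripAdj, iff_false] <;> omega

theorem cycMap_win (k s t : ℕ) (hk : 10 ≤ k) (hs : 1 ≤ s) (ht : t < k) (h1 : s % 3 ≠ 1)
    (h2 : (s + k - 4) % 3 ≠ 1) : inWin s (s + k) (cycMap k s t) := by
  unfold cycMap
  split_ifs <;> simp only [inWin] <;> omega

theorem CycPos.emb {V : Type} {G : SimpleGraph V} {S : Set V} {k s : ℕ} (h : CycPos G S k)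
    (hk : 10 ≤ k) (hs : 1 ≤ s) (h1 : s % 3 ≠ 1) (h2 : (s + k - 4) % 3 ≠ 1) :
    Emb G S s (s + k) := by
  obtain ⟨p, a, b, c⟩ := h
  refine ⟨fun v => cycMap k s (p v), ?_, ?_, ?_⟩
  · intro u hu v hv huv
    exact a hu hv (cycMap_inj k s _ _ hk hs (c u hu) (c v hv) huv)
  · intro u hu v hv
    rw [b u hu v hv]
    exact cycMap_adj k s _ _ hk hs (c u hu) (c v hv)
  · intro v hv
    exact cycMap_win k s _ hk hs (c v hv) h1 h2

def pathMap (m t : ℕ) : ℕ ⊕ ℕ :=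
  if t < m / 2 then Sum.inl (2 * (m / 2 - t) - 1)
  else if t = m / 2 then Sum.inr 2
  else Sum.inl (2 * (t - m / 2))

theorem PathPos.emb {V : Type} {G : SimpleGraph V} {S : Set V} {m : ℕ} (h : PathPos G S m) :
    Emb G S 0 (m + 6) := by
  obtain ⟨p, a, b, c⟩ := h
  refine ⟨fun v => pathMap m (p v), ?_, ?_, ?_⟩
  · intro u hu v hv huv
    apply a hu hv
    have := c u hu
    have := c v hv
    simp only [pathMap] at huv
    split_ifs at huv <;> simp only [Sum.inl.injEq, Sum.inr.injEq, reduceCtorEq] at huv <;> omega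
  · intro u hu v hv
    rw [b u hu v hv]
    have := c u hu
    have := c v hv
    simp only [pathMap]
    split_ifs <;> simp only [stripAdj, iff_false] <;> omega
  · intro v hv
    have := c v hv
    simp only [pathMap]
    split_ifs <;> simp only [inWin] <;> omega

theorem PathPos.union {V : Type} {G : SimpleGraph V} {S K : Set V} {m k : ℕ}
    (h : PathPos G S m) (h' : PathPos G K k)
    (hd : ∀ u ∈ S, u ∉ K)
    (hn : ∀ u ∈ S, ∀ v ∈ K, ¬ G.Adj u v) : PathPos G (S ∪ K) (m + 1 + k) := by
  classical
  obtain ⟨f, a, b, c⟩ := h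
  obtain ⟨f', a', b', c'⟩ := h'
  have e1 : ∀ v ∈ S, (if v ∈ K then m + 1 + f' v else f v) = f v := fun v hv => if_neg (hd v hv)
  have e2 : ∀ v ∈ K, (if v ∈ K then m + 1 + f' v else f v) = m + 1 + f' v :=
    fun v hv => if_pos hv
  refine ⟨fun v => if v ∈ K then m + 1 + f' v else f v, ?_, ?_, ?_⟩
  · rintro u (hu | hu) v (hv | hv) huv <;> dsimp only at huv
    · rw [e1 u hu, e1 v hv] at huv; exact a hu hv huv
    · rw [e1 u hu, e2 v hv] at huv
      have := c u hu; omega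
    · rw [e2 u hu, e1 v hv] at huv
      have := c v hv; omega
    · rw [e2 u hu, e2 v hv] at huv; exact a' hu hv (by omega)
  · rintro u (hu | hu) v (hv | hv) <;> dsimp only
    · rw [e1 u hu, e1 v hv]; exact b u hu v hv
    · rw [e1 u hu, e2 v hv]
      have := c u hu
      exact iff_of_false (hn u hu v hv) (by omega)
    · rw [e2 u hu, e1 v hv]
      have := c v hv
      exact iff_of_false (fun h => hn v hv u hu h.symm) (by omega)
    · rw [e2 u hu, e2 v hv, b' u hu v hv]; omega
  · rintro v (hv | hv) <;> dsimp only
    · rw [e1 v hv]; have := c v hv; omega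
    · rw [e2 v hv]; have := c' v hv; omega

/-- structure of components -/
theorem comp_struct {V : Type} [Finite V] (G : SimpleGraph V)
    (hG : ∀ v, (G.neighborSet v).ncard ≤ 2) (C : G.ConnectedComponent)
    (hC : 10 ≤ C.supp.ncard) :
    PathPos G C.supp C.supp.ncard ∨ CycPos G C.supp C.supp.ncard := by
  classical
  have := Fintype.ofFinite V
  obtain ⟨v0, hv0⟩ := C.nonempty_supp
  -- longest path
  have hex : ∃ L, (∃ (u v : V) (p : G.Walk u v), p.IsPath ∧ u ∈ C.supp ∧ p.length = L) ∧
      ∀ (u v : V) (p : G.Walk u v), p.IsPath → u ∈ C.supp → p.length ≤ L := by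
    let P : ℕ → Prop := fun L =>
      ∃ (u v : V) (p : G.Walk u v), p.IsPath ∧ u ∈ C.supp ∧ p.length = L
    have hP0 : P 0 := ⟨v0, v0, SimpleGraph.Walk.nil, by simp, hv0, rfl⟩
    have hb : ∀ L, P L → L ≤ Fintype.card V := by
      rintro L ⟨u, v, p, hp, _, rfl⟩
      exact hp.length_lt.le
    refine ⟨Nat.findGreatest P (Fintype.card V), Nat.findGreatest_spec (Nat.zero_le _) hP0, ?_⟩
    intro u v p hp hu
    exact Nat.le_findGreatest hp.length_lt.le ⟨u, v, p, hp, hu, rfl⟩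
  obtain ⟨L, ⟨u, v, p, hp, hu, hL⟩, hmax⟩ := hex
  set x : ℕ → V := p.getVert with hx
  have hinj : ∀ i ≤ L, ∀ j ≤ L, x i = x j → i = j := by
    intro i hi j hj hij
    exact hp.getVert_injOn (by simpa [hL] using hi) (by simpa [hL] using hj) hij
  have hadj : ∀ i, i < L → G.Adj (x i) (x (i + 1)) := by
    intro i hi
    exact p.adj_getVert_succ (by omega)
  have hmem : ∀ w, w ∈ p.support ↔ ∃ i ≤ L, x i = w := by
    intro w
    rw [SimpleGraph.Walk.mem_support_iff_exists_getVert]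
    constructor
    · rintro ⟨i, h1, h2⟩; exact ⟨i, by omega, h1⟩
    · rintro ⟨i, h1, h2⟩; exact ⟨i, h2, by omega⟩
  -- interior
  have hint : ∀ i, 0 < i → i < L → ∀ w, G.Adj (x i) w → w = x (i - 1) ∨ w = x (i + 1) := by
    intro i h0 hi w hw
    by_contra! hcon
    have hA : G.Adj (x i) (x (i - 1)) := by
      have := hadj (i - 1) (by omega)
      rw [Nat.sub_add_cancel h0] at this
      exact this.symm
    have hB := hadj i hi
    have hne : x (i - 1) ≠ x (i + 1) := fun h => by
      have := hinj _ (by omega) _ (by omega) h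
      omega
    have hsub : ({w, x (i - 1), x (i + 1)} : Set V) ⊆ G.neighborSet (x i) := by
      rintro y (rfl | rfl | rfl)
      · exact hw
      · exact hA
      · exact hB
    have h3 : ({w, x (i - 1), x (i + 1)} : Set V).ncard = 3 :=
      Set.ncard_eq_three.mpr ⟨_, _, _, hcon.1, hcon.2, hne, rfl⟩
    have := Set.ncard_le_ncard hsub (Set.toFinite _)
    have := hG (x i)
    omega
  have hx0 : x 0 = u := p.getVert_zero
  have hxL : x L = v := by rw [hx, ← hL]; exact p.getVert_length
  have hclosed : ∀ i ≤ L, ∀ w, G.Adj (x i) w → ∃ j ≤ L, x j = w := by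
    intro i hi w hw
    by_contra hcon
    have hns : w ∉ p.support := fun h => hcon ((hmem w).1 h)
    rcases Nat.eq_zero_or_pos i with rfl | h0
    · rw [hx0] at hw
      have h1 : (SimpleGraph.Walk.cons hw.symm p).IsPath :=
        (SimpleGraph.Walk.cons_isPath_iff _ _).2 ⟨hp, hns⟩
      have h2 := hmax _ _ _ h1 (by
        rw [SimpleGraph.ConnectedComponent.mem_supp_iff] at hu ⊢
        rw [← hu]
        exact SimpleGraph.ConnectedComponent.sound hw.symm.reachable)
      rw [SimpleGraph.Walk.length_cons] at h2
      omega
    · rcases Nat.lt_or_ge i L with h1 | h1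
      · rcases hint i h0 h1 w hw with h | h
        · exact hcon ⟨i - 1, by omega, h.symm⟩
        · exact hcon ⟨i + 1, by omega, h.symm⟩
      · have : i = L := by omega
        subst this
        rw [hxL] at hw
        have h1 : (p.concat hw).IsPath := hp.concat hns hw
        have h2 := hmax _ _ _ h1 hu
        rw [SimpleGraph.Walk.length_concat] at h2
        omega
  have hcov : ∀ w ∈ C.supp, ∃ i ≤ L, x i = w := by
    intro w hw
    rw [SimpleGraph.ConnectedComponent.mem_supp_iff] at hw hu
    have hr : G.Reachable u w := SimpleGraph.ConnectedComponent.exact (hu.trans hw.symm)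
    rw [SimpleGraph.reachable_iff_reflTransGen] at hr
    induction hr with
    | refl => exact ⟨0, by omega, hx0⟩
    | tail hab hbc ih =>
      rename_i b c
      have hb : G.connectedComponentMk b = C := by
        rw [← hw]; exact SimpleGraph.ConnectedComponent.sound hbc.reachable
      obtain ⟨i, hi, rfl⟩ := ih hb
      exact hclosed i hi _ hbc
  have hin : ∀ i ≤ L, x i ∈ C.supp := by
    intro i hi
    rw [SimpleGraph.ConnectedComponent.mem_supp_iff] at hu ⊢
    rw [← hu]
    apply SimpleGraph.ConnectedComponent.sound
    exact (p.take i).reachable.symm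
  have hcard : C.supp.ncard = L + 1 := by
    have : C.supp = x '' (Set.Iic L) := by
      ext w
      constructor
      · intro hw
        obtain ⟨i, hi, h⟩ := hcov w hw
        exact ⟨i, hi, h⟩
      · rintro ⟨i, hi, rfl⟩
        exact hin i hi
    have hio : Set.InjOn x (Set.Iic L) := fun i hi j hj h => hinj i hi j hj h
    rw [this, hio.ncard_image]
    rw [← Finset.coe_Iic, Set.ncard_coe_finset]
    simp
  have hchord : ∀ i j, i < j → j ≤ L → G.Adj (x i) (x j) → i + 1 = j ∨ (i = 0 ∧ j = L) := by
    intro i j hij hj h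
    rcases Nat.eq_zero_or_pos i with rfl | h0
    · rcases Nat.lt_or_ge j L with h1 | h1
      · rcases hint j hij h1 _ h.symm with h | h
        · have := hinj _ (by omega) _ (by omega) h; omega
        · have := hinj _ (by omega) _ (by omega) h; omega
      · right; omega
    · rcases hint i h0 (by omega) _ h with h | h
      · have := hinj _ (by omega) _ (by omega) h; omega
      · have := hinj _ (by omega) _ (by omega) h; omega
  have hpos : ∃ q : V → ℕ, ∀ w ∈ C.supp, q w ≤ L ∧ x (q w) = w := by
    refine ⟨fun w => if h : ∃ i ≤ L, x i = w then h.choose else 0, ?_⟩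
    intro w hw
    have h := hcov w hw
    simp only [dif_pos h]
    exact h.choose_spec
  obtain ⟨q, hq⟩ := hpos
  have hqinj : Set.InjOn q C.supp := by
    intro a ha b hb hab
    rw [← (hq a ha).2, ← (hq b hb).2, hab]
  rw [hcard]
  have key : ∀ a ∈ C.supp, ∀ b ∈ C.supp, G.Adj a b → q a + 1 = q b ∨ q b + 1 = q a ∨
      (q a = 0 ∧ q b = L) ∨ (q b = 0 ∧ q a = L) := by
    intro a ha b hb hab
    have hab' := hab
    rw [← (hq a ha).2, ← (hq b hb).2] at hab'
    have h1 := (hq a ha).1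
    have h2 := (hq b hb).1
    rcases lt_trichotomy (q a) (q b) with h | h | h
    · have := hchord _ _ h h2 hab'; omega
    · exact absurd (hqinj ha hb h) hab.ne
    · have := hchord _ _ h h1 hab'.symm; omega
  have key2 : ∀ a ∈ C.supp, ∀ b ∈ C.supp, q a + 1 = q b → G.Adj a b := by
    intro a ha b hb hab
    have h := hadj (q a) (by have := (hq b hb).1; omega)
    rw [hab, (hq a ha).2, (hq b hb).2] at h
    exact h
  by_cases hc : G.Adj (x 0) (x L)
  · right
    refine ⟨q, hqinj, ?_, fun w hw => by have := (hq w hw).1; omega⟩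
    have key3 : ∀ a ∈ C.supp, ∀ b ∈ C.supp, q a = 0 → q b = L → G.Adj a b := by
      intro a ha b hb h1 h2
      rw [← (hq a ha).2, ← (hq b hb).2, h1, h2]
      exact hc
    intro a ha b hb
    constructor
    · intro h
      have := key a ha b hb h
      omega
    · rintro (h | h | ⟨h1, h2⟩ | ⟨h1, h2⟩)
      · exact key2 a ha b hb h
      · exact (key2 b hb a ha h).symm
      · exact key3 a ha b hb h1 (by omega)
      · exact (key3 b hb a ha h1 (by omega)).symm
  · left
    refine ⟨q, hqinj, ?_, fun w hw => by have := (hq w hw).1; omega⟩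
    have key3 : ∀ a ∈ C.supp, ∀ b ∈ C.supp, q a = 0 → q b = L → ¬ G.Adj a b := by
      intro a ha b hb h1 h2
      rw [← (hq a ha).2, ← (hq b hb).2, h1, h2]
      exact hc
    intro a ha b hb
    constructor
    · intro h
      rcases key a ha b hb h with h' | h' | ⟨h1, h2⟩ | ⟨h1, h2⟩
      · exact Or.inl h'
      · exact Or.inr h'
      · exact absurd h (key3 a ha b hb h1 h2)
      · exact absurd h.symm (key3 b hb a ha h1 h2)
    · rintro (h | h)
      · exact key2 a ha b hb h
      · exact (key2 b hb a ha h).symm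

def compSet {V : Type} (G : SimpleGraph V) (T : Finset G.ConnectedComponent) : Set V :=
  {v | G.connectedComponentMk v ∈ T}

theorem compSet_insert {V : Type} (G : SimpleGraph V) [DecidableEq G.ConnectedComponent]
    (T : Finset G.ConnectedComponent) (C : G.ConnectedComponent) :
    compSet G (insert C T) = compSet G T ∪ C.supp := by
  ext v
  simp only [compSet, Set.mem_ofPred_eq, Finset.mem_insert, Set.mem_union,
    SimpleGraph.ConnectedComponent.mem_supp_iff]
  tauto

theorem compSet_sep {V : Type} (G : SimpleGraph V)
    (T : Finset G.ConnectedComponent) (C : G.ConnectedComponent) (hC : C ∉ T) :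
    (∀ u ∈ compSet G T, u ∉ C.supp) ∧ ∀ u ∈ compSet G T, ∀ v ∈ C.supp, ¬ G.Adj u v := by
  constructor
  · intro u hu h
    rw [SimpleGraph.ConnectedComponent.mem_supp_iff] at h
    simp only [compSet, Set.mem_ofPred_eq, h] at hu
    exact hC hu
  · intro u hu v h hadj
    rw [SimpleGraph.ConnectedComponent.mem_supp_iff] at h
    simp only [compSet, Set.mem_ofPred_eq] at hu
    rw [SimpleGraph.ConnectedComponent.sound hadj.reachable, h] at hu
    exact hC hu

theorem phase1 {V : Type} (G : SimpleGraph V) (T : Finset G.ConnectedComponent)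
    (hT : ∀ C ∈ T, 10 ≤ C.supp.ncard ∧ PathPos G C.supp C.supp.ncard) :
    ∃ m, PathPos G (compSet G T) m ∧ 10 * m ≤ 11 * ∑ C ∈ T, C.supp.ncard := by
  classical
  induction T using Finset.induction_on with
  | empty =>
    refine ⟨0, ⟨fun _ => 0, ?_, ?_, ?_⟩, by simp⟩
    · intro a ha; simp [compSet] at ha
    · intro a ha; simp [compSet] at ha
    · intro a ha; simp [compSet] at ha
  | insert C T hC ih =>
    obtain ⟨m, h1, h2⟩ := ih (fun D hD => hT D (Finset.mem_insert_of_mem hD))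
    obtain ⟨h3, h4⟩ := hT C (Finset.mem_insert_self _ _)
    obtain ⟨h5, h6⟩ := compSet_sep G T C hC
    refine ⟨_, by rw [compSet_insert]; exact h1.union h4 h5 h6, ?_⟩
    rw [Finset.sum_insert hC]
    omega

theorem phase2 {V : Type} (G : SimpleGraph V) [DecidableEq G.ConnectedComponent]
    (T0 T : Finset G.ConnectedComponent) (hd : Disjoint T0 T) (t0 : ℕ) (ht0 : t0 % 3 = 2)
    (h0 : Emb G (compSet G T0) 0 t0)
    (hT : ∀ C ∈ T, 10 ≤ C.supp.ncard ∧ C.supp.ncard % 3 = 2 ∧ CycPos G C.supp C.supp.ncard) :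
    ∃ t, t % 3 = 2 ∧ Emb G (compSet G (T ∪ T0)) 0 t ∧
      10 * t ≤ 10 * t0 + 11 * ∑ C ∈ T, C.supp.ncard := by
  induction T using Finset.induction_on with
  | empty => exact ⟨t0, ht0, by simpa using h0, by simp⟩
  | insert C T hC ih =>
    rw [Finset.disjoint_insert_right] at hd
    obtain ⟨t, ht, h1, h2⟩ := ih hd.2 (fun D hD => hT D (Finset.mem_insert_of_mem hD))
    obtain ⟨h3, h3', h4⟩ := hT C (Finset.mem_insert_self _ _)
    have hC' : C ∉ T ∪ T0 := by simp [hC, hd.1]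
    obtain ⟨h5, h6⟩ := compSet_sep G _ C hC'
    refine ⟨t + C.supp.ncard + 1, by omega, ?_, ?_⟩
    · rw [Finset.insert_union, compSet_insert]
      have h7 := h4.emb (s := t) h3 (by omega) (by omega) (by omega)
      exact (h1.union h7 (by omega) (by omega) h5 h6).mono le_rfl (by omega)
    · rw [Finset.sum_insert hC]
      omega

theorem phase3 {V : Type} (G : SimpleGraph V) [DecidableEq G.ConnectedComponent]
    (T0 T : Finset G.ConnectedComponent) (hd : Disjoint T0 T) (t0 : ℕ) (ht0 : t0 % 3 ≠ 1)
    (ht1 : 1 ≤ t0)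
    (h0 : Emb G (compSet G T0) 0 t0)
    (hT : ∀ C ∈ T, 10 ≤ C.supp.ncard ∧ C.supp.ncard % 3 ≠ 2 ∧ CycPos G C.supp C.supp.ncard) :
    ∃ t, t % 3 ≠ 1 ∧ 1 ≤ t ∧ Emb G (compSet G (T ∪ T0)) 0 t ∧
      10 * t ≤ 10 * t0 + 11 * ∑ C ∈ T, C.supp.ncard := by
  induction T using Finset.induction_on with
  | empty => exact ⟨t0, ht0, ht1, by simpa using h0, by simp⟩
  | insert C T hC ih =>
    rw [Finset.disjoint_insert_right] at hd
    obtain ⟨t, ht, ht', h1, h2⟩ := ih hd.2 (fun D hD => hT D (Finset.mem_insert_of_mem hD))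
    obtain ⟨h3, h3', h4⟩ := hT C (Finset.mem_insert_self _ _)
    have hC' : C ∉ T ∪ T0 := by simp [hC, hd.1]
    obtain ⟨h5, h6⟩ := compSet_sep G _ C hC'
    have hch : ∃ s t', t ≤ s ∧ s + C.supp.ncard ≤ t' ∧ t' ≤ t + C.supp.ncard + 1 ∧
        s % 3 ≠ 1 ∧ (s + C.supp.ncard - 4) % 3 ≠ 1 ∧ t' % 3 ≠ 1 := by
      generalize C.supp.ncard = k at *
      rcases (by omega : k % 3 = 0 ∨ k % 3 = 1) with hk | hk <;>
        rcases (by omega : t % 3 = 0 ∨ t % 3 = 2) with h | h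
      · exact ⟨t, t + k, by omega, by omega, by omega, by omega, by omega, by omega⟩
      · exact ⟨t + 1, t + k + 1, by omega, by omega, by omega, by omega, by omega, by omega⟩
      · exact ⟨t, t + k + 1, by omega, by omega, by omega, by omega, by omega, by omega⟩
      · exact ⟨t, t + k, by omega, by omega, by omega, by omega, by omega, by omega⟩
    obtain ⟨s, t', g1, g2, g3, g4, g5, g6⟩ := hch
    refine ⟨t', g6, by omega, ?_, ?_⟩
    · rw [Finset.insert_union, compSet_insert]
      have h7 := (h4.emb (s := s) h3 (by omega) g4 g5).mono g1 g2
      exact h1.union h7 (by omega) (by omega) h5 h6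
    · rw [Finset.sum_insert hC]
      omega

theorem main_emb {V : Type} [Fintype V] (G : SimpleGraph V)
    (hG : ∀ v, (G.neighborSet v).ncard ≤ 2)
    (hC : ∀ v, 10 ≤ (G.connectedComponentMk v).supp.ncard) :
    ∃ t, Emb G Set.univ 0 t ∧ 10 * t ≤ 11 * Fintype.card V + 80 := by
  classical
  have hC' : ∀ C : G.ConnectedComponent, 10 ≤ C.supp.ncard := by
    intro C
    induction C using SimpleGraph.ConnectedComponent.ind with
    | _ v => exact hC v
  let A : Finset G.ConnectedComponent :=
    Finset.univ.filter (fun C => PathPos G C.supp C.supp.ncard)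
  let B : Finset G.ConnectedComponent :=
    Finset.univ.filter (fun C => ¬ PathPos G C.supp C.supp.ncard ∧ C.supp.ncard % 3 = 2)
  let D : Finset G.ConnectedComponent :=
    Finset.univ.filter (fun C => ¬ PathPos G C.supp C.supp.ncard ∧ C.supp.ncard % 3 ≠ 2)
  have hAB : Disjoint A B := by
    rw [Finset.disjoint_left]; intro C h1 h2
    simp only [A, B, Finset.mem_filter, Finset.mem_univ, true_and] at h1 h2
    exact h2.1 h1
  have hBD : Disjoint (B ∪ A) D := by
    rw [Finset.disjoint_left]; intro C h1 h2
    simp only [A, B, D, Finset.mem_union, Finset.mem_filter, Finset.mem_univ, true_and] at h1 h2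
    tauto
  have hU : D ∪ (B ∪ A) = Finset.univ := by
    ext C
    simp only [A, B, D, Finset.mem_union, Finset.mem_filter, Finset.mem_univ, true_and]
    tauto
  obtain ⟨m, hm, hm'⟩ := phase1 G A (fun C h => ⟨hC' C, (Finset.mem_filter.1 h).2⟩)
  have hs : ∃ t0, t0 % 3 = 2 ∧ m + 6 ≤ t0 ∧ t0 ≤ m + 8 := by
    rcases (by omega : m % 3 = 0 ∨ m % 3 = 1 ∨ m % 3 = 2) with h | h | h
    · exact ⟨m + 8, by omega, by omega, by omega⟩
    · exact ⟨m + 7, by omega, by omega, by omega⟩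
    · exact ⟨m + 6, by omega, by omega, by omega⟩
  obtain ⟨t0, e1, e2, e3⟩ := hs
  obtain ⟨t1, f1, f2, f3⟩ := phase2 G A B hAB t0 e1 (hm.emb.mono le_rfl e2) (by
    intro C h
    have h := (Finset.mem_filter.1 h).2
    exact ⟨hC' C, h.2, (comp_struct G hG C (hC' C)).resolve_left h.1⟩)
  obtain ⟨t2, g1, g2, g3, g4⟩ := phase3 G (B ∪ A) D hBD t1 (by omega) (by omega) f2 (by
    intro C h
    have h := (Finset.mem_filter.1 h).2
    exact ⟨hC' C, h.2, (comp_struct G hG C (hC' C)).resolve_left h.1⟩)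
  have hsum : ∑ C : G.ConnectedComponent, C.supp.ncard = Fintype.card V := by
    rw [← Finset.card_univ, Finset.card_eq_sum_card_fiberwise
      (f := G.connectedComponentMk) (t := Finset.univ) (by intro x _; simp)]
    apply Finset.sum_congr rfl
    intro C _
    rw [← Set.ncard_coe_finset]
    congr 1
    ext v
    simp [SimpleGraph.ConnectedComponent.mem_supp_iff]
  rw [← hU, Finset.sum_union hBD.symm, Finset.sum_union hAB.symm] at hsum
  refine ⟨t2, ?_, by omega⟩
  rw [hU] at g3
  convert g3 using 1
  ext v
  simp [compSet]

theorem card_filter3 (m : ℕ) : ((Finset.range (3 * m)).filter (fun s => s % 3 ≠ 1)).card = 2 * m := by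
  induction m with
  | zero => simp
  | succ m ih =>
    have : 3 * (m + 1) = 3 * m + 1 + 1 + 1 := by ring
    rw [this, Finset.range_add_one, Finset.range_add_one, Finset.range_add_one,
      Finset.filter_insert, Finset.filter_insert, Finset.filter_insert,
      if_pos (by omega), if_neg (by omega), if_pos (by omega),
      Finset.card_insert_of_notMem (by simp), Finset.card_insert_of_notMem (by simp), ih]
    omega

/-- There is a constant `C > 0` such that for every `n` there is a graph with
at most `11n/6 + C` vertices embedding, as induced subgraphs, all graphs on `n` vertices with
maximum degree at most `2` whose connected components all have at least `10` vertices. -/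
theorem statement14 :
    ∃ C : ℝ, 0 < C ∧ ∀ n : ℕ,
      ∃ (V : Type) (_ : Fintype V) (U : SimpleGraph V),
        (Fintype.card V : ℝ) ≤ 11 * n / 6 + C ∧
        ∀ G : SimpleGraph (Fin n),
          (∀ v : Fin n, (G.neighborSet v).ncard ≤ 2) →
          (∀ v : Fin n, 10 ≤ (G.connectedComponentMk v).supp.ncard) →
          Nonempty (G ↪g U) := by
  refine ⟨20, by norm_num, fun n => ?_⟩
  let m := 11 * n / 30 + 4
  let F : Finset (ℕ ⊕ ℕ) := (Finset.range (3 * m)).disjSum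
    ((Finset.range (3 * m)).filter (fun s => s % 3 ≠ 1))
  refine ⟨{w // w ∈ F}, inferInstance, strip.comap Subtype.val, ?_, ?_⟩
  · have h1 : Fintype.card {w // w ∈ F} = 5 * m := by
      rw [Fintype.card_coe, Finset.card_disjSum, card_filter3, Finset.card_range]
      omega
    rw [h1]
    have h2 : 30 * m ≤ 11 * n + 120 := by simp only [m]; omega
    have h3 : (30 * m : ℝ) ≤ 11 * n + 120 := by exact_mod_cast h2
    push_cast
    linarith
  · intro G hG hC
    obtain ⟨t, ⟨f, a, b, c⟩, ht⟩ := main_emb G hG hC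
    rw [Fintype.card_fin] at ht
    have htm : t ≤ 3 * m := by simp only [m]; omega
    have hF : ∀ v, f v ∈ F := by
      intro v
      have := c v trivial
      rcases h : f v with j | s <;> rw [h] at this <;> simp only [inWin] at this
      · simp only [F, Finset.inl_mem_disjSum, Finset.mem_range]; omega
      · simp only [F, Finset.inr_mem_disjSum, Finset.mem_filter, Finset.mem_range]; omega
    exact ⟨⟨⟨fun v => ⟨f v, hF v⟩, fun u v h => a trivial trivial (congrArg Subtype.val h)⟩,
      fun {u v} => (b u trivial v trivial).symm⟩⟩
end
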